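/- Let ℓ be an odd prime, G a finite ℓ-group, and 1 → ℤ/ℓℤ → G̃ →^π G → 1 a non-split central extension. Let φ: Gal(ℚ̄/ℚ) ↠ G be a surjection with fixed field L of ker φ. For each prime p, let G_p = Gal(L_v/ℚ_p) ⊂ G be the decomposition group at a prime v of L over p, G̃_p = π^{-1}(G_p), and φ_p: Gal(ℚ̄_p/ℚ_p) ↠ G_p the natural quotient map. Then a surjective lift φ̃: Gal(ℚ̄/ℚ) ↠ G̃ of φ exists if and only if for every prime p there exists a homomorphism φ̃_p: Gal(ℚ̄_p/ℚ_p) → G̃_p lifting φ_p through G̃_p → G_p. -/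

import Mathlib

/-- The absolute Galois group of `ℚ`, with its Krull topology. -/
abbrev AbsGaloisGroupQ : Type :=
  AlgebraicClosure ℚ ≃ₐ[ℚ] AlgebraicClosure ℚ

/-- The absolute Galois group of `ℚ_p`, with its Krull topology. -/
abbrev AbsGaloisGroupQp (p : ℕ) [Fact p.Prime] : Type :=
  AlgebraicClosure ℚ_[p] ≃ₐ[ℚ_[p]] AlgebraicClosure ℚ_[p]

namespace EmbeddingProblem
set_option linter.unusedSectionVars false

section kernelIndex
open Polynomial Finset

/-- If `1 + x + ⋯ + x^(ℓ-1) = 0` with `ℓ` prime, then `(x-1)^(ℓ-1)` and `ℓ` are associated. -/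
theorem exists_mul_eq_of_geom_sum_eq_zero {R : Type*} [CommRing R] {ℓ : ℕ} (hℓ : ℓ.Prime) (x : R)
    (hx : ∑ i ∈ range ℓ, x ^ i = 0) :
    ∃ u v : R, (x - 1) ^ (ℓ - 1) = ℓ * u ∧ (ℓ : R) = (x - 1) ^ (ℓ - 1) * v := by
  have : Fact ℓ.Prime := ⟨hℓ⟩
  have h1 : ((X - 1) ^ (ℓ - 1) : (ZMod ℓ)[X]) = ∑ i ∈ range ℓ, X ^ i := by
    have hne : (X - 1 : (ZMod ℓ)[X]) ≠ 0 := by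
      simpa using X_sub_C_ne_zero (1 : ZMod ℓ)
    apply mul_right_cancel₀ hne
    rw [geom_sum_mul, ← pow_succ, Nat.sub_add_cancel hℓ.one_le, sub_pow_char, one_pow]
  have h2 : ∃ U : ℤ[X], (X - 1) ^ (ℓ - 1) - ∑ i ∈ range ℓ, X ^ i = C (ℓ : ℤ) * U := by
    have hker : ((X - 1) ^ (ℓ - 1) - ∑ i ∈ range ℓ, X ^ i : ℤ[X]) ∈
        RingHom.ker (mapRingHom (Int.castRingHom (ZMod ℓ))) := by
      rw [RingHom.mem_ker]
      simp only [map_sub, map_pow, map_sum, coe_mapRingHom, map_X, Polynomial.map_one]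
      rw [h1, sub_self]
    rw [ker_mapRingHom, ZMod.ker_intCastRingHom, Ideal.map_span, Set.image_singleton,
      Ideal.mem_span_singleton] at hker
    exact hker
  obtain ⟨U, hU⟩ := h2
  have hU1 : U.eval 1 = -1 := by
    have := congrArg (eval 1) hU
    have h3 : ℓ - 1 ≠ 0 := by have := hℓ.two_le; omega
    simp [eval_finsetSum, h3] at this
    have h0 : (ℓ : ℤ) ≠ 0 := by exact_mod_cast hℓ.ne_zero
    apply mul_left_cancel₀ h0
    linarith
  obtain ⟨W, hW⟩ : (X - C 1) ∣ U + 1 := by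
    rw [dvd_iff_isRoot]; simp [hU1]
  set u := aeval x U
  set w := aeval x W
  have e1 : (x - 1) ^ (ℓ - 1) = ℓ * u := by
    have := congrArg (aeval x) hU
    simpa [hx] using this
  have e2 : u + 1 = (x - 1) * w := by
    have := congrArg (aeval x) hW
    simpa using this
  have e3 := mul_neg_geom_sum ((x - 1) * w) (ℓ - 1)
  refine ⟨u, ℓ * w ^ (ℓ - 1) - ∑ i ∈ range (ℓ - 1), ((x - 1) * w) ^ i, e1, ?_⟩
  have e4 : u * (ℓ * w ^ (ℓ - 1) - ∑ i ∈ range (ℓ - 1), ((x - 1) * w) ^ i) = 1 := by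
    rw [mul_pow, e1, ← e2] at e3
    rw [← e2]
    linear_combination e3
  rw [e1, mul_assoc, e4, mul_one]

theorem index_range_comp_mul {C : Type*} [AddCommGroup C] (f g : C →+ C) [Finite f.ker]
    [Finite g.ker] :
    (f.comp g).range.index * Nat.card f.ker * Nat.card g.ker =
      f.range.index * g.range.index * Nat.card (f.comp g).ker := by
  have h1 : (f.comp g).range.index = (g.range ⊔ f.ker).index * f.range.index := by
    rw [AddMonoidHom.range_comp, AddSubgroup.index_map]
  have h2 : g.range.relIndex (g.range ⊔ f.ker) * (g.range ⊔ f.ker).index = g.range.index :=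
    AddSubgroup.relIndex_mul_index le_sup_left
  rw [AddSubgroup.relIndex_sup_left] at h2
  have h3 : Nat.card (g.range ⊓ f.ker : AddSubgroup C) * g.range.relIndex f.ker
      = Nat.card f.ker := by
    rw [← AddSubgroup.inf_relIndex_right, ← AddSubgroup.relIndex_bot_left,
      ← AddSubgroup.relIndex_bot_left]
    exact AddSubgroup.relIndex_mul_relIndex _ _ _ bot_le inf_le_right
  have h4 : Nat.card (f.comp g).ker = Nat.card g.ker * Nat.card (g.range ⊓ f.ker : AddSubgroup C) := by
    rw [← AddMonoidHom.comap_ker, ← AddSubgroup.relIndex_bot_left,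
      ← AddSubgroup.relIndex_bot_left, ← AddSubgroup.relIndex_bot_left,
      ← AddSubgroup.relIndex_mul_relIndex ⊥ g.ker (f.ker.comap g) bot_le]
    · rw [← AddMonoidHom.comap_bot g, AddSubgroup.relIndex_comap, AddSubgroup.map_comap_eq]
    · rw [← AddMonoidHom.comap_bot g]; exact AddSubgroup.comap_mono bot_le
  rw [h1, h4, ← h3, ← h2]
  ring

theorem finite_ker_comp {C : Type*} [AddCommGroup C] (f g : C →+ C) [Finite f.ker]
    [Finite g.ker] : Finite (f.comp g).ker := by
  rw [← AddMonoidHom.comap_ker]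
  have : Set.Finite ((g : C → C) ⁻¹' (f.ker : Set C)) := by
    apply Set.Finite.preimage' (Set.toFinite _)
    intro b _
    by_cases hb : ∃ c, g c = b
    · obtain ⟨c, rfl⟩ := hb
      have : Set.Finite ((fun x => x + c) '' (g.ker : Set C)) := (Set.toFinite _).image _
      refine this.subset ?_
      intro y hy
      refine ⟨y - c, ?_, by simp⟩
      simp only [Set.mem_preimage, Set.mem_singleton_iff] at hy
      simp [AddMonoidHom.mem_ker, hy]
    · convert Set.finite_empty
      ext y
      simp only [Set.mem_preimage, Set.mem_singleton_iff, Set.mem_empty_iff_false, iff_false]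
      exact fun h => hb ⟨y, h⟩
  exact this.to_subtype

theorem index_range_iterate_mul {C : Type*} [AddCommGroup C] (f : C →+ C) (F : ℕ → C →+ C)
    (h0 : F 0 = AddMonoidHom.id C) (hF : ∀ n, F (n + 1) = (F n).comp f) [Finite f.ker] (n : ℕ) :
    Finite (F n).ker ∧
    (F n).range.index * Nat.card f.ker ^ n = f.range.index ^ n * Nat.card (F n).ker := by
  induction n with
  | zero =>
    have h1 : (F 0).ker = ⊥ := by rw [h0]; ext; simp
    have h2 : (F 0).range = ⊤ := by rw [h0]; ext; simp
    rw [h1, h2]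
    exact ⟨inferInstance, by simp⟩
  | succ n ih =>
    obtain ⟨i1, i2⟩ := ih
    have := index_range_comp_mul (F n) f
    have hfin := finite_ker_comp (F n) f
    rw [hF]
    refine ⟨hfin, ?_⟩
    have hpos : 0 < Nat.card (F n).ker := Nat.card_pos
    apply Nat.eq_of_mul_eq_mul_right hpos
    rw [pow_succ, pow_succ]
    linear_combination (Nat.card f.ker) ^ n * this +
      f.range.index * Nat.card ((F n).comp f).ker * i2

end kernelIndex

section powerIndex
open Polynomial Finset Module

theorem index_range_nsmul (A : Type*) [AddCommGroup A] [Module.Finite ℤ A] {n : ℕ} (hn : n ≠ 0) :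
    Finite (nsmulAddMonoidHom (α := A) n).ker ∧ (nsmulAddMonoidHom (α := A) n).range.index =
      n ^ finrank ℤ A * Nat.card (nsmulAddMonoidHom (α := A) n).ker := by
  have : AddGroup.FG A := Module.Finite.iff_addGroup_fg.1 inferInstance
  obtain ⟨r, ι, _, p, hp, e, ⟨E⟩⟩ := AddCommGroup.equiv_free_prod_directSum_zmod A
  have hne : ∀ i, NeZero (p i ^ e i) := fun i => ⟨pow_ne_zero _ (hp i).ne_zero⟩
  have (i : ι) : Fintype (ZMod (p i ^ e i)) := ZMod.fintype _
  classical
  have : Fintype (DirectSum ι fun i => ZMod (p i ^ e i)) :=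
    Fintype.ofEquiv _ DFinsupp.equivFunOnFintype.symm
  set T := DirectSum ι fun i => ZMod (p i ^ e i)
  set F := Fin r →₀ ℤ
  have hker : (nsmulAddMonoidHom (α := F) n).ker = ⊥ := by
    rw [AddMonoidHom.ker_eq_bot_iff]
    intro x y h
    exact nsmul_right_injective hn h
  have h1 : Nat.card (nsmulAddMonoidHom (α := A) n).ker = Nat.card (nsmulAddMonoidHom (α := T) n).ker ∧ Finite (nsmulAddMonoidHom (α := A) n).ker := by
    have E' : (nsmulAddMonoidHom (α := A) n).ker ≃ (nsmulAddMonoidHom (α := T) n).ker :=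
      { toFun := fun x => ⟨(E x).2, by
          have := x.2
          rw [AddMonoidHom.mem_ker] at this ⊢
          have h := congrArg (fun y => (E y).2) this
          simpa using h⟩
        invFun := fun y => ⟨E.symm (0, y), by
          have := y.2
          rw [AddMonoidHom.mem_ker] at this ⊢
          apply E.injective
          simp only [nsmulAddMonoidHom_apply, map_nsmul, AddEquiv.apply_symm_apply, map_zero] at this ⊢
          ext1 <;> simp [this]⟩
        left_inv := fun x => by
          ext
          apply E.injective
          have := x.2
          rw [AddMonoidHom.mem_ker] at this
          have h := congrArg (fun y => (E y).1) this
          simp only [nsmulAddMonoidHom_apply, map_nsmul, Prod.smul_fst, map_zero, Prod.fst_zero] at h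
          have h' : (E x).1 = 0 := nsmul_right_injective hn (by simpa using h)
          simp only [AddEquiv.apply_symm_apply]
          ext1
          · simp [h']
          · rfl
        right_inv := fun y => by ext; simp }
    exact ⟨Nat.card_congr E', Finite.of_equiv _ E'.symm⟩
  have h2 : (nsmulAddMonoidHom (α := A) n).range.index = (nsmulAddMonoidHom (α := F) n).range.index *
      (nsmulAddMonoidHom (α := T) n).range.index := by
    rw [← AddSubgroup.index_prod, ← AddSubgroup.index_map_equiv _ E]
    congr 1
    ext ⟨x, y⟩
    simp only [AddSubgroup.mem_map, AddMonoidHom.mem_range, AddSubgroup.mem_prod]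
    constructor
    · rintro ⟨_, ⟨a, rfl⟩, h⟩
      simp only [nsmulAddMonoidHom_apply, AddMonoidHom.coe_coe, map_nsmul] at h
      exact ⟨⟨(E a).1, by simpa using congrArg Prod.fst h⟩, ⟨(E a).2, by simpa using congrArg Prod.snd h⟩⟩
    · rintro ⟨⟨a, h⟩, ⟨c, h'⟩⟩
      refine ⟨_, ⟨E.symm (a, c), rfl⟩, ?_⟩
      simp only [nsmulAddMonoidHom_apply] at h h'
      ext1 <;> simp [h, h']
  have h3 : (nsmulAddMonoidHom (α := T) n).range.index = Nat.card (nsmulAddMonoidHom (α := T) n).ker := by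
    have h := AddSubgroup.index_ker (nsmulAddMonoidHom (α := T) n)
    have h4 := AddSubgroup.card_mul_index (nsmulAddMonoidHom (α := T) n).range
    have h5 := AddSubgroup.card_mul_index (nsmulAddMonoidHom (α := T) n).ker
    rw [h, ← h4, mul_comm] at h5
    exact (Nat.eq_of_mul_eq_mul_left Nat.card_pos h5).symm
  have h6 : finrank ℤ A = r := by
    rw [E.toIntLinearEquiv.finrank_eq, ← Submodule.finrank_quotient_add_finrank (LinearMap.range (LinearMap.inl ℤ F T))]
    have e1 : finrank ℤ (LinearMap.range (LinearMap.inl ℤ F T)) = r := by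
      rw [LinearMap.finrank_range_of_inj LinearMap.inl_injective]
      simp [F]
    have e2 : Finite ((F × T) ⧸ LinearMap.range (LinearMap.inl ℤ F T)) := by
      rw [LinearMap.range_inl]
      exact Finite.of_equiv _ (LinearMap.quotKerEquivOfSurjective (LinearMap.snd ℤ F T) LinearMap.snd_surjective).symm.toEquiv
    have e3 : finrank ℤ ((F × T) ⧸ LinearMap.range (LinearMap.inl ℤ F T)) = 0 := by
      apply Module.finrank_eq_zero_of_rank_eq_zero
      rw [rank_eq_zero_iff]
      intro x
      obtain ⟨m, hm, h⟩ := (isOfFinAddOrder_of_finite x).exists_nsmul_eq_zero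
      exact ⟨m, by exact_mod_cast hm.ne', by simpa using h⟩
    rw [e1, e3, zero_add]
  refine ⟨h1.2, ?_⟩
  rw [h2, h1.1, h3, h6]
  congr 1
  have := AddSubgroup.index_range_nsmul F n
  simpa [F] using this

end powerIndex

section cyclicActionIndex
open Polynomial Finset Module

/-- An endomorphism `s` with `1 + s + ⋯ + s^(ℓ-1) = 0` on a finitely generated abelian group. -/
theorem index_range_sub_one_pow {C : Type*} [AddCommGroup C] [Module.Finite ℤ C] {ℓ : ℕ}
    (hℓ : ℓ.Prime) (s : Module.End ℤ C) (hs : ∑ i ∈ range ℓ, s ^ i = 0) :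
    Finite (s - 1).toAddMonoidHom.ker ∧ (s - 1).toAddMonoidHom.range.index ^ (ℓ - 1) =
      ℓ ^ finrank ℤ C * Nat.card (s - 1).toAddMonoidHom.ker ^ (ℓ - 1) := by
  obtain ⟨u, v, hu, hv, hcomm⟩ : ∃ u v : Module.End ℤ C, (s - 1) ^ (ℓ - 1) = ℓ • u ∧
      (ℓ • 1 : Module.End ℤ C) = (s - 1) ^ (ℓ - 1) * v ∧ Commute (s - 1) v := by
    let R := Algebra.adjoin ℤ {s}
    have : IsMulCommutative R := Algebra.isMulCommutative_adjoin ℤ (by simp)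
    let _ : CommRing R := inferInstance
    let x : R := ⟨s, Algebra.subset_adjoin rfl⟩
    obtain ⟨u, v, hu, hv⟩ := exists_mul_eq_of_geom_sum_eq_zero hℓ x (by
      apply Subtype.ext
      have := hs
      simpa [x] using this)
    refine ⟨u, v, ?_, ?_, ?_⟩
    · have := congrArg (Subtype.val) hu
      simpa [x, nsmul_eq_mul] using this
    · have := congrArg (Subtype.val) hv
      simpa [x, nsmul_eq_mul] using this
    · exact congrArg Subtype.val (mul_comm (x - 1) v)
  set D := (s - 1) with hD
  have hr : (D ^ (ℓ - 1)).toAddMonoidHom.range = (nsmulAddMonoidHom (α := C) ℓ).range := by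
    apply le_antisymm
    · rintro _ ⟨x, rfl⟩
      refine ⟨u x, ?_⟩
      simp [hu]
    · rintro _ ⟨x, rfl⟩
      refine ⟨v x, ?_⟩
      have := congrArg (fun f : Module.End ℤ C => f x) hv
      simpa using this.symm
  have hk : (D ^ (ℓ - 1)).toAddMonoidHom.ker = (nsmulAddMonoidHom (α := C) ℓ).ker := by
    ext x
    simp only [AddMonoidHom.mem_ker, LinearMap.toAddMonoidHom_coe, nsmulAddMonoidHom_apply]
    constructor
    · intro h
      have := congrArg (fun f : Module.End ℤ C => f x) hv
      rw [(hcomm.pow_left _).eq] at this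
      simpa [h] using this
    · intro h
      rw [hu]
      simp [← map_nsmul, h]
  obtain ⟨f1, i1⟩ := index_range_nsmul C hℓ.ne_zero
  have f2 : Finite D.toAddMonoidHom.ker := by
    have : D.toAddMonoidHom.ker ≤ (nsmulAddMonoidHom (α := C) ℓ).ker := by
      rw [← hk]
      intro x hx
      obtain ⟨m, hm⟩ : ∃ m, ℓ - 1 = m + 1 := ⟨ℓ - 2, by have := hℓ.two_le; omega⟩
      simp only [AddMonoidHom.mem_ker, LinearMap.toAddMonoidHom_coe] at hx ⊢
      rw [hm, pow_succ, Module.End.mul_apply, hx, map_zero]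
    exact Set.Finite.subset (Set.toFinite ((nsmulAddMonoidHom (α := C) ℓ).ker : Set C)) this
  refine ⟨f2, ?_⟩
  obtain ⟨f3, i3⟩ := index_range_iterate_mul D.toAddMonoidHom (fun n => (D ^ n).toAddMonoidHom)
    (by simp; rfl) (fun n => by rw [pow_succ]; rfl) (ℓ - 1)
  rw [hr, hk, i1] at i3
  have hpos : 0 < Nat.card (nsmulAddMonoidHom (α := C) ℓ).ker := Nat.card_pos
  apply Nat.eq_of_mul_eq_mul_right hpos
  rw [← i3]; ring

/-- Herbrand quotient computation: a finitely generated abelian group with an endomorphism `s`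
of prime order `ℓ` such that every element of norm zero is of the form `s c - c`. -/
theorem herbrand_index {A : Type*} [AddCommGroup A] [Module.Finite ℤ A] {ℓ : ℕ}
    (hℓ : ℓ.Prime) (s : Module.End ℤ A) (hs : s ^ ℓ = 1)
    (hH : ∀ a, (∑ i ∈ range ℓ, s ^ i) a = 0 → ∃ c, a = s c - c) :
    ((∑ i ∈ range ℓ, s ^ i).toAddMonoidHom.range.relIndex (s - 1).toAddMonoidHom.ker) ^ (ℓ - 1) *
      ℓ ^ finrank ℤ A = ℓ ^ (ℓ * finrank ℤ (LinearMap.ker (s - 1))) := by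
  set N := ∑ i ∈ range ℓ, s ^ i with hN
  have hDN : (s - 1) * N = 0 := by rw [hN, mul_geom_sum, hs, sub_self]
  have hND : N * (s - 1) = 0 := by rw [hN, geom_sum_mul, hs, sub_self]
  set D := s - 1 with hD
  have hsD : Commute s D := by rw [hD]; exact (Commute.refl s).sub_right (Commute.one_right s)
  set C := LinearMap.range D with hC
  set B := LinearMap.ker D with hB
  have hker : LinearMap.ker N = C := by
    ext a
    constructor
    · intro ha
      obtain ⟨c, hc⟩ := hH a ha
      exact ⟨c, by simp [hD, hc]⟩
    · rintro ⟨c, rfl⟩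
      exact congrArg (fun f : Module.End ℤ A => f c) hND
  have hsC : ∀ x ∈ C, s x ∈ C := by
    rintro _ ⟨x, rfl⟩
    exact ⟨s x, by rw [← Module.End.mul_apply, ← Module.End.mul_apply, hsD.eq]⟩
  let t : Module.End ℤ C := s.restrict hsC
  have ht : ∀ (n : ℕ) (x : C), (((t ^ n) x : C) : A) = (s ^ n) x := by
    intro n
    induction n with
    | zero => simp
    | succ n ih => intro x; rw [pow_succ, pow_succ, Module.End.mul_apply, ih]; rfl
  obtain ⟨f1, i1⟩ := index_range_sub_one_pow hℓ t (by
    ext x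
    have : N x = 0 := by
      have := x.2
      exact LinearMap.mem_ker.1 (hker.symm ▸ this)
    rw [LinearMap.zero_apply, LinearMap.sum_apply, Submodule.coe_sum, Submodule.coe_zero, ← this, hN,
      LinearMap.sum_apply]
    exact Finset.sum_congr rfl fun i _ => ht i x)
  -- `N` on `B` is multiplication by `ℓ`
  have hsB : ∀ x ∈ B, s x = x := by
    intro x hx
    have : D x = 0 := hx
    simpa [hD, sub_eq_zero] using this
  have hNB : ∀ x ∈ B, N x = ℓ • x := by
    intro x hx
    have : ∀ i, (s ^ i) x = x := by
      intro i
      induction i with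
      | zero => simp
      | succ n ih => rw [pow_succ, Module.End.mul_apply, hsB x hx, ih]
    simp [hN, LinearMap.sum_apply, this]
  obtain ⟨f2, i2⟩ := index_range_nsmul B hℓ.ne_zero
  -- kernel of `t - 1` on `C`
  have c1 : Nat.card (t - 1).toAddMonoidHom.ker = Nat.card (nsmulAddMonoidHom (α := B) ℓ).ker := by
    refine Nat.card_congr
      { toFun := fun x => ⟨⟨x.1.1, ?_⟩, ?_⟩, invFun := fun x => ⟨⟨x.1.1, ?_⟩, ?_⟩,
        left_inv := fun x => rfl, right_inv := fun x => rfl }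
    · have := x.2
      rw [AddMonoidHom.mem_ker] at this
      exact congrArg Subtype.val this
    · have h2 : x.1.1 ∈ LinearMap.ker N := by rw [hker]; exact x.1.2
      have h3 : x.1.1 ∈ B := by
        have := x.2
        rw [AddMonoidHom.mem_ker] at this
        exact congrArg Subtype.val this
      rw [LinearMap.mem_ker, hNB _ h3] at h2
      rw [AddMonoidHom.mem_ker]
      ext
      exact h2
    · rw [← hker, LinearMap.mem_ker, hNB _ x.1.2]
      exact congrArg Subtype.val x.2
    · rw [AddMonoidHom.mem_ker]
      ext
      exact x.1.2
  -- index computations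
  have hNle : N.toAddMonoidHom.range ≤ B.toAddSubgroup := by
    rintro _ ⟨x, rfl⟩
    exact congrArg (fun f : Module.End ℤ A => f x) hDN
  set LB : AddSubgroup A := (nsmulAddMonoidHom (α := B) ℓ).range.map B.subtype.toAddMonoidHom with hLB
  have hLB' : LB = B.toAddSubgroup.map N.toAddMonoidHom := by
    ext x
    constructor
    · rintro ⟨_, ⟨y, rfl⟩, rfl⟩
      exact ⟨y, y.2, by simpa using hNB y y.2⟩
    · rintro ⟨y, hy, rfl⟩
      exact ⟨_, ⟨⟨y, hy⟩, rfl⟩, by simpa using (hNB y hy).symm⟩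
  have j1 : LB.relIndex B.toAddSubgroup = (nsmulAddMonoidHom (α := B) ℓ).range.index := by
    have : B.toAddSubgroup = (⊤ : AddSubgroup B).map B.subtype.toAddMonoidHom := by
      ext x; simp
    rw [hLB, this, AddSubgroup.relIndex_map_map_of_injective, AddSubgroup.relIndex_top_right]
    exact Subtype.val_injective
  have j2 : LB.relIndex N.toAddMonoidHom.range * N.toAddMonoidHom.range.relIndex B.toAddSubgroup
      = LB.relIndex B.toAddSubgroup := AddSubgroup.relIndex_mul_relIndex _ _ _
        (by rw [hLB', AddMonoidHom.range_eq_map]; exact AddSubgroup.map_mono le_top) hNle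
  have j3 : LB.relIndex N.toAddMonoidHom.range = (B.toAddSubgroup ⊔ C.toAddSubgroup).index := by
    rw [hLB', AddMonoidHom.range_eq_map, AddSubgroup.relIndex_map_map, top_sup_eq, AddSubgroup.relIndex_top_right]
    congr 2
    rw [← hker]
    rfl
  have j4 : (t - 1).toAddMonoidHom.range.index = (B.toAddSubgroup ⊔ C.toAddSubgroup).index := by
    have e1 : (t - 1).toAddMonoidHom.range.map C.subtype.toAddMonoidHom = C.toAddSubgroup.map D.toAddMonoidHom := by
      ext x
      constructor
      · rintro ⟨_, ⟨y, rfl⟩, rfl⟩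
        exact ⟨y, y.2, rfl⟩
      · rintro ⟨y, hy, rfl⟩
        exact ⟨_, ⟨⟨y, hy⟩, rfl⟩, rfl⟩
    have e2 : C.toAddSubgroup = (⊤ : AddSubgroup C).map C.subtype.toAddMonoidHom := by
      ext x; simp
    have e3 : C.toAddSubgroup = (⊤ : AddSubgroup A).map D.toAddMonoidHom := by
      rw [← AddMonoidHom.range_eq_map]; rfl
    have e4 : (C.toAddSubgroup.map D.toAddMonoidHom).relIndex C.toAddSubgroup
       = (t - 1).toAddMonoidHom.range.index := by
      rw [← e1]
      conv_lhs => rw [e2]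
      rw [AddSubgroup.relIndex_map_map_of_injective, AddSubgroup.relIndex_top_right]
      exact Subtype.val_injective
    rw [← e4]
    conv_lhs => 
      arg 2
      rw [e3]
    rw [AddSubgroup.relIndex_map_map, top_sup_eq, AddSubgroup.relIndex_top_right, sup_comm]
    rfl
  have hrk : finrank ℤ C + finrank ℤ B = finrank ℤ A := by
    rw [← Submodule.finrank_quotient_add_finrank B]
    rw [D.quotKerEquivRange.finrank_eq]
  have hkk : D.toAddMonoidHom.ker = B.toAddSubgroup := rfl
  rw [hkk]
  rw [j3, ← j4, j1, i2, ← c1] at j2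
  have hpos : 0 < Nat.card (t - 1).toAddMonoidHom.ker ^ (ℓ - 1) := pow_pos Nat.card_pos _
  set X := N.toAddMonoidHom.range.relIndex B.toAddSubgroup
  have j5 := congrArg (· ^ (ℓ - 1)) j2
  simp only [mul_pow] at j5
  rw [i1] at j5
  apply Nat.eq_of_mul_eq_mul_right hpos
  rw [← hrk, pow_add]
  have : ℓ ^ (ℓ * finrank ℤ B) = (ℓ ^ finrank ℤ B) ^ (ℓ - 1) * ℓ ^ finrank ℤ B := by
    rw [← pow_mul, ← pow_add]
    congr 1
    obtain ⟨k, rfl⟩ : ∃ k, ℓ = k + 1 := ⟨ℓ - 1, by have := hℓ.one_le; omega⟩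
    simp; ring
  rw [this]
  linear_combination ℓ ^ finrank ℤ B * j5

end cyclicActionIndex

section finitePlaces
open Finset Module NumberField IsDedekindDomain WithZero

/-- The finite places of a number field. -/
abbrev Pl (K : Type*) [Field K] := HeightOneSpectrum (𝓞 K)

section ord
variable {K : Type*} [Field K] [NumberField K]

/-- The additive valuation of a nonzero element at a finite place. -/
noncomputable def ord (v : Pl K) (x : Kˣ) : ℤ := - Multiplicative.toAdd (v.valuationOfNeZero x)

theorem valuation_eq_exp (v : Pl K) (x : Kˣ) : v.valuation K (x : K) = exp (-ord v x) := by
  rw [← HeightOneSpectrum.valuationOfNeZero_eq, ord, neg_neg]; rfl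

@[simp] theorem ord_mul (v : Pl K) (x y : Kˣ) : ord v (x * y) = ord v x + ord v y := by
  simp [ord, add_comm]

@[simp] theorem ord_one (v : Pl K) : ord v 1 = 0 := by simp [ord]

@[simp] theorem ord_inv (v : Pl K) (x : Kˣ) : ord v x⁻¹ = - ord v x := by simp [ord]

@[simp] theorem ord_div (v : Pl K) (x y : Kˣ) : ord v (x / y) = ord v x - ord v y := by
  rw [div_eq_mul_inv, ord_mul, ord_inv, sub_eq_add_neg]

@[simp] theorem ord_pow (v : Pl K) (x : Kˣ) (n : ℕ) : ord v (x ^ n) = n * ord v x := by simp [ord]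

@[simp] theorem ord_zpow (v : Pl K) (x : Kˣ) (n : ℤ) : ord v (x ^ n) = n * ord v x := by simp [ord]

theorem ord_prod {ι : Type*} (v : Pl K) (s : Finset ι) (f : ι → Kˣ) :
    ord v (∏ i ∈ s, f i) = ∑ i ∈ s, ord v (f i) := by
  classical
  induction s using Finset.induction_on with
  | empty => simp
  | insert a s ha ih => rw [prod_insert ha, sum_insert ha, ord_mul, ih]

theorem valuation_eq_one_iff (v : Pl K) (x : Kˣ) : v.valuation K (x : K) = 1 ↔ ord v x = 0 := by
  rw [valuation_eq_exp, ← exp_zero, exp_inj]; omega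

theorem valuation_le_one_iff (v : Pl K) (x : Kˣ) : v.valuation K (x : K) ≤ 1 ↔ 0 ≤ ord v x := by
  rw [valuation_eq_exp, ← exp_zero, exp_le_exp]; omega

theorem exists_ord_eq (v : Pl K) (n : ℤ) : ∃ x : Kˣ, ord v x = n := by
  obtain ⟨π, hπ⟩ := v.valuation_exists_uniformizer K
  have h0 : π ≠ 0 := by rintro rfl; rw [map_zero] at hπ; exact exp_ne_zero hπ.symm
  refine ⟨Units.mk0 π h0 ^ n, ?_⟩
  have : ord v (Units.mk0 π h0) = 1 := by
    have := valuation_eq_exp v (Units.mk0 π h0)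
    rw [Units.val_mk0, hπ, exp_inj] at this
    omega
  rw [ord_zpow, this, mul_one]

theorem exists_int_div (x : Kˣ) : ∃ a b : 𝓞 K, a ≠ 0 ∧ b ≠ 0 ∧ (x : K) = algebraMap (𝓞 K) K a / algebraMap (𝓞 K) K b := by
  obtain ⟨a, b, hb, h⟩ := IsFractionRing.div_surjective (A := 𝓞 K) (x : K)
  refine ⟨a, b, ?_, nonZeroDivisors.ne_zero hb, h.symm⟩
  rintro rfl
  exact x.ne_zero (by rw [← h]; simp)

theorem finite_int_valuation_ne_one (a : 𝓞 K) (ha : a ≠ 0) :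
    {v : Pl K | v.valuation K (algebraMap (𝓞 K) K a) ≠ 1}.Finite := by
  refine (Ideal.finite_factors (I := Ideal.span {a}) (by simpa using ha)).subset ?_
  intro v hv
  by_contra h
  apply hv
  rw [HeightOneSpectrum.valuation_eq_one_iff_notMem]
  intro h'
  exact h (by simpa [Ideal.dvd_span_singleton] using h')

theorem finite_ord_ne_zero (x : Kˣ) : {v : Pl K | ord v x ≠ 0}.Finite := by
  obtain ⟨a, b, ha, hb, h⟩ := exists_int_div x
  refine ((finite_int_valuation_ne_one a ha).union (finite_int_valuation_ne_one b hb)).subset ?_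
  intro v hv
  by_contra h'
  simp only [Set.mem_union, Set.mem_ofPred_eq, not_or, not_not] at h'
  apply hv
  rw [← valuation_eq_one_iff, h, map_div₀, h'.1, h'.2, div_one]

theorem exists_unit_of_ord (x : Kˣ) (h : ∀ v, ord v x = 0) :
    ∃ u : (𝓞 K)ˣ, algebraMap (𝓞 K) K u = x := by
  obtain ⟨a, ha⟩ := HeightOneSpectrum.mem_integers_of_valuation_le_one K (x : K) (fun v => by
    rw [valuation_le_one_iff, h v])
  obtain ⟨b, hb⟩ := HeightOneSpectrum.mem_integers_of_valuation_le_one K ((x⁻¹ : Kˣ) : K) (fun v => by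
    rw [valuation_le_one_iff, ord_inv, h v, neg_zero])
  refine ⟨Units.mkOfMulEqOne a b ?_, ha⟩
  apply FaithfulSMul.algebraMap_injective (𝓞 K) K
  rw [map_mul, ha, hb, map_one]; simp

theorem ord_unit (u : (𝓞 K)ˣ) (v : Pl K) : ord v (Units.map (algebraMap (𝓞 K) K : 𝓞 K →* K) u) = 0 := by
  rw [← valuation_eq_one_iff]
  simp only [Units.coe_map, MonoidHom.coe_coe]
  rw [HeightOneSpectrum.valuation_eq_one_iff_notMem]
  intro h
  exact v.isPrime.ne_top (Ideal.eq_top_of_isUnit_mem _ h u.isUnit)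

theorem ord_of_span (v : Pl K) (x : Kˣ) (a : 𝓞 K) (ha : algebraMap (𝓞 K) K a = x) (n : ℕ)
    (J : Ideal (𝓞 K)) (h : Ideal.span {a} = v.asIdeal ^ n * J) (hJ : ¬ v.asIdeal ∣ J) :
    ord v x = n := by
  have h1 := valuation_eq_exp v x
  rw [← ha, HeightOneSpectrum.valuation_of_algebraMap] at h1
  have h2 := (v.intValuation_le_pow_iff_dvd a n).2 (h ▸ dvd_mul_right _ _)
  have h3 : ¬ v.intValuation a ≤ exp (-((n + 1 : ℕ) : ℤ)) := by
    rw [v.intValuation_le_pow_iff_dvd, h, pow_succ]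
    intro h4
    exact hJ ((mul_dvd_mul_iff_left (pow_ne_zero _ v.ne_bot)).1 h4)
  rw [h1, exp_le_exp] at h2 h3
  push_cast at h3
  omega

theorem exists_generator (I : Ideal (𝓞 K)) (hI : I ≠ ⊥) (h : I.IsPrincipal) :
    ∃ (x : Kˣ) (a : 𝓞 K), algebraMap (𝓞 K) K a = x ∧ Ideal.span {a} = I := by
  obtain ⟨a, ha⟩ := h
  have ha0 : a ≠ 0 := by rintro rfl; exact hI (by simp [ha])
  exact ⟨Units.mk0 (algebraMap (𝓞 K) K a) (by simpa using ha0), a, rfl, ha.symm⟩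

theorem not_dvd_of_ne {v w : Pl K} (h : w ≠ v) : ¬ w.asIdeal ∣ v.asIdeal := fun hd =>
  h (HeightOneSpectrum.ext (associated_iff_eq.1 ((Prime.dvd_prime_iff_associated w.prime v.prime).1 hd)))

/-- Every place has a principal power. -/
theorem exists_ord_single (v : Pl K) :
    ∃ n : ℕ, 0 < n ∧ ∃ x : Kˣ, ord v x = n ∧ ∀ w, w ≠ v → ord w x = 0 := by
  let I : nonZeroDivisors (Ideal (𝓞 K)) := ⟨v.asIdeal, mem_nonZeroDivisors_of_ne_zero v.ne_bot⟩
  have hc : ClassGroup.mk0 (I ^ Nat.card (ClassGroup (𝓞 K))) = 1 := by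
    rw [map_pow, pow_card_eq_one']
  rw [ClassGroup.mk0_eq_one_iff] at hc
  obtain ⟨x, a, ha, hs⟩ := exists_generator (v.asIdeal ^ Nat.card (ClassGroup (𝓞 K)))
    (pow_ne_zero _ v.ne_bot) hc
  refine ⟨_, Nat.card_pos, x, ord_of_span v x a ha _ ⊤ (by rw [Ideal.mul_top, hs]) ?_, ?_⟩
  · rw [Ideal.dvd_iff_le, top_le_iff]; exact v.isPrime.ne_top
  · intro w hw
    refine (ord_of_span w x a ha 0 _ (by rw [pow_zero, one_mul]) ?_)
    rw [hs]
    exact fun h => not_dvd_of_ne hw (w.prime.dvd_of_dvd_pow h)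

/-- Outside a suitable finite set `S₀`, every place is principal up to `S₀`. -/
theorem exists_finset_class : ∃ S₀ : Finset (Pl K), ∀ v ∉ S₀, ∃ x : Kˣ, ord v x = 1 ∧
    ∀ w ∉ S₀, w ≠ v → ord w x = 0 := by
  choose I hI using (ClassGroup.mk0_surjective (R := 𝓞 K))
  have hfin : (⋃ C, {v : Pl K | v.asIdeal ∣ (I C : Ideal (𝓞 K))}).Finite := by
    apply Set.finite_iUnion
    intro C
    exact Ideal.finite_factors (nonZeroDivisors.coe_ne_zero _)
  refine ⟨hfin.toFinset, ?_⟩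
  intro v hv
  simp only [Set.Finite.mem_toFinset, Set.mem_iUnion, Set.mem_ofPred_eq, not_exists] at hv ⊢
  let V : nonZeroDivisors (Ideal (𝓞 K)) := ⟨v.asIdeal, mem_nonZeroDivisors_of_ne_zero v.ne_bot⟩
  set C := (ClassGroup.mk0 V)⁻¹ with hC
  have hc : ClassGroup.mk0 (V * I C) = 1 := by rw [map_mul, hI, hC, mul_inv_cancel]
  rw [ClassGroup.mk0_eq_one_iff] at hc
  obtain ⟨x, a, ha, hs⟩ := exists_generator (v.asIdeal * (I C : Ideal (𝓞 K)))
    (mul_ne_zero v.ne_bot (nonZeroDivisors.coe_ne_zero _)) hc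
  refine ⟨x, ?_, ?_⟩
  · exact_mod_cast ord_of_span v x a ha 1 _ (by rw [pow_one, hs]) (hv C)
  · intro w hw hwv
    refine (ord_of_span w x a ha 0 _ (by rw [pow_zero, one_mul]) ?_)
    rw [hs]
    intro h
    rcases w.prime.dvd_or_dvd h with h | h
    · exact not_dvd_of_ne hwv h
    · exact hw C h

end ord

end finitePlaces

section sUnitGroups
open Finset Module NumberField IsDedekindDomain WithZero

section sunits
variable {K : Type*} [Field K] [NumberField K]

/-- The group of `S`-units of a number field. -/
def sUnits (S : Finset (Pl K)) : Subgroup Kˣ where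
  carrier := {x | ∀ v ∉ S, ord v x = 0}
  mul_mem' {x y} hx hy v hv := by rw [ord_mul, hx v hv, hy v hv, add_zero]
  one_mem' v _ := ord_one v
  inv_mem' {x} hx v hv := by rw [ord_inv, hx v hv, neg_zero]

theorem mem_sUnits {S : Finset (Pl K)} {x : Kˣ} : x ∈ sUnits S ↔ ∀ v ∉ S, ord v x = 0 := Iff.rfl

theorem sUnits_mono {S T : Finset (Pl K)} (h : S ⊆ T) : sUnits S ≤ sUnits T :=
  fun _ hx v hv => hx v (fun hS => hv (h hS))

/-- The vector of valuations of an `S`-unit. -/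
noncomputable def sUnitsOrd (S : Finset (Pl K)) : Additive (sUnits S) →ₗ[ℤ] (S → ℤ) :=
  AddMonoidHom.toIntLinearMap
    { toFun := fun x v => ord v.1 (Additive.toMul x).1
      map_zero' := by ext; simp
      map_add' := fun x y => by ext; simp }

theorem sUnitsOrd_apply (S : Finset (Pl K)) (x : Additive (sUnits S)) (v : S) :
    sUnitsOrd S x v = ord v.1 (Additive.toMul x).1 := rfl

/-- The kernel of `sUnitsOrd` is the unit group. -/
noncomputable def unitsEquivKer (S : Finset (Pl K)) :
    Additive (𝓞 K)ˣ ≃ₗ[ℤ] LinearMap.ker (sUnitsOrd S) :=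
  AddEquiv.toIntLinearEquiv <| AddEquiv.ofBijective (AddMonoidHom.mk' (M := Additive (𝓞 K)ˣ)
      (G := LinearMap.ker (sUnitsOrd S)) (fun u => ⟨Additive.ofMul ⟨Units.map (algebraMap (𝓞 K) K : 𝓞 K →* K) u.toMul,
          fun v _ => ord_unit _ v⟩, by ext v; exact ord_unit _ v.1⟩) (fun x y => by
      apply Subtype.ext; apply Additive.toMul.injective; ext; simp)) (by
    constructor
    · intro x y h
      have h1 := congrArg (fun z : LinearMap.ker (sUnitsOrd S) => (z.1.toMul.1 : K)) h
      apply Additive.toMul.injective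
      ext
      exact h1
    · rintro ⟨x, hx⟩
      obtain ⟨u, hu⟩ := exists_unit_of_ord x.toMul.1 (fun v => by
        by_cases hv : v ∈ S
        · exact congrFun hx ⟨v, hv⟩
        · exact x.toMul.2 v hv)
      refine ⟨Additive.ofMul u, ?_⟩
      apply Subtype.ext
      apply Additive.toMul.injective
      ext
      exact hu)

instance (S : Finset (Pl K)) : Module.Finite ℤ (Additive (sUnits S)) := by
  have h1 : Module.Finite ℤ (LinearMap.ker (sUnitsOrd S)) := Module.Finite.equiv (unitsEquivKer S)
  have h2 : Module.Finite ℤ (Additive (sUnits S) ⧸ LinearMap.ker (sUnitsOrd S)) :=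
    Module.Finite.equiv (sUnitsOrd S).quotKerEquivRange.symm
  exact Module.Finite.of_submodule_quotient (LinearMap.ker (sUnitsOrd S))

theorem finrank_range_sUnitsOrd (S : Finset (Pl K)) : finrank ℤ (LinearMap.range (sUnitsOrd S)) = S.card := by
  classical
  choose n hn x hx hx' using (exists_ord_single (K := K))
  have h1 := Submodule.finrank_quotient_add_finrank (LinearMap.range (sUnitsOrd S))
  have h2 : finrank ℤ ((S → ℤ) ⧸ LinearMap.range (sUnitsOrd S)) = 0 := by
    apply Module.finrank_eq_zero_of_rank_eq_zero
    rw [rank_eq_zero_iff]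
    intro q
    obtain ⟨f, rfl⟩ := Submodule.mkQ_surjective _ q
    refine ⟨∏ v : S, (n v.1 : ℤ), prod_ne_zero_iff.2 (fun v _ => by exact_mod_cast (hn v.1).ne'), ?_⟩
    rw [← map_smul, Submodule.mkQ_apply, Submodule.Quotient.mk_eq_zero]
    have hy : ∀ v : S, x v.1 ∈ sUnits S := fun v w hw => hx' _ _ (fun h => hw (h ▸ v.2))
    refine ⟨∑ v : S, (f v * ∏ w ∈ univ.erase v, (n w.1 : ℤ)) • Additive.ofMul ⟨x v.1, hy v⟩, ?_⟩
    ext w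
    rw [map_sum, Finset.sum_apply, sum_eq_single w]
    · rw [map_smul, Pi.smul_apply, sUnitsOrd_apply]
      simp only [toMul_ofMul, hx, smul_eq_mul, Pi.smul_apply]
      rw [mul_assoc, prod_erase_mul _ _ (mem_univ w), mul_comm]
    · intro v _ hv
      rw [map_smul, Pi.smul_apply, sUnitsOrd_apply]
      simp only [toMul_ofMul]
      rw [hx' _ _ (fun h => hv (Subtype.ext h.symm)), smul_zero]
    · simp
  rw [h2, zero_add] at h1
  rw [h1]; simp

theorem finrank_sUnits (S : Finset (Pl K)) :
    finrank ℤ (Additive (sUnits S)) = NumberField.Units.rank K + S.card := by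
  rw [← Submodule.finrank_quotient_add_finrank (LinearMap.ker (sUnitsOrd S)),
    (sUnitsOrd S).quotKerEquivRange.finrank_eq, ← (unitsEquivKer S).finrank_eq,
    NumberField.Units.finrank_eq, finrank_range_sUnitsOrd, add_comm]

end sunits

theorem units_rank_of_rootOfUnity {K : Type*} [Field K] [NumberField K] {ℓ : ℕ} (hℓ : 2 < ℓ) {ζ : K}
    (hζ : IsPrimitiveRoot ζ ℓ) : 2 * (NumberField.Units.rank K + 1) = finrank ℚ K := by
  have h : IsTotallyComplex K := by
    rw [← nrRealPlaces_eq_zero_iff]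
    exact NumberField.InfinitePlace.IsPrimitiveRoot.nrRealPlaces_eq_zero_of_two_lt hℓ hζ
  have h1 := IsTotallyComplex.finrank K
  have h2 : NumberField.Units.rank K + 1 = Fintype.card (InfinitePlace K) :=
    Nat.sub_add_cancel Fintype.card_pos
  have h3 := InfinitePlace.card_eq_nrRealPlaces_add_nrComplexPlaces K
  rw [IsTotallyComplex.nrRealPlaces_eq_zero, zero_add] at h3
  rw [h2, h1, h3]

/-- The `ℓ`-torsion of a group of `S`-units containing the `ℓ`-th roots of unity. -/
theorem card_ker_pow_sUnits {K : Type*} [Field K] [NumberField K] {ℓ : ℕ} (hℓ : ℓ.Prime) {ζ : K}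
    (hζ : IsPrimitiveRoot ζ ℓ) (S : Finset (Pl K)) :
    Nat.card (powMonoidHom ℓ : sUnits S →* sUnits S).ker = ℓ := by
  have : NeZero ℓ := ⟨hℓ.ne_zero⟩
  refine Eq.trans (b := Nat.card (rootsOfUnity ℓ K)) ?_ hζ.card_rootsOfUnity
  refine Nat.card_congr ⟨fun x => ⟨x.1.1, ?_⟩, fun x => ⟨⟨x.1, ?_⟩, ?_⟩, fun x => rfl, fun x => rfl⟩
  · exact congrArg Subtype.val x.2
  · intro v _
    have h := x.2
    rw [mem_rootsOfUnity] at h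
    have := congrArg (ord v) h
    rw [ord_pow, ord_one] at this
    simpa [hℓ.ne_zero] using this
  · apply Subtype.ext
    exact x.2

/-- The group `K_S / K_S^ℓ` has order `ℓ ^ (rank + 1)`. -/
theorem card_sUnits_mod {K : Type*} [Field K] [NumberField K] {ℓ : ℕ} (hℓ : ℓ.Prime) {ζ : K}
    (hζ : IsPrimitiveRoot ζ ℓ) (S : Finset (Pl K)) :
    (powMonoidHom ℓ : sUnits S →* sUnits S).range.index =
      ℓ ^ (NumberField.Units.rank K + 1 + S.card) := by
  have h := (index_range_nsmul (Additive (sUnits S)) hℓ.ne_zero).2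
  have h2 : Nat.card (nsmulAddMonoidHom (α := Additive (sUnits S)) ℓ).ker = ℓ :=
    card_ker_pow_sUnits hℓ hζ S
  rw [h2, finrank_sUnits, ← pow_succ] at h
  rw [show NumberField.Units.rank K + 1 + S.card = NumberField.Units.rank K + S.card + 1 by ring]
  exact h

end sUnitGroups

section placesAbove
open Finset Module NumberField IsDedekindDomain WithZero
open scoped Pointwise

variable {K L : Type*} [Field K] [NumberField K] [Field L] [NumberField L] [Algebra K L]

/-- The inclusion of unit groups. -/
abbrev inc (K L : Type*) [Field K] [Field L] [Algebra K L] : Kˣ →* Lˣ := Units.map (algebraMap K L : K →* L)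

/-- The action of an automorphism on units. -/
abbrev uact (σ : L ≃ₐ[K] L) : Lˣ →* Lˣ := Units.map (σ : L →* L)

/-- The place of `K` below a place of `L`. -/
noncomputable abbrev below (K : Type*) {L : Type*} [Field K] [NumberField K] [Field L] [NumberField L]
  [Algebra K L] (w : Pl L) : Pl K := w.under (𝓞 K)

instance (w : Pl L) : w.asIdeal.LiesOver (below K w).asIdeal := ⟨rfl⟩

/-- The ramification index of `w` over `K`. -/
noncomputable def ram (K : Type*) {L : Type*} [Field K] [NumberField K] [Field L] [NumberField L]
  [Algebra K L] (w : Pl L) : ℕ := Ideal.ramificationIdx' (below K w).asIdeal w.asIdeal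

theorem ram_ne_zero (w : Pl L) : ram K w ≠ 0 :=
  Ideal.IsDedekindDomain.ramificationIdx'_ne_zero_of_liesOver w.asIdeal (below K w).ne_bot

theorem valuation_algebraMap (w : Pl L) (x : K) :
    w.valuation L (algebraMap K L x) = (below K w).valuation K x ^ ram K w :=
  (HeightOneSpectrum.valuation_liesOver L (below K w) w x).symm

theorem ord_inc (w : Pl L) (x : Kˣ) : ord w (inc K L x) = ram K w * ord (below K w) x := by
  have h := valuation_algebraMap (K := K) w (x : K)
  rw [valuation_eq_exp, ← exp_nsmul] at h
  have h2 := valuation_eq_exp w (inc K L x)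
  rw [Units.coe_map] at h2
  have h3 := exp_injective (h2.symm.trans h)
  rw [nsmul_eq_mul] at h3
  linarith

theorem finite_above (v : Pl K) : {w : Pl L | below K w = v}.Finite := by
  have h := IsDedekindDomain.primesOver_finite v.asIdeal (B := 𝓞 L)
  refine Set.Finite.of_finite_image (f := HeightOneSpectrum.asIdeal) (h.subset ?_)
    (fun x _ y _ h => HeightOneSpectrum.ext h)
  rintro _ ⟨w, rfl, rfl⟩
  exact ⟨w.isPrime, inferInstance⟩

/-- The places of `L` above a place of `K`. -/
noncomputable def above (L : Type*) {K : Type*} [Field K] [NumberField K] [Field L] [NumberField L]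
  [Algebra K L] (v : Pl K) : Finset (Pl L) := (finite_above (L := L) v).toFinset

@[simp] theorem mem_above {v : Pl K} {w : Pl L} : w ∈ above L v ↔ below K w = v := by
  simp [above]

theorem card_above (v : Pl K) : (above L v).card = (Ideal.primesOver v.asIdeal (𝓞 L)).ncard := by
  rw [← Set.ncard_coe_finset]
  refine Set.ncard_congr (fun w _ => w.asIdeal) ?_ ?_ ?_
  · intro w hw
    rw [mem_coe, mem_above] at hw
    subst hw
    exact ⟨w.isPrime, inferInstance⟩
  · intro w w' _ _ h; exact HeightOneSpectrum.ext h
  · rintro P ⟨h1, h2⟩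
    refine ⟨⟨P, h1, Ideal.ne_bot_of_liesOver_of_ne_bot v.ne_bot P⟩, ?_, rfl⟩
    rw [mem_coe, mem_above]
    exact HeightOneSpectrum.ext h2.over.symm

/-- The conjugate of a place. -/
noncomputable def conj (σ : L ≃ₐ[K] L) (w : Pl L) : Pl L where
  asIdeal := σ • w.asIdeal
  isPrime := by have := w.isPrime; infer_instance
  ne_bot := by
    intro h
    apply w.ne_bot
    rw [← inv_smul_smul σ w.asIdeal, h]
    exact Ideal.map_bot

theorem valuation_conj (σ : L ≃ₐ[K] L) (w : Pl L) (x : L) :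
    (conj σ w).valuation L (σ x) = w.valuation L x := by
  have key : ∀ a : 𝓞 L, (conj σ w).intValuation (σ • a) = w.intValuation a := by
    intro a
    rcases eq_or_ne a 0 with rfl | ha
    · simp
    have h : ∀ n : ℕ, (conj σ w).intValuation (σ • a) ≤ exp (-(n : ℤ)) ↔ w.intValuation a ≤ exp (-(n : ℤ)) := by
      intro n
      rw [HeightOneSpectrum.intValuation_le_pow_iff_mem, HeightOneSpectrum.intValuation_le_pow_iff_mem]
      have : (conj σ w).asIdeal ^ n = σ • (w.asIdeal ^ n) := (Ideal.map_pow _ _ _).symm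
      rw [this]
      exact Ideal.smul_mem_pointwise_smul_iff
    have ha' : σ • a ≠ 0 := (smul_ne_zero_iff_ne σ).2 ha
    obtain ⟨m, hm⟩ : ∃ m : ℕ, w.intValuation a = exp (-(m : ℤ)) := ⟨_, w.intValuation_if_neg ha⟩
    obtain ⟨m', hm'⟩ : ∃ m : ℕ, (conj σ w).intValuation (σ • a) = exp (-(m : ℤ)) :=
      ⟨_, (conj σ w).intValuation_if_neg ha'⟩
    rw [hm, hm'] at h ⊢
    have h1 := (h m).2 le_rfl
    have h2 := (h m').1 le_rfl
    exact le_antisymm h1 h2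
  obtain ⟨a, b, hb, rfl⟩ := IsFractionRing.div_surjective (A := 𝓞 L) x
  have hc : ∀ a : 𝓞 L, σ (algebraMap (𝓞 L) L a) = algebraMap (𝓞 L) L (σ • a) := fun a => rfl
  rw [map_div₀ σ, map_div₀, map_div₀, hc, hc, HeightOneSpectrum.valuation_of_algebraMap,
    HeightOneSpectrum.valuation_of_algebraMap, HeightOneSpectrum.valuation_of_algebraMap,
    HeightOneSpectrum.valuation_of_algebraMap, key, key]

theorem ord_conj (σ : L ≃ₐ[K] L) (w : Pl L) (x : Lˣ) : ord (conj σ w) (uact σ x) = ord w x := by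
  have h := valuation_conj σ w (x : L)
  have h2 := valuation_eq_exp (conj σ w) (uact σ x)
  rw [Units.coe_map] at h2
  have h3 := exp_injective (h2.symm.trans (h.trans (valuation_eq_exp w x)))
  omega

theorem below_conj (σ : L ≃ₐ[K] L) (w : Pl L) : below K (conj σ w) = below K w :=
  have : SMulCommClass (L ≃ₐ[K] L) (𝓞 K) (𝓞 L) := ⟨fun τ a x => by
    apply RingOfIntegers.ext
    rw [Algebra.smul_def, Algebra.smul_def, smul_mul']
    change τ (algebraMap K L (a : K)) * _ = algebraMap K L (a : K) * _
    rw [τ.commutes]⟩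
  HeightOneSpectrum.ext (Ideal.under_smul (𝓞 K) w.asIdeal σ)

theorem exists_conj_eq [IsGalois K L] {w w' : Pl L} (h : below K w = below K w') :
    ∃ σ : L ≃ₐ[K] L, conj σ w = w' := by
  have h1 : w'.asIdeal.LiesOver (below K w).asIdeal := by rw [h]; infer_instance
  have := w.isPrime
  have := w'.isPrime
  obtain ⟨σ, hσ⟩ := Ideal.exists_smul_eq_of_isGaloisGroup (below K w).asIdeal w.asIdeal w'.asIdeal
    (L ≃ₐ[K] L)
  exact ⟨σ, HeightOneSpectrum.ext hσ⟩

theorem exists_above (v : Pl K) : ∃ w : Pl L, below K w = v := by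
  have := v.isPrime
  obtain ⟨P⟩ : Nonempty (Ideal.primesOver v.asIdeal (𝓞 L)) := inferInstance
  exact ⟨⟨P.1, P.2.1, by have := P.2.2; exact Ideal.ne_bot_of_liesOver_of_ne_bot v.ne_bot P.1⟩, HeightOneSpectrum.ext P.2.2.over.symm⟩

theorem card_mul_ram_mul_inertia [IsGalois K L] (w : Pl L) :
    (above L (below K w)).card * (ram K w * w.asIdeal.inertiaDeg (𝓞 K)) = finrank K L := by
  have := w.isPrime
  have := (below K w).isPrime
  have h := Ideal.ncard_primesOver_mul_ramificationIdxIn_mul_inertiaDegIn (below K w).asIdeal (𝓞 L) (L ≃ₐ[K] L)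
  rw [Ideal.ramificationIdxIn_eq_ramificationIdx _ w.asIdeal (L ≃ₐ[K] L),
    Ideal.inertiaDegIn_eq_inertiaDeg _ w.asIdeal (L ≃ₐ[K] L), IsGalois.card_aut_eq_finrank] at h
  rw [card_above, ← h, ram, Ideal.ramificationIdx'_eq_ramificationIdx _ _ (below K w).ne_bot]

/-- Approximation modulo `w` by elements of `K` when the residue degree is one. -/
theorem exists_sub_valuation_lt_one (w : Pl L) (hf : w.asIdeal.inertiaDeg (𝓞 K) = 1) (x : L)
    (hx : w.valuation L x ≤ 1) : ∃ a : K, w.valuation L (x - algebraMap K L a) < 1 := by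
  have hm1 : w.asIdeal.IsMaximal := w.isMaximal
  have hm2 : (below K w).asIdeal.IsMaximal := (below K w).isMaximal
  rw [Ideal.inertiaDeg_eq_of_isMaximal (below K w).asIdeal w.asIdeal] at hf
  obtain ⟨y, hy⟩ := w.exists_valuation_sub_lt_of_integer hx 1
  let : Field (𝓞 K ⧸ (below K w).asIdeal) := Ideal.Quotient.field _
  obtain ⟨c, hc⟩ := (finrank_eq_one_iff_of_nonzero' (K := 𝓞 K ⧸ (below K w).asIdeal)
    (1 : 𝓞 L ⧸ w.asIdeal) one_ne_zero).1 hf (Ideal.Quotient.mk _ y)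
  obtain ⟨a, rfl⟩ := Ideal.Quotient.mk_surjective c
  refine ⟨a, ?_⟩
  have h1 : y - algebraMap (𝓞 K) (𝓞 L) a ∈ w.asIdeal := by
    rw [← Ideal.Quotient.eq_zero_iff_mem, map_sub, ← hc, sub_eq_zero, Algebra.smul_def, mul_one]
    rfl
  have h2 : w.valuation L (algebraMap (𝓞 L) L (y - algebraMap (𝓞 K) (𝓞 L) a)) < 1 := by
    rwa [HeightOneSpectrum.valuation_lt_one_iff_mem]
  have h3 : x - algebraMap K L a = algebraMap (𝓞 L) L (y - algebraMap (𝓞 K) (𝓞 L) a) -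
      (algebraMap (𝓞 L) L y - x) := by
    rw [map_sub]
    have : algebraMap (𝓞 L) L (algebraMap (𝓞 K) (𝓞 L) a) = algebraMap K L a := rfl
    rw [this]; ring
  rw [h3]
  exact Valuation.map_sub_lt _ h2 hy

end placesAbove

section kummer
open Finset Module Polynomial IntermediateField

/-- A Kummer extension `L = K(B)` of prime degree `ℓ`, with `B ^ ℓ = b` and `σ B = ζ B`. -/
structure Kum (K L : Type) [Field K] [Field L] [Algebra K L] (ℓ : ℕ) (ζ : K) (b : Kˣ) where
  prime : ℓ.Prime
  hζ : IsPrimitiveRoot ζ ℓ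
  hfin : finrank K L = ℓ
  B : Lˣ
  hB : B ^ ℓ = inc K L b
  σ : L ≃ₐ[K] L
  hσ : σ B = algebraMap K L ζ * B

namespace Kum
variable {K L : Type} [Field K] [Field L] [Algebra K L] {ℓ : ℕ} {ζ : K} {b : Kˣ} (D : Kum K L ℓ ζ b)
include D

theorem B_pow : (D.B : L) ^ ℓ = algebraMap K L b := congrArg Units.val D.hB

theorem finiteDimensional : FiniteDimensional K L :=
  FiniteDimensional.of_finrank_pos (by rw [D.hfin]; exact D.prime.pos)

theorem σ_pow_B (i : ℕ) : (D.σ ^ i) (D.B : L) = algebraMap K L ζ ^ i * D.B := by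
  induction i with
  | zero => simp
  | succ i ih => rw [pow_succ', AlgEquiv.mul_apply, ih, map_mul, map_pow, D.σ.commutes, D.hσ]; ring

theorem adjoin_eq_top : K⟮(D.B : L)⟯ = ⊤ := by
  have h : (finrank K L).Prime := by rw [D.hfin]; exact D.prime
  have := D.finiteDimensional
  have := IntermediateField.isSimpleOrder_of_finrank_prime K L h
  rcases eq_bot_or_eq_top K⟮(D.B : L)⟯ with h | h
  · exfalso
    have h1 : (D.B : L) ∈ (⊥ : IntermediateField K L) := h ▸ mem_adjoin_simple_self K _
    obtain ⟨c, hc⟩ := IntermediateField.mem_bot.1 h1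
    have h2 := D.hσ
    rw [← hc, D.σ.commutes] at h2
    have h3 : algebraMap K L c ≠ 0 := by rw [hc]; exact D.B.ne_zero
    have h4 : algebraMap K L ζ = 1 := mul_right_cancel₀ h3 (by rw [one_mul, ← h2])
    rw [← map_one (algebraMap K L)] at h4
    exact D.hζ.ne_one D.prime.one_lt ((algebraMap K L).injective h4)
  · exact h

theorem exists_aeval (x : L) : ∃ P : K[X], aeval (D.B : L) P = x := by
  have := D.finiteDimensional
  have h1 : x ∈ K⟮(D.B : L)⟯ := by rw [D.adjoin_eq_top]; trivial
  have h2 := (IntermediateField.adjoin_simple_toSubalgebra_of_isAlgebraic (F := K)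
    (Algebra.IsAlgebraic.isAlgebraic (D.B : L)))
  rw [← IntermediateField.mem_toSubalgebra, h2, Algebra.adjoin_singleton_eq_range_aeval] at h1
  exact h1

theorem ext_B {A : Type*} [Semiring A] [Algebra K A] {f g : L →ₐ[K] A} (h : f D.B = g D.B) : f = g := by
  ext x
  obtain ⟨P, rfl⟩ := D.exists_aeval x
  rw [← aeval_algHom_apply, ← aeval_algHom_apply, h]

theorem σ_pow_eq_iff (i j : ℕ) : D.σ ^ i = D.σ ^ j ↔ ζ ^ i = ζ ^ j := by
  constructor
  · intro h
    have h1 := D.σ_pow_B i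
    rw [h, D.σ_pow_B j] at h1
    have := mul_right_cancel₀ D.B.ne_zero h1
    rw [← map_pow, ← map_pow] at this
    exact (algebraMap K L).injective this.symm
  · intro h
    have : ((D.σ ^ i : L ≃ₐ[K] L) : L →ₐ[K] L) = (D.σ ^ j : L ≃ₐ[K] L) := by
      apply D.ext_B
      change (D.σ ^ i) (D.B : L) = (D.σ ^ j) (D.B : L)
      rw [D.σ_pow_B, D.σ_pow_B, ← map_pow, h, map_pow]
    ext x
    exact congrArg (fun f : L →ₐ[K] L => f x) this

theorem orderOf_σ : orderOf D.σ = ℓ := by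
  rw [orderOf_eq_iff D.prime.pos]
  constructor
  · rw [← pow_zero D.σ, D.σ_pow_eq_iff, D.hζ.pow_eq_one, pow_zero]
  · intro m hm h0
    rw [← pow_zero D.σ, Ne, D.σ_pow_eq_iff, pow_zero]
    exact D.hζ.pow_ne_one_of_pos_of_lt h0.ne' hm

theorem σ_pow_ℓ : D.σ ^ ℓ = 1 := by
  have := pow_orderOf_eq_one D.σ
  rwa [D.orderOf_σ] at this

theorem isGalois : IsGalois K L := by
  have := D.finiteDimensional
  apply IsGalois.of_card_aut_eq_finrank
  apply le_antisymm
  · rw [Nat.card_eq_fintype_card]; exact AlgEquiv.card_le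
  · rw [D.hfin]
    conv_lhs => rw [← D.orderOf_σ, ← Nat.card_zpowers]
    exact Nat.card_le_card_of_injective _ Subtype.val_injective

theorem mem_zpowers (τ : L ≃ₐ[K] L) : τ ∈ Subgroup.zpowers D.σ := by
  have := D.finiteDimensional
  have := D.isGalois
  have h : Subgroup.zpowers D.σ = ⊤ := by
    apply Subgroup.eq_top_of_card_eq
    rw [Nat.card_zpowers, D.orderOf_σ, IsGalois.card_aut_eq_finrank, D.hfin]
  rw [h]; trivial

theorem exists_pow_eq (τ : L ≃ₐ[K] L) : ∃ i < ℓ, D.σ ^ i = τ := by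
  classical
  have := D.finiteDimensional
  have h1 := D.mem_zpowers τ
  rw [← SetLike.mem_coe, ← (isOfFinOrder_of_finite D.σ).powers_eq_zpowers,
    (isOfFinOrder_of_finite D.σ).powers_eq_image_range_orderOf, D.orderOf_σ] at h1
  simpa using h1

theorem exists_of_fixed {x : L} (hx : D.σ x = x) : ∃ c : K, algebraMap K L c = x := by
  have := D.finiteDimensional
  have := D.isGalois
  apply (IsGalois.mem_range_algebraMap_iff_fixed x).2
  intro τ
  obtain ⟨i, _, rfl⟩ := D.exists_pow_eq τ
  clear *- hx
  induction i with
  | zero => rfl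
  | succ i ih => rw [pow_succ, AlgEquiv.mul_apply, hx, ih]

theorem exists_unit_of_fixed {x : Lˣ} (hx : uact D.σ x = x) : ∃ c : Kˣ, inc K L c = x := by
  obtain ⟨c, hc⟩ := D.exists_of_fixed (congrArg Units.val hx)
  refine ⟨Units.mk0 c (by rintro rfl; rw [map_zero] at hc; exact x.ne_zero hc.symm), Units.ext hc⟩

theorem norm_eq (x : L) : algebraMap K L (Algebra.norm K x) = ∏ i ∈ range ℓ, (D.σ ^ i) x := by
  have := D.finiteDimensional
  have := D.isGalois
  rw [Algebra.norm_eq_prod_automorphisms]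
  symm
  refine prod_bij (fun i _ => D.σ ^ i) (fun _ _ => mem_univ _) ?_ ?_ (fun _ _ => rfl)
  · intro i hi j hj h
    rw [mem_range] at hi hj
    have h1 := (D.σ_pow_eq_iff i j).1 h
    exact D.hζ.pow_inj hi hj h1
  · intro τ _
    obtain ⟨i, hi, h⟩ := D.exists_pow_eq τ
    exact ⟨i, mem_range.2 hi, h⟩

/-- The norm on units. -/
noncomputable abbrev N (_ : Kum K L ℓ ζ b) : Lˣ →* Kˣ := Units.map (Algebra.norm K)

theorem inc_N (x : Lˣ) : inc K L (D.N x) = ∏ i ∈ range ℓ, uact (D.σ ^ i) x := by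
  ext
  rw [Units.coe_prod]
  exact D.norm_eq x

theorem N_inc (x : Kˣ) : D.N (inc K L x) = x ^ ℓ := by
  ext
  change Algebra.norm K (algebraMap K L (x : K)) = (x : K) ^ ℓ
  rw [Algebra.norm_algebraMap, D.hfin]

theorem hilbert90 {x : Lˣ} (hx : D.N x = 1) : ∃ y : Lˣ, x = uact D.σ y / y := by
  have := D.finiteDimensional
  have := D.isGalois
  have : IsCyclic (L ≃ₐ[K] L) := ⟨D.σ, D.mem_zpowers⟩
  have h : Algebra.norm K ((x⁻¹ : Lˣ) : L) = 1 := by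
    have h2 : D.N x⁻¹ = 1 := by rw [map_inv, hx, inv_one]
    exact congrArg Units.val h2
  obtain ⟨y, hy⟩ := groupCohomology.exists_div_of_norm_eq_one D.mem_zpowers h
  refine ⟨y, ?_⟩
  rw [← inv_inj, inv_div]
  ext
  rw [← hy, Units.val_div_eq_div_val]
  rfl

/-- Elements of `K` which become `ℓ`-th powers in `L`. -/
theorem exists_of_pow_mem {x : Kˣ} {y : Lˣ} (h : y ^ ℓ = inc K L x) :
    ∃ (i : ℕ) (c : Kˣ), x = b ^ i * c ^ ℓ := by
  have h1 : (D.σ (y : L) / y) ^ ℓ = 1 := by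
    have h2 : (y : L) ^ ℓ = algebraMap K L x := congrArg Units.val h
    rw [div_pow, ← map_pow, h2, D.σ.commutes, div_self]
    simp
  have : NeZero ℓ := ⟨D.prime.ne_zero⟩
  obtain ⟨i, hi, h3⟩ := (D.hζ.map_of_injective (algebraMap K L).injective).eq_pow_of_pow_eq_one h1
  have hy0 : (y : L) ≠ 0 := y.ne_zero
  have h4 : uact D.σ (y / D.B ^ i) = y / D.B ^ i := by
    ext
    rw [Units.coe_map, Units.val_div_eq_div_val, Units.val_pow_eq_pow_val]
    change D.σ ((y : L) / (D.B : L) ^ i) = (y : L) / (D.B : L) ^ i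
    rw [map_div₀, map_pow, D.hσ, mul_pow, h3]
    have := D.B.ne_zero
    have hs : D.σ (y : L) ≠ 0 := by simp
    field_simp
  obtain ⟨c, hc⟩ := D.exists_unit_of_fixed h4
  refine ⟨i, c, ?_⟩
  have h5 : inc K L x = inc K L (b ^ i * c ^ ℓ) := by
    rw [map_mul, map_pow, map_pow, hc, ← D.hB, ← h, div_pow, ← pow_mul, ← pow_mul, mul_comm ℓ i,
      mul_div_cancel]
  ext
  exact (algebraMap K L).injective (congrArg Units.val h5)

theorem not_pow (c : Kˣ) : c ^ ℓ ≠ b := by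
  intro h
  have h1 : ((D.B : L) / algebraMap K L c) ^ ℓ = 1 := by
    rw [div_pow, D.B_pow, ← h, Units.val_pow_eq_pow_val, map_pow, div_self]; simp
  have : NeZero ℓ := ⟨D.prime.ne_zero⟩
  obtain ⟨i, hi, h3⟩ := (D.hζ.map_of_injective (algebraMap K L).injective).eq_pow_of_pow_eq_one h1
  have hc : algebraMap K L c ≠ 0 := by simp
  have h4 : (D.B : L) = algebraMap K L (ζ ^ i * c) := by
    rw [map_mul, map_pow, h3]; field_simp
  have h5 := D.hσ
  rw [h4, D.σ.commutes] at h5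
  have h6 : algebraMap K L (ζ ^ i * c) ≠ 0 := by rw [← h4]; exact D.B.ne_zero
  have h7 : algebraMap K L ζ = 1 := mul_right_cancel₀ h6 (by rw [one_mul, ← h5])
  rw [← map_one (algebraMap K L)] at h7
  exact D.hζ.ne_one D.prime.one_lt ((algebraMap K L).injective h7)

end Kum

/-- Existence of Kummer extensions. -/
theorem exists_kum {K : Type} [Field K] [NumberField K] {ℓ : ℕ} (hℓ : ℓ.Prime) {ζ : K}
    (hζ : IsPrimitiveRoot ζ ℓ) (b : Kˣ) (hb : ∀ c : Kˣ, c ^ ℓ ≠ b) :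
    ∃ (L : Type) (_ : Field L) (_ : NumberField L) (_ : Algebra K L), Nonempty (Kum K L ℓ ζ b) := by
  have hirr : Irreducible (X ^ ℓ - C (b : K)) := by
    apply X_pow_sub_C_irreducible_of_prime hℓ
    intro c hc
    have hc0 : c ≠ 0 := by rintro rfl; rw [zero_pow hℓ.ne_zero] at hc; exact b.ne_zero hc.symm
    exact hb (Units.mk0 c hc0) (Units.ext hc)
  have : Fact (Irreducible (X ^ ℓ - C (b : K))) := ⟨hirr⟩
  have hne : (X ^ ℓ - C (b : K)) ≠ 0 := hirr.ne_zero
  let L := AdjoinRoot (X ^ ℓ - C (b : K))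
  have hfin : finrank K L = ℓ := by
    rw [(AdjoinRoot.powerBasis hne).finrank, AdjoinRoot.powerBasis_dim, natDegree_X_pow_sub_C]
  have hfd : FiniteDimensional K L := FiniteDimensional.of_finrank_pos (by rw [hfin]; exact hℓ.pos)
  have hc : CharZero L := charZero_of_injective_algebraMap (algebraMap K L).injective
  have hQ : FiniteDimensional ℚ L := FiniteDimensional.trans ℚ K L
  have hroot : (AdjoinRoot.root (X ^ ℓ - C (b : K)) : L) ^ ℓ = algebraMap K L b := by
    have h := AdjoinRoot.eval₂_root (X ^ ℓ - C (b : K))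
    rw [eval₂_sub, eval₂_X_pow, eval₂_C, sub_eq_zero] at h
    exact h
  have hr0 : (AdjoinRoot.root (X ^ ℓ - C (b : K)) : L) ≠ 0 := by
    intro h
    rw [h, zero_pow hℓ.ne_zero] at hroot
    exact (by simp : algebraMap K L b ≠ 0) hroot.symm
  have hev : eval₂ (Algebra.ofId K L : K →+* L) (algebraMap K L ζ * AdjoinRoot.root (X ^ ℓ - C (b : K)))
      (X ^ ℓ - C (b : K)) = 0 := by
      rw [eval₂_sub, eval₂_X_pow, eval₂_C, mul_pow, hroot, ← map_pow, hζ.pow_eq_one, map_one, one_mul]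
      exact sub_self _
  let f : L →ₐ[K] L := AdjoinRoot.liftAlgHom (X ^ ℓ - C (b : K)) (Algebra.ofId K L)
    (algebraMap K L ζ * AdjoinRoot.root (X ^ ℓ - C (b : K))) hev
  refine ⟨L, inferInstance, ⟨⟩, inferInstance, ⟨⟨hℓ, hζ, hfin, Units.mk0 _ hr0, Units.ext hroot,
    AlgEquiv.ofBijective f (Algebra.IsAlgebraic.algHom_bijective f), ?_⟩⟩⟩
  exact AdjoinRoot.liftAlgHom_root (X ^ ℓ - C (b : K)) (Algebra.ofId K L) _ hev

end kummer

section symbols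
open Finset Module NumberField IsDedekindDomain WithZero

variable {K : Type*} [Field K] [NumberField K] {ℓ : ℕ} {ζ : K}

theorem valuation_rootOfUnity (hℓ : ℓ ≠ 0) (hζ : IsPrimitiveRoot ζ ℓ) (v : Pl K) : v.valuation K ζ = 1 := by
  have h : v.valuation K ζ ^ ℓ = 1 := by rw [← map_pow, hζ.pow_eq_one, map_one]
  exact (pow_eq_one_iff_of_nonneg zero_le hℓ).1 h

theorem valuation_zeta_sub_one_le (hℓ : ℓ ≠ 0) (hζ : IsPrimitiveRoot ζ ℓ) (v : Pl K) :
    v.valuation K (ζ - 1) ≤ 1 :=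
  (Valuation.map_sub _ _ _).trans (by rw [valuation_rootOfUnity hℓ hζ, map_one, max_self])

theorem valuation_zeta_sub_one_ne_zero (hℓ : ℓ.Prime) (hζ : IsPrimitiveRoot ζ ℓ) (v : Pl K) :
    v.valuation K (ζ - 1) ≠ 0 :=
  (Valuation.ne_zero_iff _).2 (sub_ne_zero.2 (hζ.ne_one hℓ.one_lt))

theorem valuation_prime (hℓ : ℓ.Prime) (hζ : IsPrimitiveRoot ζ ℓ) (v : Pl K) :
    v.valuation K (ℓ : K) = v.valuation K (ζ - 1) ^ (ℓ - 1) := by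
  let R := (v.valuation K).valuationSubring
  let z : R := ⟨ζ, (valuation_rootOfUnity hℓ.ne_zero hζ v).le⟩
  have hz : ∑ i ∈ range ℓ, z ^ i = 0 := by
    apply Subtype.ext
    rw [AddSubmonoidClass.coe_finsetSum]
    exact hζ.geom_sum_eq_zero hℓ.one_lt
  obtain ⟨x, y, h1, h2⟩ := exists_mul_eq_of_geom_sum_eq_zero hℓ z hz
  have h1' : (ζ - 1) ^ (ℓ - 1) = (ℓ : K) * x := congrArg Subtype.val h1
  have h2' : (ℓ : K) = (ζ - 1) ^ (ℓ - 1) * y := congrArg Subtype.val h2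
  have hx : v.valuation K (x : K) ≤ 1 := x.2
  have hy : v.valuation K (y : K) ≤ 1 := y.2
  apply le_antisymm
  · conv_lhs => rw [h2', map_mul, map_pow]
    exact mul_le_of_le_one_right' hy
  · rw [← map_pow, h1', map_mul]
    exact mul_le_of_le_one_right' hx

theorem valuation_eq_one_of_sub_one_lt {v : Pl K} {x : K} (h : v.valuation K (x - 1) < 1) :
    v.valuation K x = 1 := by
  have h2 := Valuation.map_add_eq_of_lt_right (v.valuation K) (x := x - 1) (y := 1) (by rwa [map_one])
  rwa [sub_add_cancel, map_one] at h2

/-- The group of units which are close to `1`. -/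
def oneUnits (v : Pl K) (r : ℤᵐ⁰) (hr : r ≠ 0) : Subgroup Kˣ where
  carrier := {u | v.valuation K ((u : K) - 1) < r ∧ v.valuation K ((u : K) - 1) < 1}
  one_mem' := by
    simp [zero_lt_iff, hr]
  mul_mem' := by
    rintro a b ⟨ha, ha'⟩ ⟨hb, hb'⟩
    have h : ((a * b : Kˣ) : K) - 1 = a * (b - 1) + (a - 1) := by push_cast; ring
    have h1 : v.valuation K (a * ((b : K) - 1)) = v.valuation K ((b : K) - 1) := by
      rw [map_mul, valuation_eq_one_of_sub_one_lt ha', one_mul]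
    rw [Set.mem_ofPred_eq, h]
    exact ⟨Valuation.map_add_lt _ (h1.trans_lt hb) ha, Valuation.map_add_lt _ (h1.trans_lt hb') ha'⟩
  inv_mem' := by
    rintro a ⟨ha, ha'⟩
    have h : ((a⁻¹ : Kˣ) : K) - 1 = - ((a : K)⁻¹ * (a - 1)) := by
      push_cast; field_simp [a.ne_zero]; ring
    have h1 : v.valuation K (((a⁻¹ : Kˣ) : K) - 1) = v.valuation K ((a : K) - 1) := by
      rw [h, Valuation.map_neg, map_mul, map_inv₀, valuation_eq_one_of_sub_one_lt ha', inv_one, one_mul]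
    rw [Set.mem_ofPred_eq, h1]
    exact ⟨ha, ha'⟩

theorem mem_oneUnits {v : Pl K} {r : ℤᵐ⁰} {hr : r ≠ 0} {u : Kˣ} : u ∈ oneUnits v r hr ↔
    v.valuation K ((u : K) - 1) < r ∧ v.valuation K ((u : K) - 1) < 1 := Iff.rfl

theorem mem_oneUnits_one {v : Pl K} {u : Kˣ} : u ∈ oneUnits v 1 one_ne_zero ↔
    v.valuation K ((u : K) - 1) < 1 := by rw [mem_oneUnits, and_self]

theorem ord_of_mem_oneUnits {v : Pl K} {r : ℤᵐ⁰} {hr : r ≠ 0} {u : Kˣ} (h : u ∈ oneUnits v r hr) :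
    ord v u = 0 := (valuation_eq_one_iff v u).1 (valuation_eq_one_of_sub_one_lt h.2)

open Classical in
/-- The elements which are, up to an `ℓ`-th power, very close to `1` at `v`. -/
noncomputable def Pg (ζ : K) (ℓ : ℕ) (v : Pl K) : Subgroup Kˣ :=
  (if h : v.valuation K (ζ - 1) ^ ℓ ≠ 0 then oneUnits v _ h else ⊥) ⊔ (powMonoidHom ℓ : Kˣ →* Kˣ).range

theorem mem_Pg (hℓ : ℓ.Prime) (hζ : IsPrimitiveRoot ζ ℓ) {v : Pl K} {x : Kˣ} :
    x ∈ Pg ζ ℓ v ↔ ∃ z : Kˣ, v.valuation K ((x : K) / z ^ ℓ - 1) < v.valuation K (ζ - 1) ^ ℓ := by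
  have hle : v.valuation K (ζ - 1) ^ ℓ ≤ 1 := pow_le_one₀ zero_le (valuation_zeta_sub_one_le hℓ.ne_zero hζ v)
  rw [Pg, dif_pos (pow_ne_zero _ (valuation_zeta_sub_one_ne_zero hℓ hζ v)), Subgroup.mem_sup]
  constructor
  · rintro ⟨u, hu, _, ⟨z, rfl⟩, rfl⟩
    refine ⟨z, ?_⟩
    have : ((u * powMonoidHom ℓ z : Kˣ) : K) / z ^ ℓ = u := by
      rw [powMonoidHom_apply]; push_cast; field_simp
    rw [this]; exact hu.1
  · rintro ⟨z, hz⟩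
    refine ⟨x / z ^ ℓ, ?_, z ^ ℓ, ⟨z, rfl⟩, div_mul_cancel _ _⟩
    rw [mem_oneUnits]; push_cast
    exact ⟨hz, hz.trans_le hle⟩

theorem pow_mem_Pg (v : Pl K) (x : Kˣ) : x ^ ℓ ∈ Pg ζ ℓ v := by
  exact Subgroup.mem_sup_right ⟨x, rfl⟩

theorem zpow_mem_Pg (v : Pl K) (x : Kˣ) {n : ℤ} (h : (ℓ : ℤ) ∣ n) : x ^ n ∈ Pg ζ ℓ v := by
  obtain ⟨m, rfl⟩ := h
  rw [mul_comm, zpow_mul, zpow_natCast]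
  exact pow_mem_Pg _ _

theorem mem_Pg_tame (hℓ : ℓ.Prime) (hζ : IsPrimitiveRoot ζ ℓ) {v : Pl K} (hv : v.valuation K (ζ - 1) = 1)
    {x : Kˣ} : x ∈ Pg ζ ℓ v ↔ ∃ z : Kˣ, ∃ u ∈ oneUnits v 1 one_ne_zero, x = z ^ ℓ * u := by
  rw [mem_Pg hℓ hζ, hv, one_pow]
  constructor
  · rintro ⟨z, hz⟩
    refine ⟨z, x / z ^ ℓ, ?_, (mul_div_cancel _ _).symm⟩
    rw [mem_oneUnits_one]; push_cast; exact hz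
  · rintro ⟨z, u, hu, rfl⟩
    refine ⟨z, ?_⟩
    rw [mem_oneUnits_one] at hu
    have : ((z ^ ℓ * u : Kˣ) : K) / z ^ ℓ = u := by push_cast; field_simp
    rwa [this]

/-- The tame symbol. -/
noncomputable def tame (v : Pl K) (b : Kˣ) : Kˣ →* Kˣ where
  toFun x := x ^ ord v b / b ^ ord v x
  map_one' := by simp
  map_mul' x y := by rw [mul_zpow, ord_mul, zpow_add, mul_div_mul_comm]

/-- The kernel of the tame symbol. -/
noncomputable def H (ζ : K) (ℓ : ℕ) (v : Pl K) (b : Kˣ) : Subgroup Kˣ := (Pg ζ ℓ v).comap (tame v b)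

theorem mem_H {v : Pl K} {b x : Kˣ} : x ∈ H ζ ℓ v b ↔ x ^ ord v b / b ^ ord v x ∈ Pg ζ ℓ v := Iff.rfl

theorem mem_H_symm {v : Pl K} {b x : Kˣ} (h : x ∈ H ζ ℓ v b) : b ∈ H ζ ℓ v x := by
  rw [mem_H] at h ⊢
  rw [← inv_div]
  exact inv_mem h

theorem pow_mem_H (v : Pl K) (b x : Kˣ) : x ^ ℓ ∈ H ζ ℓ v b := by
  rw [H, Subgroup.mem_comap, map_pow]
  exact pow_mem_Pg _ _

theorem mem_H_of_mem_Pg (hℓ : ℓ.Prime) (hζ : IsPrimitiveRoot ζ ℓ) {v : Pl K} (hv : v.valuation K (ζ - 1) = 1)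
    {x : Kˣ} (h : x ∈ Pg ζ ℓ v) (b : Kˣ) : x ∈ H ζ ℓ v b := by
  obtain ⟨z, u, hu, rfl⟩ := (mem_Pg_tame hℓ hζ hv).1 h
  refine mul_mem (pow_mem_H v b z) ?_
  rw [mem_H, ord_of_mem_oneUnits hu, zpow_zero, div_one]
  refine zpow_mem ?_ _
  exact (mem_Pg_tame hℓ hζ hv).2 ⟨1, u, hu, by simp⟩

theorem finite_not_tame (hℓ : ℓ.Prime) (hζ : IsPrimitiveRoot ζ ℓ) :
    {v : Pl K | v.valuation K (ζ - 1) ≠ 1}.Finite := by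
  refine (finite_ord_ne_zero (Units.mk0 (ζ - 1) (sub_ne_zero.2 (hζ.ne_one hℓ.one_lt)))).subset ?_
  intro v hv h
  exact hv ((valuation_eq_one_iff v _).2 h)

/-- A unit at a tame place which is not an `ℓ`-th power residue. -/
theorem exists_ord_zero_not_mem_Pg (hℓ : ℓ.Prime) (hζ : IsPrimitiveRoot ζ ℓ) {v : Pl K}
    (hv : v.valuation K (ζ - 1) = 1) : ∃ x : Kˣ, ord v x = 0 ∧ x ∉ Pg ζ ℓ v := by
  have hm : v.asIdeal.IsMaximal := v.isMaximal
  let : Field (𝓞 K ⧸ v.asIdeal) := Ideal.Quotient.field _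
  have hfin : Finite (𝓞 K ⧸ v.asIdeal) := Ideal.finiteQuotientOfFreeOfNeBot _ v.ne_bot
  let q := Ideal.Quotient.mk v.asIdeal
  have hzint : IsIntegral ℤ ζ := hζ.isIntegral hℓ.pos
  let z : 𝓞 K := ⟨ζ, hzint⟩
  have hz1 : q z ≠ 1 := by
    intro h
    have h2 : z - 1 ∈ v.asIdeal := by
      rw [← Ideal.Quotient.eq_zero_iff_mem, map_sub, map_one, sub_eq_zero]; exact h
    rw [← v.valuation_lt_one_iff_mem (K := K)] at h2
    have : algebraMap (𝓞 K) K (z - 1) = ζ - 1 := by rw [map_sub, map_one]; rfl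
    change v.valuation K (algebraMap (𝓞 K) K (z - 1)) < 1 at h2
    rw [this, hv] at h2
    exact lt_irrefl _ h2
  have hzl : q z ^ ℓ = 1 := by
    rw [← map_pow]
    have : z ^ ℓ = 1 := RingOfIntegers.ext (by push_cast; exact hζ.pow_eq_one)
    rw [this, map_one]
  have hns : ¬ Function.Surjective (fun x : 𝓞 K ⧸ v.asIdeal => x ^ ℓ) := by
    intro hs
    exact hz1 (Finite.injective_iff_surjective.2 hs (by simp [hzl]))
  have hns : ∃ y : 𝓞 K ⧸ v.asIdeal, ∀ x, x ^ ℓ ≠ y := by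
    simpa [Function.Surjective] using hns
  obtain ⟨y, hy⟩ := hns
  obtain ⟨a, rfl⟩ := Ideal.Quotient.mk_surjective y
  have ha : a ∉ v.asIdeal := by
    intro h
    apply hy 0
    rw [Ideal.Quotient.eq_zero_iff_mem.2 h, zero_pow hℓ.ne_zero]
  have ha0 : algebraMap (𝓞 K) K a ≠ 0 := by
    intro h
    rw [FaithfulSMul.algebraMap_eq_zero_iff] at h
    exact ha (h ▸ zero_mem _)
  have hva : v.valuation K (algebraMap (𝓞 K) K a) = 1 := by
    refine le_antisymm (v.valuation_le_one a) (not_lt.1 ?_)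
    rwa [v.valuation_lt_one_iff_mem]
  refine ⟨Units.mk0 _ ha0, (valuation_eq_one_iff v _).1 hva, ?_⟩
  intro h
  obtain ⟨x, u, hu, hx⟩ := (mem_Pg_tame hℓ hζ hv).1 h
  have hx1 : v.valuation K (x : K) = 1 := by
    have h1 := congrArg (ord v) hx
    rw [(valuation_eq_one_iff v _).1 hva, ord_mul, ord_of_mem_oneUnits hu, ord_pow, add_zero] at h1
    rw [valuation_eq_one_iff]
    have := hℓ.ne_zero
    simpa [this] using h1.symm
  obtain ⟨c, hc⟩ := v.exists_valuation_sub_lt_of_integer hx1.le 1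
  apply hy (q c)
  rw [← map_pow, ← sub_eq_zero, ← map_sub, Ideal.Quotient.eq_zero_iff_mem, ← v.valuation_lt_one_iff_mem (K := K)]
  have e1 : algebraMap (𝓞 K) K a = (x : K) ^ ℓ * u := by
    have := congrArg Units.val hx
    push_cast at this; exact this
  have e2 : algebraMap (𝓞 K) K (c ^ ℓ - a) =
      ((algebraMap (𝓞 K) K c) ^ ℓ - x ^ ℓ) - x ^ ℓ * (u - 1) := by
    rw [map_sub, map_pow, e1]; ring
  change v.valuation K (algebraMap (𝓞 K) K (c ^ ℓ - a)) < 1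
  rw [e2]
  refine Valuation.map_sub_lt _ ?_ ?_
  · obtain ⟨t, ht⟩ := sub_dvd_pow_sub_pow (⟨_, v.valuation_le_one c⟩ : (v.valuation K).valuationSubring) ⟨x, hx1.le⟩ ℓ
    have ht' := congrArg Subtype.val ht
    push_cast at ht'
    rw [ht', map_mul]
    exact mul_lt_one_of_lt_of_le hc t.2
  · rw [map_mul, map_pow, hx1, one_pow, one_mul]
    exact hu.2

end symbols

section kummerLocal
open Finset Module NumberField IsDedekindDomain WithZero

section general
variable {K L : Type*} [Field K] [NumberField K] [Field L] [NumberField L] [Algebra K L]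
  {ℓ : ℕ} {ζ : K}

theorem valuation_lt_iff_algebraMap (w : Pl L) (x y : K) :
    w.valuation L (algebraMap K L x) < w.valuation L (algebraMap K L y) ↔
      (below K w).valuation K x < (below K w).valuation K y := by
  rw [valuation_algebraMap, valuation_algebraMap]
  exact pow_lt_pow_iff_left₀ zero_le zero_le (ram_ne_zero w)

theorem valuation_lt_one_iff_algebraMap (w : Pl L) (x : K) :
    w.valuation L (algebraMap K L x) < 1 ↔ (below K w).valuation K x < 1 := by
  simpa using valuation_lt_iff_algebraMap w x 1

theorem inc_mem_oneUnits {w : Pl L} {x : Kˣ} :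
    inc K L x ∈ oneUnits w 1 one_ne_zero ↔ x ∈ oneUnits (below K w) 1 one_ne_zero := by
  rw [mem_oneUnits_one, mem_oneUnits_one, ← valuation_lt_one_iff_algebraMap, map_sub (algebraMap K L), map_one (algebraMap K L)]
  rfl

theorem tame_above {w : Pl L} (h : (below K w).valuation K (ζ - 1) = 1) :
    w.valuation L (algebraMap K L ζ - 1) = 1 := by
  rw [← map_one (algebraMap K L), ← map_sub, valuation_algebraMap, h, one_pow]

theorem inc_mem_Pg (hℓ : ℓ.Prime) (hζ : IsPrimitiveRoot ζ ℓ) {w : Pl L} {x : Kˣ}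
    (h : x ∈ Pg ζ ℓ (below K w)) : inc K L x ∈ Pg (algebraMap K L ζ) ℓ w := by
  have hζ' : IsPrimitiveRoot (algebraMap K L ζ) ℓ := hζ.map_of_injective (algebraMap K L).injective
  obtain ⟨z, hz⟩ := (mem_Pg hℓ hζ).1 h
  refine (mem_Pg hℓ hζ').2 ⟨inc K L z, ?_⟩
  rw [← map_pow, ← valuation_lt_iff_algebraMap (L := L)] at hz
  simpa using hz

end general

namespace Kum
variable {K L : Type} [Field K] [NumberField K] [Field L] [NumberField L] [Algebra K L]
  {ℓ : ℕ} {ζ : K} {b : Kˣ} (D : Kum K L ℓ ζ b)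
include D

theorem hζL : IsPrimitiveRoot (algebraMap K L ζ) ℓ := D.hζ.map_of_injective (algebraMap K L).injective

theorem conj_eq_self {w : Pl L} (h : (above L (below K w)).card = 1) (τ : L ≃ₐ[K] L) : conj τ w = w :=
  card_le_one.1 h.le _ (mem_above.2 (below_conj τ w)) _ (mem_above.2 rfl)

theorem valuation_fixed {w : Pl L} (h : (above L (below K w)).card = 1) (τ : L ≃ₐ[K] L) (x : L) :
    w.valuation L (τ x) = w.valuation L x := by
  conv_lhs => rw [← D.conj_eq_self h τ]
  exact valuation_conj τ w x

/-- Elements close to `ℓ`-th powers split in the Kummer extension they generate. -/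
theorem not_mem_Pg {w : Pl L} (h : (above L (below K w)).card = 1) : b ∉ Pg ζ ℓ (below K w) := by
  intro hb
  have h1 := inc_mem_Pg (L := L) D.prime D.hζ hb
  obtain ⟨z, hz⟩ := (mem_Pg D.prime D.hζ).1 hb
  rw [← map_pow, ← valuation_lt_iff_algebraMap (L := L), map_pow (algebraMap K L), map_sub (algebraMap K L),
    map_sub (algebraMap K L), map_div₀, map_one, ← D.B_pow, map_pow (algebraMap K L), ← div_pow] at hz
  set X : L := D.B / algebraMap K L z with hX
  have hle := valuation_zeta_sub_one_le D.prime.ne_zero D.hζL w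
  have hX1 : w.valuation L X = 1 := by
    have h2 := valuation_eq_one_of_sub_one_lt (hz.trans_le (by
      rw [map_pow]; exact pow_le_one₀ zero_le hle))
    rw [map_pow] at h2
    exact (pow_eq_one_iff_of_nonneg zero_le D.prime.ne_zero).1 h2
  have hprod := D.hζL.pow_sub_pow_eq_prod_sub_mul X 1 D.prime.pos
  rw [one_pow] at hprod
  have hex : ∃ η ∈ Polynomial.nthRootsFinset ℓ (1 : L), w.valuation L (X - η) <
      w.valuation L (algebraMap K L ζ - 1) := by
    by_contra! hcon
    have : w.valuation L (algebraMap K L ζ - 1) ^ ℓ ≤ w.valuation L (X ^ ℓ - 1) := by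
      rw [hprod, map_prod]
      conv_lhs => rw [← D.hζL.card_nthRootsFinset, ← prod_const]
      refine prod_le_prod' ?_
      intro η hη
      rw [mul_one]; exact hcon η hη
    rw [map_pow (w.valuation L) (algebraMap K L ζ - 1)] at hz
    exact absurd hz (not_lt.2 this)
  obtain ⟨η, hη, hlt⟩ := hex
  have : NeZero ℓ := ⟨D.prime.ne_zero⟩
  obtain ⟨i, -, rfl⟩ := D.hζL.eq_pow_of_pow_eq_one ((Polynomial.mem_nthRootsFinset D.prime.pos _).1 hη)
  have hσ := D.valuation_fixed h D.σ (X - algebraMap K L ζ ^ i)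
  have hsub : X * (algebraMap K L ζ - 1) = D.σ (X - algebraMap K L ζ ^ i) - (X - algebraMap K L ζ ^ i) := by
    rw [map_sub, hX, map_div₀, D.hσ, map_pow, D.σ.commutes, D.σ.commutes]
    ring
  have := Valuation.map_sub_lt _ (hσ.trans_lt hlt) hlt
  rw [← hsub, map_mul, hX1, one_mul] at this
  exact lt_irrefl _ this

theorem dichotomy (w : Pl L) : (above L (below K w)).card = 1 ∧ ram K w * w.asIdeal.inertiaDeg (𝓞 K) = ℓ ∨
    (above L (below K w)).card = ℓ ∧ ram K w = 1 ∧ w.asIdeal.inertiaDeg (𝓞 K) = 1 := by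
  have := D.isGalois
  have h := card_mul_ram_mul_inertia (K := K) w
  rw [D.hfin] at h
  rcases (Nat.dvd_prime D.prime).1 ⟨_, h.symm⟩ with h1 | h1
  · left; rw [h1, one_mul] at h; exact ⟨h1, h⟩
  · right
    rw [h1] at h
    have := Nat.eq_of_mul_eq_mul_left D.prime.pos (h.trans (mul_one ℓ).symm)
    exact ⟨h1, Nat.eq_one_of_mul_eq_one_right this, Nat.eq_one_of_mul_eq_one_left this⟩

theorem ord_B (w : Pl L) : ℓ * ord w D.B = ram K w * ord (below K w) b := by
  rw [← ord_inc, ← D.hB, ord_pow]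

theorem no_approx {w : Pl L} (h : (above L (below K w)).card = 1)
    (hv : (below K w).valuation K (ζ - 1) = 1) (hB : ord w D.B = 0) (a : K) :
    ¬ w.valuation L (D.B - algebraMap K L a) < 1 := by
  intro ha
  have h1 := D.valuation_fixed h D.σ (D.B - algebraMap K L a)
  have h2 : (D.B : L) * (algebraMap K L ζ - 1) = D.σ (D.B - algebraMap K L a) - (D.B - algebraMap K L a) := by
    rw [map_sub, D.hσ, D.σ.commutes]; ring
  have h3 := Valuation.map_sub_lt _ (h1.trans_lt ha) ha
  rw [← h2, map_mul, (valuation_eq_one_iff _ _).2 hB, one_mul, tame_above hv] at h3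
  exact lt_irrefl _ h3

theorem unramified {w : Pl L} (hv : (below K w).valuation K (ζ - 1) = 1) (hb : ord (below K w) b = 0) :
    ram K w = 1 := by
  rcases D.dichotomy w with ⟨h1, h2⟩ | ⟨-, h2, -⟩
  · rcases (Nat.dvd_prime D.prime).1 ⟨_, h2.symm⟩ with h3 | h3
    · exact h3
    · exfalso
      have hf : w.asIdeal.inertiaDeg (𝓞 K) = 1 := by
        rw [h3] at h2
        exact Nat.eq_of_mul_eq_mul_left D.prime.pos (h2.trans (mul_one ℓ).symm)
      have hB : ord w D.B = 0 := by
        have := D.ord_B w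
        rw [hb, mul_zero] at this
        have := D.prime.ne_zero
        simp_all
      obtain ⟨a, ha⟩ := exists_sub_valuation_lt_one (K := K) w hf D.B ((valuation_eq_one_iff _ _).2 hB).le
      exact D.no_approx h1 hv hB a ha
  · exact h2

theorem exists_mul_oneUnits {w : Pl L} (hf : w.asIdeal.inertiaDeg (𝓞 K) = 1) {x : Lˣ} (hx : ord w x = 0) :
    ∃ a : Kˣ, ∃ u ∈ oneUnits w 1 one_ne_zero, x = inc K L a * u := by
  have hx1 := (valuation_eq_one_iff _ _).2 hx
  obtain ⟨a, ha⟩ := exists_sub_valuation_lt_one (K := K) w hf x hx1.le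
  have ha1 : w.valuation L (algebraMap K L a) = 1 := by
    have := Valuation.map_sub_eq_of_lt_right (w.valuation L) (x := (x : L) - algebraMap K L a) (y := x)
      (by rwa [hx1])
    rw [sub_sub_cancel_left, Valuation.map_neg, hx1] at this
    exact this
  have ha0 : a ≠ 0 := by rintro rfl; simp at ha1
  refine ⟨Units.mk0 a ha0, x / inc K L (Units.mk0 a ha0), ?_, (mul_div_cancel _ _).symm⟩
  rw [mem_oneUnits_one]
  have ha0' : algebraMap K L a ≠ 0 := by simpa using ha0
  have : ((x / inc K L (Units.mk0 a ha0) : Lˣ) : L) - 1 = (x - algebraMap K L a) / algebraMap K L a := by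
    push_cast; simp only [inc, Units.coe_map, Units.val_mk0, MonoidHom.coe_coe]; field_simp
  rw [this, map_div₀, ha1, div_one]
  exact ha

theorem mem_Pg_of_split {v : Pl K} (hv : v.valuation K (ζ - 1) = 1) (h : (above L v).card ≠ 1) :
    b ∈ Pg ζ ℓ v := by
  obtain ⟨w, rfl⟩ := exists_above (L := L) v
  obtain ⟨-, h2, h3⟩ := (D.dichotomy w).resolve_left (fun h' => h h'.1)
  obtain ⟨k, hk⟩ := exists_ord_eq (below K w) (ord w D.B)
  have h4 : ord w (D.B / inc K L k) = 0 := by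
    rw [ord_div, ord_inc, h2, hk]; simp
  obtain ⟨a, u, hu, hx⟩ := D.exists_mul_oneUnits h3 h4
  refine (mem_Pg_tame D.prime D.hζ hv).2 ⟨k * a, b / (k * a) ^ ℓ, ?_, (mul_div_cancel _ _).symm⟩
  rw [← inc_mem_oneUnits (L := L)]
  have : inc K L (b / (k * a) ^ ℓ) = u ^ ℓ := by
    rw [map_div, ← D.hB, map_pow, ← div_pow, map_mul, ← div_div, hx, mul_div_cancel_left]
  rw [this]
  exact pow_mem hu ℓ

theorem N_B (hodd : Odd ℓ) : D.N D.B = b := by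
  apply Units.map_injective (f := (algebraMap K L : K →* L)) (algebraMap K L).injective
  change inc K L _ = inc K L _
  rw [D.inc_N, ← D.hB]
  apply Units.ext
  rw [Units.coe_prod, Units.val_pow_eq_pow_val]
  have : ∀ i ∈ range ℓ, ((uact (D.σ ^ i) D.B : Lˣ) : L) = algebraMap K L ζ ^ i * D.B := fun i _ => D.σ_pow_B i
  rw [prod_congr rfl this, prod_mul_distrib, prod_const, card_range, prod_pow_eq_pow_sum]
  obtain ⟨m, hm⟩ := hodd
  have h2 : ∑ i ∈ range ℓ, i = ℓ * m := by
    rw [sum_range_id, hm, Nat.add_sub_cancel, mul_left_comm, Nat.mul_div_cancel_left _ two_pos]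
  rw [h2, pow_mul, ← map_pow, D.hζ.pow_eq_one, map_one, one_pow, one_mul]

theorem ord_N {w : Pl L} (h : (above L (below K w)).card = 1) (β : Lˣ) :
    ram K w * ord (below K w) (D.N β) = ℓ * ord w β := by
  rw [← ord_inc, D.inc_N, ord_prod]
  have : ∀ i ∈ range ℓ, ord w (uact (D.σ ^ i) β) = ord w β := by
    intro i _
    conv_lhs => rw [← D.conj_eq_self h (D.σ ^ i)]
    exact ord_conj _ _ _
  rw [sum_congr rfl this, sum_const, card_range, nsmul_eq_mul]

/-- Norms are in the kernel of the tame symbol. -/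
theorem N_mem_H (hodd : Odd ℓ) {v : Pl K} (hv : v.valuation K (ζ - 1) = 1) (β : Lˣ) :
    D.N β ∈ H ζ ℓ v b := by
  by_cases hc : (above L v).card = 1
  swap
  · exact mem_H_symm (mem_H_of_mem_Pg D.prime D.hζ hv (D.mem_Pg_of_split hv hc) _)
  obtain ⟨w, rfl⟩ := exists_above (L := L) v
  obtain ⟨-, h2⟩ := (D.dichotomy w).resolve_right (fun h' => D.prime.ne_one (h'.1.symm.trans hc))
  have hN := D.ord_N hc β
  have hB := D.ord_B w
  have hℓ0 : (ℓ : ℤ) ≠ 0 := by exact_mod_cast D.prime.ne_zero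
  rcases (Nat.dvd_prime D.prime).1 ⟨_, h2.symm⟩ with h3 | h3
  · rw [h3, Nat.cast_one, one_mul] at hN hB
    rw [mem_H, hN, ← hB]
    exact div_mem (zpow_mem_Pg _ _ ⟨_, rfl⟩) (zpow_mem_Pg _ _ ⟨_, rfl⟩)
  · have hf : w.asIdeal.inertiaDeg (𝓞 K) = 1 := by
      rw [h3] at h2
      exact Nat.eq_of_mul_eq_mul_left D.prime.pos (h2.trans (mul_one ℓ).symm)
    rw [h3] at hN hB
    have hN := mul_left_cancel₀ hℓ0 hN
    have hB := mul_left_cancel₀ hℓ0 hB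
    rw [mem_H, hN, ← hB]
    conv in b ^ _ => rw [← D.N_B hodd]
    rw [← map_zpow, ← map_zpow, ← map_div]
    have hy : ord w (β ^ ord w D.B / D.B ^ ord w β) = 0 := by
      rw [ord_div, ord_zpow, ord_zpow]; ring
    obtain ⟨a, u, hu, hx⟩ := D.exists_mul_oneUnits hf hy
    rw [hx, map_mul, D.N_inc]
    refine mul_mem (pow_mem_Pg _ _) ((mem_Pg_tame D.prime D.hζ hv).2 ⟨1, _, ?_, by rw [one_pow, one_mul]⟩)
    rw [← inc_mem_oneUnits (L := L), D.inc_N]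
    refine prod_mem fun i _ => ?_
    rw [mem_oneUnits_one] at hu ⊢
    have := D.valuation_fixed hc (D.σ ^ i) (u - 1)
    rw [map_sub, map_one] at this
    exact this.trans_lt hu

theorem exists_not_mem_H {v : Pl K} (hv : v.valuation K (ζ - 1) = 1) (hc : (above L v).card = 1) :
    ∃ y, y ∉ H ζ ℓ v b := by
  obtain ⟨w, rfl⟩ := exists_above (L := L) v
  by_cases hd : (ℓ : ℤ) ∣ ord (below K w) b
  · obtain ⟨y, hy⟩ := exists_ord_eq (below K w) 1
    refine ⟨y, fun h => D.not_mem_Pg hc ?_⟩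
    rw [mem_H, hy, zpow_one, div_eq_mul_inv] at h
    have := (Subgroup.mul_mem_cancel_left _ (zpow_mem_Pg (below K w) y hd)).1 h
    exact inv_mem_iff.1 this
  · obtain ⟨y, hy, hy'⟩ := exists_ord_zero_not_mem_Pg D.prime D.hζ hv
    refine ⟨y, fun h => hy' ?_⟩
    rw [mem_H, hy, zpow_zero, div_one] at h
    have hcop : IsCoprime (ord (below K w) b) (ℓ : ℤ) :=
      ((Nat.prime_iff_prime_int.1 D.prime).irreducible.coprime_iff_not_dvd.2 hd).symm
    obtain ⟨s, t, hst⟩ := hcop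
    rw [← zpow_one y, ← hst, zpow_add, mul_comm s, zpow_mul]
    exact mul_mem (zpow_mem h s) (zpow_mem_Pg _ _ ⟨t, mul_comm _ _⟩)

end Kum
end kummerLocal

section normIndex
open Finset Module NumberField IsDedekindDomain WithZero
open scoped Pointwise

/-- The class group is generated by the primes in `S`. -/
def Kills {K : Type*} [Field K] [NumberField K] (S : Finset (Pl K)) : Prop :=
  ∀ v ∉ S, ∃ x : Kˣ, ord v x = 1 ∧ ∀ w ∉ S, w ≠ v → ord w x = 0

section kills
variable {K : Type*} [Field K] [NumberField K]

theorem Kills.mono {S T : Finset (Pl K)} (h : Kills S) (hST : S ⊆ T) : Kills T := fun v hv => by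
  obtain ⟨x, hx, hx'⟩ := h v (fun h => hv (hST h))
  exact ⟨x, hx, fun w hw => hx' w (fun h => hw (hST h))⟩

theorem Kills.exists_ord {S : Finset (Pl K)} (h : Kills S) (f : Pl K → ℤ) (hf : {v | f v ≠ 0}.Finite) :
    ∃ x : Kˣ, ∀ v ∉ S, ord v x = f v := by
  classical
  have key : ∀ T : Finset (Pl K), ∃ x : Kˣ, ∀ v ∉ S, ord v x = if v ∈ T then f v else 0 := by
    intro T
    induction T using Finset.induction_on with
    | empty => exact ⟨1, by simp⟩
    | insert a T ha ih =>
      obtain ⟨x, hx⟩ := ih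
      by_cases haS : a ∈ S
      · refine ⟨x, fun v hv => ?_⟩
        have : v ≠ a := fun h => hv (h ▸ haS)
        rw [hx v hv]; simp [this]
      · obtain ⟨y, hy1, hy2⟩ := h a haS
        refine ⟨x * y ^ f a, fun v hv => ?_⟩
        rw [ord_mul, ord_zpow, hx v hv]
        rcases eq_or_ne v a with rfl | hne
        · simp [ha, hy1]
        · simp [hne, hy2 v hv hne]
  obtain ⟨x, hx⟩ := key hf.toFinset
  refine ⟨x, fun v hv => ?_⟩
  rw [hx v hv]
  by_cases h0 : f v = 0 <;> simp [h0]

end kills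

section above
variable {K L : Type*} [Field K] [NumberField K] [Field L] [NumberField L] [Algebra K L]

theorem conj_inv_conj (σ : L ≃ₐ[K] L) (w : Pl L) : conj σ (conj σ⁻¹ w) = w :=
  HeightOneSpectrum.ext (smul_inv_smul σ w.asIdeal)

open Classical in
/-- The places of `L` above a set of places of `K`. -/
noncomputable def aboveSet (L : Type*) {K : Type*} [Field K] [NumberField K] [Field L] [NumberField L]
    [Algebra K L] (S : Finset (Pl K)) : Finset (Pl L) := S.biUnion (above L)

theorem mem_aboveSet {S : Finset (Pl K)} {w : Pl L} : w ∈ aboveSet L S ↔ below K w ∈ S := by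
  simp [aboveSet]

theorem card_aboveSet (S : Finset (Pl K)) : (aboveSet L S).card = ∑ v ∈ S, (above L v).card := by
  classical
  rw [aboveSet, card_biUnion]
  intro v _ v' _ hne
  exact disjoint_left.2 fun w h h' => hne ((mem_above.1 h).symm.trans (mem_above.1 h'))

theorem uact_mem {S : Finset (Pl K)} (σ : L ≃ₐ[K] L) {x : Lˣ} (hx : x ∈ sUnits (aboveSet L S)) :
    uact σ x ∈ sUnits (aboveSet L S) := by
  intro w hw
  rw [← conj_inv_conj σ w, ord_conj]
  apply hx
  rw [mem_aboveSet, below_conj, ← mem_aboveSet]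
  exact hw

theorem inc_mem_sUnits {S : Finset (Pl K)} {x : Kˣ} : inc K L x ∈ sUnits (aboveSet L S) ↔ x ∈ sUnits S := by
  constructor
  · intro h v hv
    obtain ⟨w, rfl⟩ := exists_above (L := L) v
    have := h w (by rwa [mem_aboveSet])
    rw [ord_inc] at this
    simpa [ram_ne_zero] using this
  · intro h w hw
    rw [ord_inc, h _ (by rwa [mem_aboveSet] at hw), mul_zero]

/-- The action of an automorphism on `S`-units. -/
noncomputable def sact (S : Finset (Pl K)) (σ : L ≃ₐ[K] L) : Module.End ℤ (Additive (sUnits (aboveSet L S))) :=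
  AddMonoidHom.toIntLinearMap (MonoidHom.toAdditive
    (((uact σ).comp (sUnits (aboveSet L S)).subtype).codRestrict (sUnits (aboveSet L S))
      (fun x => uact_mem σ x.2)))

theorem sact_apply (S : Finset (Pl K)) (σ : L ≃ₐ[K] L) (x : Additive (sUnits (aboveSet L S))) :
    ((sact S σ x).toMul : Lˣ) = uact σ (x.toMul : Lˣ) := rfl

theorem sact_pow_apply (S : Finset (Pl K)) (σ : L ≃ₐ[K] L) (i : ℕ) (x : Additive (sUnits (aboveSet L S))) :
    (((sact S σ ^ i) x).toMul : Lˣ) = uact (σ ^ i) (x.toMul : Lˣ) := by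
  induction i with
  | zero => ext; simp
  | succ i ih =>
    rw [pow_succ', Module.End.mul_apply, sact_apply, ih]
    ext; rw [pow_succ']; rfl

end above

namespace Kum
variable {K L : Type} [Field K] [NumberField K] [Field L] [NumberField L] [Algebra K L]
  {ℓ : ℕ} {ζ : K} {b : Kˣ} (D : Kum K L ℓ ζ b)
include D

theorem sact_norm (S : Finset (Pl K)) (x : Additive (sUnits (aboveSet L S))) :
    (((∑ i ∈ range ℓ, sact S D.σ ^ i) x).toMul : Lˣ) = inc K L (D.N (x.toMul : Lˣ)) := by
  rw [LinearMap.sum_apply, D.inc_N, toMul_sum, Subgroup.val_finsetProd]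
  exact prod_congr rfl fun i _ => sact_pow_apply S D.σ i x

theorem div_mem_pow {S : Finset (Pl K)} {x : Lˣ} (h : uact D.σ x / x ∈ sUnits (aboveSet L S)) (i : ℕ) :
    uact (D.σ ^ i) x / x ∈ sUnits (aboveSet L S) := by
  induction i with
  | zero =>
    have : uact (D.σ ^ 0) x = x := by ext; rfl
    rw [this, div_self']; exact one_mem _
  | succ i ih =>
    have : uact (D.σ ^ (i + 1)) x / x = uact D.σ (uact (D.σ ^ i) x / x) * (uact D.σ x / x) := by
      rw [map_div, div_mul_div_cancel]
      congr 1
      ext; rw [pow_succ']; rfl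
    rw [this]
    exact mul_mem (uact_mem _ ih) h

theorem hilbert90_sUnits {S : Finset (Pl K)} (hS : Kills S) (ht : ∀ v ∉ S, v.valuation K (ζ - 1) = 1)
    (hb : ∀ v ∉ S, ord v b = 0) {u : Lˣ} (hu : u ∈ sUnits (aboveSet L S)) (hN : D.N u = 1) :
    ∃ y ∈ sUnits (aboveSet L S), u = uact D.σ y / y := by
  have := D.isGalois
  obtain ⟨x, rfl⟩ := D.hilbert90 hN
  have hconst : ∀ w w' : Pl L, below K w = below K w' → below K w ∉ S → ord w x = ord w' x := by
    intro w w' h hw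
    obtain ⟨τ, rfl⟩ := exists_conj_eq h
    obtain ⟨i, -, rfl⟩ := D.exists_pow_eq τ
    have h1 := D.div_mem_pow hu i (conj (D.σ ^ i) w) (by rwa [mem_aboveSet, below_conj])
    rw [ord_div, ord_conj] at h1
    omega
  choose g hg using fun v : Pl K => exists_above (L := L) v
  have hfin : {v : Pl K | ord (g v) x ≠ 0}.Finite := by
    refine ((finite_ord_ne_zero x).image (below K)).subset fun v hv => ⟨g v, hv, hg v⟩
  obtain ⟨k, hk⟩ := hS.exists_ord (fun v => ord (g v) x) hfin
  refine ⟨x / inc K L k, fun w hw => ?_, ?_⟩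
  · rw [mem_aboveSet] at hw
    rw [ord_div, ord_inc, D.unramified (ht _ hw) (hb _ hw), hk _ hw, hconst _ w (hg _) (by rwa [hg])]
    simp
  · have : uact D.σ (inc K L k) = inc K L k := by ext; exact D.σ.commutes _
    rw [map_div, this, div_div_div_cancel_right]

theorem N_mem_sUnits {S : Finset (Pl K)} {x : Lˣ} (hx : x ∈ sUnits (aboveSet L S)) : D.N x ∈ sUnits S := by
  rw [← inc_mem_sUnits (L := L), D.inc_N]
  exact prod_mem fun i _ => uact_mem _ hx

/-- The norm index of the group of `S`-units. -/
theorem normIndex (hodd : Odd ℓ) {S : Finset (Pl K)} (hS : Kills S) (ht : ∀ v ∉ S, v.valuation K (ζ - 1) = 1)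
    (hb : ∀ v ∉ S, ord v b = 0) :
    ((sUnits (aboveSet L S)).map D.N).relIndex (sUnits S) * ℓ =
      ℓ ^ (S.filter (fun v => (above L v).card = 1)).card := by
  have h2 : 2 < ℓ := by
    have := D.prime.two_le
    rcases hodd with ⟨m, hm⟩
    omega
  set A := Additive (sUnits (aboveSet L S))
  set s : Module.End ℤ A := sact S D.σ with hs
  have hsℓ : s ^ ℓ = 1 := by
    ext x
    rw [hs, sact_pow_apply, D.σ_pow_ℓ]; rfl
  have hH : ∀ a, (∑ i ∈ range ℓ, s ^ i) a = 0 → ∃ c, a = s c - c := by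
    intro a ha
    have h1 := D.sact_norm S a
    rw [ha] at h1
    have hN : D.N (a.toMul : Lˣ) = 1 :=
      Units.map_injective (f := (algebraMap K L : K →* L)) (algebraMap K L).injective
        (h1.symm.trans (map_one _).symm)
    obtain ⟨y, hy, h⟩ := D.hilbert90_sUnits hS ht hb a.toMul.2 hN
    exact ⟨Additive.ofMul ⟨y, hy⟩, Additive.toMul.injective (Subtype.ext h)⟩
  have hherb := herbrand_index D.prime s hsℓ hH
  -- the fixed part
  have hfix : ∀ x : A, x ∈ LinearMap.ker (s - 1) ↔ ∃ k : Kˣ, k ∈ sUnits S ∧ inc K L k = (x.toMul : Lˣ) := by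
    intro x
    rw [LinearMap.mem_ker, LinearMap.sub_apply, sub_eq_zero]
    constructor
    · intro h
      have h' : uact D.σ (x.toMul : Lˣ) = (x.toMul : Lˣ) := congrArg (fun z : A => (z.toMul : Lˣ)) h
      obtain ⟨c, hc⟩ := D.exists_unit_of_fixed h'
      exact ⟨c, inc_mem_sUnits.1 (hc ▸ x.toMul.2), hc⟩
    · rintro ⟨k, -, hk⟩
      apply Additive.toMul.injective
      apply Subtype.ext
      change uact D.σ (x.toMul : Lˣ) = (x.toMul : Lˣ)
      rw [← hk]
      ext; exact D.σ.commutes _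
  have hincinj : Function.Injective (inc K L) :=
    Units.map_injective (f := (algebraMap K L : K →* L)) (algebraMap K L).injective
  let j : Additive (sUnits S) →+ A := MonoidHom.toAdditive
    (((inc K L).comp (sUnits S).subtype).codRestrict (sUnits (aboveSet L S))
      (fun x => inc_mem_sUnits.2 x.2))
  have hj : Function.Injective j := fun x y h =>
    Additive.toMul.injective (Subtype.ext (hincinj (congrArg (fun z : A => (z.toMul : Lˣ)) h)))
  have hjr : LinearMap.range j.toIntLinearMap = LinearMap.ker (s - 1) := by
    ext x
    rw [hfix]
    constructor
    · rintro ⟨k, rfl⟩; exact ⟨(k.toMul : Kˣ), k.toMul.2, rfl⟩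
    · rintro ⟨k, hk, h⟩
      exact ⟨Additive.ofMul ⟨k, hk⟩, Additive.toMul.injective (Subtype.ext h)⟩
  have hrk : finrank ℤ (LinearMap.ker (s - 1)) = Units.rank K + S.card := by
    rw [← hjr, LinearMap.finrank_range_of_inj (f := j.toIntLinearMap) hj, finrank_sUnits]
  have hrel : (∑ i ∈ range ℓ, s ^ i).toAddMonoidHom.range.relIndex (s - 1).toAddMonoidHom.ker =
      ((sUnits (aboveSet L S)).map D.N).relIndex (sUnits S) := by
    let i : A →+ Additive Lˣ := MonoidHom.toAdditive (sUnits (aboveSet L S)).subtype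
    have hi : Function.Injective i := fun x y h => Additive.toMul.injective (Subtype.ext h)
    rw [← AddSubgroup.relIndex_map_map_of_injective _ _ hi]
    rw [← Subgroup.relIndex_map_map_of_injective _ _ hincinj]
    rw [← Subgroup.relIndex_toAddSubgroup]
    congr 1
    · ext x
      constructor
      · rintro ⟨_, ⟨y, rfl⟩, rfl⟩
        exact ⟨_, ⟨(y.toMul : Lˣ), y.toMul.2, rfl⟩, (D.sact_norm S y).symm⟩
      · rintro ⟨_, ⟨y, hy, rfl⟩, rfl⟩
        exact ⟨_, ⟨Additive.ofMul ⟨y, hy⟩, rfl⟩, D.sact_norm S _⟩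
    · ext x
      constructor
      · rintro ⟨y, hy, rfl⟩
        obtain ⟨k, hk, h⟩ := (hfix y).1 hy
        exact ⟨k, hk, h⟩
      · rintro ⟨k, hk, rfl⟩
        exact ⟨j (Additive.ofMul ⟨k, hk⟩), (hfix _).2 ⟨k, hk, rfl⟩, rfl⟩
  rw [hrel, hrk, finrank_sUnits] at hherb
  set X := ((sUnits (aboveSet L S)).map D.N).relIndex (sUnits S)
  set ns := (S.filter (fun v => (above L v).card = 1)).card with hns
  have hcard : (aboveSet L S).card + (ℓ - 1) * ns = ℓ * S.card := by
    rw [card_aboveSet, hns, card_filter, mul_sum, ← sum_add_distrib, mul_comm, ← smul_eq_mul,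
      ← sum_const]
    refine sum_congr rfl fun v _ => ?_
    obtain ⟨w, rfl⟩ := exists_above (L := L) v
    have := D.prime.one_lt
    rcases D.dichotomy w with h | h
    · rw [if_pos h.1, h.1]; omega
    · rw [if_neg (by omega), h.1]; omega
  have hrank : Units.rank L + 1 = ℓ * (Units.rank K + 1) := by
    have e1 := units_rank_of_rootOfUnity h2 D.hζ
    have e2 := units_rank_of_rootOfUnity h2 D.hζL
    have e3 : finrank ℚ K * finrank K L = finrank ℚ L := finrank_mul_finrank ℚ K L
    rw [D.hfin, ← e1, ← e2] at e3
    linarith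
  have hfinal : (X * ℓ) ^ (ℓ - 1) = (ℓ ^ ns) ^ (ℓ - 1) := by
    have hpos : 0 < ℓ ^ (Units.rank L + (aboveSet L S).card) := pow_pos D.prime.pos _
    apply Nat.eq_of_mul_eq_mul_right hpos
    rw [mul_pow, mul_assoc, mul_comm (ℓ ^ (ℓ - 1)), ← mul_assoc, hherb, ← pow_mul, ← pow_add, ← pow_add]
    congr 1
    have e4 : ℓ - 1 + 1 = ℓ := by omega
    linarith
  exact Nat.pow_left_injective (by omega : ℓ - 1 ≠ 0) hfinal

end Kum
end normIndex

section localIndex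
open Finset Module NumberField IsDedekindDomain WithZero

theorem relIndex_le_card {A α : Type*} [CommGroup A] [Finite α] (V U : Subgroup A) (f : A → α)
    (h : ∀ x ∈ U, ∀ y ∈ U, f x = f y → x / y ∈ V) : V.relIndex U ≠ 0 ∧ V.relIndex U ≤ Nat.card α := by
  let g : U ⧸ V.subgroupOf U → α := fun q => f (q.out : U)
  have hg : Function.Injective g := by
    intro q q' hq
    rw [← q.out_eq', ← q'.out_eq']
    apply Eq.symm
    rw [QuotientGroup.eq, Subgroup.mem_subgroupOf]
    have := h _ q.out.2 _ q'.out.2 hq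
    rw [div_eq_inv_mul] at this
    exact this
  have hfin := Finite.of_injective g hg
  refine ⟨?_, Nat.card_le_card_of_injective g hg⟩
  rw [Subgroup.relIndex, Subgroup.index]
  exact Nat.card_pos.ne'

theorem relIndex_sup_map_pow {A : Type*} [CommGroup A] (n : ℕ) (V U : Subgroup A) (hVU : V ≤ U)
    (hfin : V.relIndex U ≠ 0) :
    (V ⊔ U.map (powMonoidHom n)).relIndex U = V.relIndex (U ⊓ V.comap (powMonoidHom n)) := by
  have hUL : U.map (powMonoidHom n) ≤ U := by
    rintro _ ⟨x, hx, rfl⟩; exact pow_mem hx n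
  have h1 : (U ⊓ V.comap (powMonoidHom n)).relIndex U = V.relIndex (V ⊔ U.map (powMonoidHom n)) := by
    rw [inf_comm, Subgroup.inf_relIndex_right, Subgroup.relIndex_comap, Subgroup.relIndex_sup_left]
  have h2 := Subgroup.relIndex_mul_relIndex V (U ⊓ V.comap (powMonoidHom n)) U
    (le_inf hVU fun x hx => pow_mem hx n) inf_le_left
  have h3 := Subgroup.relIndex_mul_relIndex V (V ⊔ U.map (powMonoidHom n)) U le_sup_left (sup_le hVU hUL)
  rw [h1] at h2
  have hpos : 0 < V.relIndex (V ⊔ U.map (powMonoidHom n)) := Nat.pos_of_ne_zero fun h0 => hfin (by rw [← h3, h0, zero_mul])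
  apply Nat.eq_of_mul_eq_mul_left hpos
  rw [h3, ← h2, mul_comm]

variable {K : Type*} [Field K] [NumberField K] {ℓ : ℕ} {ζ : K}

theorem exists_residue (v : Pl K) : ∃ res : K → 𝓞 K ⧸ v.asIdeal, ∀ x y, v.valuation K x ≤ 1 →
    v.valuation K y ≤ 1 → res x = res y → v.valuation K (x - y) < 1 := by
  classical
  have h : ∀ x : K, ∃ a : 𝓞 K, v.valuation K x ≤ 1 → v.valuation K (algebraMap (𝓞 K) K a - x) < 1 := by
    intro x
    by_cases hx : v.valuation K x ≤ 1
    · obtain ⟨a, ha⟩ := v.exists_valuation_sub_lt_of_integer hx 1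
      exact ⟨a, fun _ => ha⟩
    · exact ⟨0, fun h => absurd h hx⟩
  choose a ha using h
  refine ⟨fun x => Ideal.Quotient.mk _ (a x), fun x y hx hy hxy => ?_⟩
  have h1 : v.valuation K (algebraMap (𝓞 K) K (a x - a y)) < 1 :=
    (v.valuation_lt_one_iff_mem _).2 (Ideal.Quotient.eq.1 hxy)
  have h2 : x - y = algebraMap (𝓞 K) K (a x - a y) - ((algebraMap (𝓞 K) K (a x) - x) - (algebraMap (𝓞 K) K (a y) - y)) := by
    rw [map_sub]; ring
  rw [h2]
  exact Valuation.map_sub_lt _ h1 (Valuation.map_sub_lt _ (ha x hx) (ha y hy))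

/-- The units at `v`. -/
def unitsAt (v : Pl K) : Subgroup Kˣ where
  carrier := {x | ord v x = 0}
  one_mem' := ord_one v
  mul_mem' := by
    intro x y hx hy
    rw [Set.mem_ofPred_eq] at *
    rw [ord_mul, hx, hy, add_zero]
  inv_mem' := by
    intro x hx
    rw [Set.mem_ofPred_eq] at *
    rw [ord_inv, hx, neg_zero]

theorem mem_unitsAt {v : Pl K} {x : Kˣ} : x ∈ unitsAt v ↔ ord v x = 0 := Iff.rfl

/-- The filtration of the unit group. -/
def filt (v : Pl K) (k : ℕ) : Subgroup Kˣ := oneUnits v (exp (-(k : ℤ))) exp_ne_zero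

theorem exp_neg_natCast_le_one (k : ℕ) : exp (-(k : ℤ)) ≤ (1 : ℤᵐ⁰) := by
  rw [← exp_zero, exp_le_exp]; omega

theorem mem_filt {v : Pl K} {k : ℕ} {x : Kˣ} : x ∈ filt v k ↔ v.valuation K ((x : K) - 1) < exp (-(k : ℤ)) :=
  ⟨fun h => h.1, fun h => ⟨h, h.trans_le (exp_neg_natCast_le_one k)⟩⟩

theorem filt_le_unitsAt (v : Pl K) (k : ℕ) : filt v k ≤ unitsAt v := fun _ h => ord_of_mem_oneUnits h

theorem filt_anti (v : Pl K) {k m : ℕ} (h : k ≤ m) : filt v m ≤ filt v k := fun x hx => by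
  rw [mem_filt] at *
  refine hx.trans_le ?_
  rw [exp_le_exp]; omega

theorem finite_residue (v : Pl K) : Finite (𝓞 K ⧸ v.asIdeal) := Ideal.finiteQuotientOfFreeOfNeBot _ v.ne_bot

theorem card_residue (v : Pl K) : Nat.card (𝓞 K ⧸ v.asIdeal) = Ideal.absNorm v.asIdeal :=
  (Ideal.absNorm_apply v.asIdeal).symm

theorem div_sub_one_valuation {v : Pl K} {x y : Kˣ} (hy : ord v y = 0) :
    v.valuation K (((x / y : Kˣ) : K) - 1) = v.valuation K ((x : K) - y) := by
  have : ((x / y : Kˣ) : K) - 1 = ((x : K) - y) / y := by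
    push_cast; field_simp
  rw [this, map_div₀, (valuation_eq_one_iff v y).2 hy, div_one]

theorem relIndex_filt_zero (v : Pl K) : (filt v 0).relIndex (unitsAt v) ≠ 0 := by
  obtain ⟨res, hres⟩ := exists_residue v
  have := finite_residue v
  refine (relIndex_le_card _ _ (fun x : Kˣ => res x) fun x hx y hy hxy => ?_).1
  rw [mem_filt, div_sub_one_valuation hy]
  exact hres _ _ ((valuation_eq_one_iff v x).2 hx).le ((valuation_eq_one_iff v y).2 hy).le hxy

theorem relIndex_filt_succ (v : Pl K) (k : ℕ) : (filt v (k + 1)).relIndex (filt v k) ≠ 0 ∧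
    (filt v (k + 1)).relIndex (filt v k) ≤ Ideal.absNorm v.asIdeal := by
  obtain ⟨res, hres⟩ := exists_residue v
  have := finite_residue v
  obtain ⟨t, ht⟩ := exists_ord_eq v (k + 1)
  have hvt : v.valuation K (t : K) = exp (-((k : ℤ) + 1)) := by rw [valuation_eq_exp, ht]
  have hle : ∀ x ∈ filt v k, v.valuation K (((x : K) - 1) / t) ≤ 1 := by
    intro x hx
    rw [mem_filt] at hx
    rw [map_div₀, hvt, div_le_one₀ exp_pos]
    rcases eq_or_ne ((x : K) - 1) 0 with h | h
    · rw [h, map_zero]; exact zero_le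
    · have h1 := valuation_eq_exp v (Units.mk0 _ h)
      rw [Units.val_mk0] at h1
      rw [h1, exp_lt_exp] at hx
      rw [h1, exp_le_exp]; omega
  rw [← card_residue]
  refine relIndex_le_card _ _ (fun x : Kˣ => res (((x : K) - 1) / t)) fun x hx y hy hxy => ?_
  have h1 := hres _ _ (hle x hx) (hle y hy) hxy
  rw [← sub_div, sub_sub_sub_cancel_right, map_div₀, hvt, div_lt_one₀ exp_pos] at h1
  rw [mem_filt, div_sub_one_valuation (filt_le_unitsAt v k hy)]
  push_cast
  exact h1

theorem relIndex_filt_add (v : Pl K) (k m : ℕ) : (filt v (k + m)).relIndex (filt v k) ≠ 0 ∧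
    (filt v (k + m)).relIndex (filt v k) ≤ Ideal.absNorm v.asIdeal ^ m := by
  induction m with
  | zero => simp
  | succ m ih =>
    have h1 := relIndex_filt_succ v (k + m)
    have h2 := Subgroup.relIndex_mul_relIndex _ _ _ (filt_anti v (Nat.le_succ (k + m))) (filt_anti v (Nat.le_add_right k m))
    rw [← add_assoc, ← h2]
    refine ⟨mul_ne_zero h1.1 ih.1, ?_⟩
    rw [pow_succ', ]
    exact Nat.mul_le_mul h1.2 ih.2

theorem mem_filt_sup_zpowers (hℓ : ℓ.Prime) (hζ : IsPrimitiveRoot ζ ℓ) (v : Pl K) (e : ℕ)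
    (he : v.valuation K (ζ - 1) = exp (-(e : ℤ))) {z : Kˣ} (hz : (z : K) = ζ) {x : Kˣ}
    (hx : v.valuation K (((x ^ ℓ : Kˣ) : K) - 1) < exp (-((ℓ * e : ℕ) : ℤ))) :
    x ∈ filt v e ⊔ Subgroup.zpowers z := by
  have : NeZero ℓ := ⟨hℓ.ne_zero⟩
  have hpow : v.valuation K (ζ - 1) ^ ℓ = exp (-((ℓ * e : ℕ) : ℤ)) := by
    rw [he, ← exp_nsmul]; congr 1; push_cast; simp
  rw [← hpow, Units.val_pow_eq_pow_val] at hx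
  have hprod := hζ.pow_sub_pow_eq_prod_sub_mul (x : K) 1 hℓ.pos
  rw [one_pow] at hprod
  have hex : ∃ η ∈ Polynomial.nthRootsFinset ℓ (1 : K), v.valuation K (x - η) < v.valuation K (ζ - 1) := by
    by_contra! hcon
    have : v.valuation K (ζ - 1) ^ ℓ ≤ v.valuation K ((x : K) ^ ℓ - 1) := by
      rw [hprod, map_prod]
      have hc := prod_const (s := Polynomial.nthRootsFinset ℓ (1 : K)) (v.valuation K (ζ - 1))
      rw [hζ.card_nthRootsFinset] at hc
      rw [← hc]
      refine prod_le_prod' ?_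
      intro η hη
      rw [mul_one]; exact hcon η hη
    exact absurd hx (not_lt.2 this)
  obtain ⟨η, hη, hlt⟩ := hex
  obtain ⟨i, -, hi⟩ := hζ.eq_pow_of_pow_eq_one ((Polynomial.mem_nthRootsFinset hℓ.pos _).1 hη)
  rw [← div_mul_cancel x (z ^ i)]
  refine mul_mem (Subgroup.mem_sup_left ?_) (Subgroup.mem_sup_right (pow_mem (Subgroup.mem_zpowers z) i))
  have hz0 : ord v (z ^ i) = 0 := by
    rw [ord_pow, (valuation_eq_one_iff v z).1 (by rw [hz]; exact valuation_rootOfUnity hℓ.ne_zero hζ v), mul_zero]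
  rw [mem_filt, div_sub_one_valuation hz0, ← he, Units.val_pow_eq_pow_val, hz, hi]
  exact hlt

/-- The index among the units of the group of elements close to `ℓ`-th powers. -/
theorem relIndex_Pg_unitsAt (hℓ : ℓ.Prime) (hζ : IsPrimitiveRoot ζ ℓ) (v : Pl K) (e : ℕ)
    (he : v.valuation K (ζ - 1) = exp (-(e : ℤ))) :
    (Pg ζ ℓ v).relIndex (unitsAt v) ≠ 0 ∧
      (Pg ζ ℓ v).relIndex (unitsAt v) ≤ Ideal.absNorm v.asIdeal ^ ((ℓ - 1) * e) * ℓ := by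
  have hζ0 : ζ ≠ 0 := hζ.ne_zero hℓ.ne_zero
  have : NeZero ℓ := ⟨hℓ.ne_zero⟩
  let z : Kˣ := Units.mk0 ζ hζ0
  have hz : z ^ ℓ = 1 := Units.ext hζ.pow_eq_one
  have hpow : v.valuation K (ζ - 1) ^ ℓ = exp (-((ℓ * e : ℕ) : ℤ)) := by
    rw [he, ← exp_nsmul]; congr 1; push_cast; simp
  have hz' : (z : K) = ζ := rfl
  let V := filt v (ℓ * e)
  let U := unitsAt v
  have hVP : V ≤ Pg ζ ℓ v := by
    intro x hx
    refine (mem_Pg hℓ hζ).2 ⟨1, ?_⟩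
    rw [hpow]
    simpa using mem_filt.1 hx
  have hVU0 : V.relIndex U ≠ 0 := by
    have h1 := (relIndex_filt_add v 0 (ℓ * e)).1
    rw [zero_add] at h1
    exact Subgroup.relIndex_ne_zero_trans h1 (relIndex_filt_zero v)
  have h1 := relIndex_sup_map_pow ℓ V U (filt_le_unitsAt v _) hVU0
  have hsplit : ℓ * e = e + (ℓ - 1) * e := by
    have := hℓ.one_le
    rw [add_comm e, ← Nat.succ_mul, Nat.succ_eq_add_one, Nat.sub_add_cancel this]
  have hW : U ⊓ V.comap (powMonoidHom ℓ) ≤ filt v e ⊔ Subgroup.zpowers z := by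
    intro x hx
    exact mem_filt_sup_zpowers hℓ hζ v e he hz' (mem_filt.1 (Subgroup.mem_comap.1 hx.2))
  have hZ : (filt v e).relIndex (filt v e ⊔ Subgroup.zpowers z) ≠ 0 ∧
      (filt v e).relIndex (filt v e ⊔ Subgroup.zpowers z) ≤ ℓ := by
    rw [Subgroup.relIndex_sup_left]
    have hcard : Nat.card (Subgroup.zpowers z) ≤ ℓ := by
      rw [Nat.card_zpowers]
      exact orderOf_le_of_pow_eq_one hℓ.pos hz
    have hfin : Finite (Subgroup.zpowers z) :=
      (isOfFinOrder_iff_pow_eq_one.2 ⟨ℓ, hℓ.pos, hz⟩).finite_zpowers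
    have := Subgroup.card_quotient_dvd_card ((filt v e).subgroupOf (Subgroup.zpowers z))
    exact ⟨Nat.card_pos.ne', (Nat.le_of_dvd Nat.card_pos this).trans hcard⟩
  have h2 := relIndex_filt_add v e ((ℓ - 1) * e)
  rw [← hsplit] at h2
  have h3 := Subgroup.relIndex_mul_relIndex V (filt v e) (filt v e ⊔ Subgroup.zpowers z)
    (filt_anti v (by rw [hsplit]; omega)) le_sup_left
  have h4 : V.relIndex (filt v e ⊔ Subgroup.zpowers z) ≠ 0 := by
    rw [← h3]; exact mul_ne_zero h2.1 hZ.1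
  have h5 : (V ⊔ U.map (powMonoidHom ℓ)).relIndex U ≤ Ideal.absNorm v.asIdeal ^ ((ℓ - 1) * e) * ℓ := by
    rw [h1]
    refine (Subgroup.relIndex_le_of_le_right hW h4).trans ?_
    rw [← h3]
    exact Nat.mul_le_mul h2.2 hZ.2
  have h6 : (V ⊔ U.map (powMonoidHom ℓ)).relIndex U ≠ 0 := fun h0 =>
    hVU0 (Subgroup.relIndex_eq_zero_of_le_left le_sup_left h0)
  have hPsup : V ⊔ U.map (powMonoidHom ℓ) ≤ Pg ζ ℓ v := by
    refine sup_le hVP ?_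
    rintro _ ⟨x, -, rfl⟩
    exact pow_mem_Pg v x
  have h7 : (Pg ζ ℓ v).relIndex U ≠ 0 := fun h0 => h6 (Subgroup.relIndex_eq_zero_of_le_left hPsup h0)
  have h8 := (Subgroup.relIndex_le_of_le_left hPsup h6).trans h5
  exact ⟨h7, h8⟩

/-- The index of the group of elements close to `ℓ`-th powers. -/
theorem index_Pg (hℓ : ℓ.Prime) (hζ : IsPrimitiveRoot ζ ℓ) (v : Pl K) (e : ℕ)
    (he : v.valuation K (ζ - 1) = exp (-(e : ℤ))) :
    (Pg ζ ℓ v).index ≠ 0 ∧ (Pg ζ ℓ v).index ≤ ℓ ^ 2 * Ideal.absNorm v.asIdeal ^ ((ℓ - 1) * e) := by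
  have : NeZero ℓ := ⟨hℓ.ne_zero⟩
  obtain ⟨h7, h8⟩ := relIndex_Pg_unitsAt hℓ hζ v e he
  let U := unitsAt v
  have h9 : (Pg ζ ℓ v ⊔ U).relIndex ⊤ ≠ 0 ∧ (Pg ζ ℓ v ⊔ U).relIndex ⊤ ≤ Nat.card (ZMod ℓ) := by
    refine relIndex_le_card _ _ (fun x : Kˣ => (ord v x : ZMod ℓ)) fun x _ y _ hxy => ?_
    obtain ⟨k, hk⟩ := (ZMod.intCast_eq_intCast_iff_dvd_sub _ _ _).1 hxy.symm
    obtain ⟨t, ht⟩ := exists_ord_eq v k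
    rw [← mul_div_cancel (t ^ ℓ) (x / y)]
    refine mul_mem (Subgroup.mem_sup_left (pow_mem_Pg v t)) (Subgroup.mem_sup_right ?_)
    rw [mem_unitsAt, ord_div, ord_div, ord_pow, ht, hk, sub_self]
  rw [Subgroup.relIndex_top_right, Nat.card_zmod] at h9
  have h10 := Subgroup.relIndex_mul_index (le_sup_left : Pg ζ ℓ v ≤ Pg ζ ℓ v ⊔ U)
  rw [Subgroup.relIndex_sup_left] at h10
  rw [← h10]
  refine ⟨mul_ne_zero h7 h9.1, (Nat.mul_le_mul h8 h9.2).trans (le_of_eq (by ring))⟩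

theorem exists_exp_zeta_sub_one (hℓ : ℓ.Prime) (hζ : IsPrimitiveRoot ζ ℓ) (v : Pl K) :
    ∃ e : ℕ, v.valuation K (ζ - 1) = exp (-(e : ℤ)) := by
  have h0 : ζ - 1 ≠ 0 := sub_ne_zero.2 (hζ.ne_one hℓ.one_lt)
  have h1 := valuation_zeta_sub_one_le hℓ.ne_zero hζ v
  have h2 := valuation_eq_exp v (Units.mk0 _ h0)
  rw [← Units.val_mk0 h0, valuation_le_one_iff] at h1
  refine ⟨(ord v (Units.mk0 _ h0)).toNat, ?_⟩
  rw [Int.toNat_of_nonneg h1]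
  exact h2

/-- The product of the local indices. -/
theorem prod_index_Pg (hℓ : ℓ.Prime) (hζ : IsPrimitiveRoot ζ ℓ) (S : Finset (Pl K)) :
    ∏ v ∈ S, (Pg ζ ℓ v).index ≤ ℓ ^ (2 * S.card + finrank ℚ K) := by
  choose e he using exists_exp_zeta_sub_one hℓ hζ
  have h1 : ∏ v ∈ S, (Pg ζ ℓ v).index ≤ ∏ v ∈ S, ℓ ^ 2 * Ideal.absNorm (v.asIdeal ^ ((ℓ - 1) * e v)) := by
    refine prod_le_prod' fun v _ => ?_
    rw [map_pow]
    exact (index_Pg hℓ hζ v _ (he v)).2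
  refine h1.trans ?_
  rw [prod_mul_distrib, prod_const, ← pow_mul, pow_add, ← map_prod]
  refine Nat.mul_le_mul_left _ ?_
  have h2 : ∏ v ∈ S, v.asIdeal ^ ((ℓ - 1) * e v) ∣ Ideal.span {(ℓ : 𝓞 K)} := by
    refine Finset.prod_dvd_of_coprime ?_ ?_
    · intro v _ w _ hne
      refine IsCoprime.pow ?_
      rw [Ideal.isCoprime_iff_sup_eq]
      exact v.isMaximal.coprime_of_ne w.isMaximal fun h => hne (HeightOneSpectrum.ext h)
    · intro v _
      rw [← v.intValuation_le_pow_iff_dvd, ← v.valuation_of_algebraMap (K := K)]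
      change v.valuation K (algebraMap (𝓞 K) K (ℓ : 𝓞 K)) ≤ _
      rw [map_natCast (algebraMap (𝓞 K) K), valuation_prime hℓ hζ, he, ← exp_nsmul, exp_le_exp]
      push_cast; simp
  have h3 := Ideal.absNorm_dvd_absNorm_of_le (Ideal.le_of_dvd h2)
  have h4 : Ideal.absNorm (Ideal.span {(ℓ : 𝓞 K)}) = ℓ ^ finrank ℚ K := by
    rw [Ideal.absNorm_span_natCast, RingOfIntegers.rank]
  rw [h4] at h3
  exact Nat.le_of_dvd (pow_pos hℓ.pos _) h3

end localIndex

section nonsplit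
open Finset Module NumberField IsDedekindDomain WithZero

section approx
variable {K : Type*} [Field K] [NumberField K]

theorem exists_exp_neg_lt {r : ℤᵐ⁰} (hr : r ≠ 0) : ∃ e : ℕ, exp (-(e : ℤ)) < r := by
  refine ⟨(1 - log r).toNat, ?_⟩
  rw [← exp_log hr, exp_lt_exp, log_exp]
  have := Int.self_le_toNat (1 - log r)
  omega

theorem exists_common_den (S : Finset (Pl K)) (a : Pl K → Kˣ) :
    ∃ (d : Kˣ) (A : Pl K → 𝓞 K), ∀ v ∈ S, algebraMap (𝓞 K) K (A v) = d * a v := by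
  classical
  choose p q hp hq h using fun v => exists_int_div (a v)
  have hq' : ∀ v, algebraMap (𝓞 K) K (q v) ≠ 0 := fun v => by simpa using hq v
  refine ⟨∏ v ∈ S, Units.mk0 _ (hq' v), fun v => p v * ∏ w ∈ S.erase v, q w, fun v hv => ?_⟩
  rw [h v, ← mul_prod_erase S _ hv, map_mul, map_prod]
  push_cast
  rw [Units.val_mk0]
  field_simp [hq' v]
  simp only [Units.val_mk0]

theorem weak_approx (S : Finset (Pl K)) (a : Pl K → Kˣ) {r : ℤᵐ⁰} (hr : r ≠ 0) :
    ∃ x : Kˣ, ∀ v ∈ S, v.valuation K ((x : K) / a v - 1) < r := by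
  classical
  obtain rfl | ⟨v₀, hv₀⟩ := S.eq_empty_or_nonempty
  · exact ⟨1, by simp⟩
  obtain ⟨d, A, hA⟩ := exists_common_den S a
  have he : ∀ v : Pl K, ∃ e : ℕ, exp (-(e : ℤ)) < min r 1 * v.valuation K ((d * a v : Kˣ) : K) := by
    intro v
    refine exists_exp_neg_lt (mul_ne_zero ?_ ((map_ne_zero _).2 (Units.ne_zero _)))
    rcases min_choice r 1 with h | h <;> rw [h]
    · exact hr
    · exact one_ne_zero
  choose e he using he
  obtain ⟨y, hy⟩ := IsDedekindDomain.exists_forall_sub_mem_ideal (s := S) (fun v => v.asIdeal) e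
    (fun v _ => v.prime) (fun v _ w _ hne h => hne (HeightOneSpectrum.ext h)) (fun v => A v)
  have key : ∀ v ∈ S, v.valuation K (algebraMap (𝓞 K) K y / (d * a v : Kˣ) - 1) < min r 1 := by
    intro v hv
    have h1 : algebraMap (𝓞 K) K y / (d * a v : Kˣ) - 1 = algebraMap (𝓞 K) K (y - A v) / (d * a v : Kˣ) := by
      rw [map_sub (algebraMap (𝓞 K) K), hA v hv, sub_div, ← Units.val_mul, div_self (Units.ne_zero _)]
    rw [h1, map_div₀, div_lt_iff₀ (zero_lt_iff.2 ((map_ne_zero _).2 (Units.ne_zero _)))]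
    refine lt_of_le_of_lt ?_ (he v)
    rw [v.valuation_of_algebraMap]
    exact (v.intValuation_le_pow_iff_mem _ _).2 (hy v hv)
  have hy0 : algebraMap (𝓞 K) K y ≠ 0 := by
    intro h0
    have := (key v₀ hv₀).trans_le (min_le_right _ _)
    rw [h0, zero_div, zero_sub, Valuation.map_neg, map_one] at this
    exact lt_irrefl _ this
  refine ⟨Units.mk0 _ hy0 / d, fun v hv => ?_⟩
  convert (key v hv).trans_le (min_le_left _ _) using 2
  push_cast
  rw [Units.val_mk0, div_div]

theorem infinite_places : Infinite (Pl K) := by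
  refine ⟨fun hfin => ?_⟩
  have := Fintype.ofFinite (Pl K)
  let n : ℕ := ∏ v : Pl K, Ideal.absNorm v.asIdeal
  have hn : 0 < n := prod_pos fun v _ => Nat.pos_of_ne_zero (by
    rw [Ne, Ideal.absNorm_eq_zero_iff]; exact v.ne_bot)
  have hne : Ideal.span {((n + 1 : ℕ) : 𝓞 K)} ≠ ⊤ := by
    rw [← Ideal.absNorm_eq_one_iff.ne, Ideal.absNorm_span_natCast]
    exact (Nat.one_lt_pow Module.finrank_pos.ne' (by omega)).ne'
  obtain ⟨M, hM, hle⟩ := Ideal.exists_le_maximal _ hne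
  have hmem : ((n + 1 : ℕ) : 𝓞 K) ∈ M := hle (Ideal.mem_span_singleton_self _)
  have hM0 : M ≠ ⊥ := by
    rintro rfl
    rw [Ideal.mem_bot, Nat.cast_eq_zero] at hmem
    omega
  let v : Pl K := ⟨M, hM.isPrime, hM0⟩
  have h1 : ((n : ℕ) : 𝓞 K) ∈ M := by
    have h2 := Ideal.absNorm_mem v.asIdeal
    obtain ⟨k, hk⟩ : Ideal.absNorm v.asIdeal ∣ n := dvd_prod_of_mem _ (mem_univ v)
    rw [hk, Nat.cast_mul]
    exact M.mul_mem_right _ h2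
  apply hM.ne_top
  rw [Ideal.eq_top_iff_one]
  have := M.sub_mem hmem h1
  simpa using this

end approx

variable {K : Type} [Field K] [NumberField K] {ℓ : ℕ} {ζ : K}

theorem weak_approx_Pg (hℓ : ℓ.Prime) (hζ : IsPrimitiveRoot ζ ℓ) (S : Finset (Pl K)) (a : Pl K → Kˣ) :
    ∃ x : Kˣ, ∀ v ∈ S, x / a v ∈ Pg ζ ℓ v ∧ ord v x = ord v (a v) := by
  classical
  have hr : ∀ v : Pl K, v.valuation K (ζ - 1) ^ ℓ ≠ 0 := fun v =>
    pow_ne_zero _ (valuation_zeta_sub_one_ne_zero hℓ hζ v)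
  have hle : ∀ v : Pl K, v.valuation K (ζ - 1) ^ ℓ ≤ 1 := fun v =>
    pow_le_one' (valuation_zeta_sub_one_le hℓ.ne_zero hζ v) _
  obtain ⟨r, hr0, hr⟩ : ∃ r : ℤᵐ⁰, r ≠ 0 ∧ ∀ v ∈ S, r ≤ v.valuation K (ζ - 1) ^ ℓ := by
    refine ⟨∏ v ∈ S, v.valuation K (ζ - 1) ^ ℓ, prod_ne_zero_iff.2 fun v _ => hr v, fun v hv => ?_⟩
    rw [← mul_prod_erase S _ hv]
    exact mul_le_of_le_one_right' (prod_le_one' fun v _ => hle v)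
  obtain ⟨x, hx⟩ := weak_approx S a hr0
  refine ⟨x, fun v hv => ⟨(mem_Pg hℓ hζ).2 ⟨1, ?_⟩, ?_⟩⟩
  · simpa using (hx v hv).trans_le (hr v hv)
  · have h1 := valuation_eq_one_of_sub_one_lt ((hx v hv).trans_le ((hr v hv).trans (hle v)))
    rw [← Units.val_div_eq_div_val, valuation_eq_one_iff, ord_div] at h1
    omega

theorem exists_good_finset (hℓ : ℓ.Prime) (hζ : IsPrimitiveRoot ζ ℓ) (T : Finset (Pl K)) (A : Finset Kˣ) :
    ∃ S : Finset (Pl K), T ⊆ S ∧ Kills S ∧ (∀ v ∉ S, v.valuation K (ζ - 1) = 1) ∧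
      ∀ x ∈ A, ∀ v ∉ S, ord v x = 0 := by
  classical
  obtain ⟨S₀, hS₀⟩ := exists_finset_class (K := K)
  refine ⟨T ∪ S₀ ∪ (finite_not_tame hℓ hζ).toFinset ∪ A.biUnion fun x => (finite_ord_ne_zero x).toFinset,
    fun v hv => by simp [hv], Kills.mono hS₀ fun v hv => by simp [hv], fun v hv => ?_, fun x hx v hv => ?_⟩
  · by_contra h; exact hv (by simp [h])
  · by_contra h
    refine hv (mem_union_right _ (mem_biUnion.2 ⟨x, hx, ?_⟩))
    simpa using h

/-- An element which is locally a power everywhere is a power. -/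
theorem exists_pow_of_forall_mem_Pg (hℓ : ℓ.Prime) (hodd : Odd ℓ) (hζ : IsPrimitiveRoot ζ ℓ) {y : Kˣ}
    (hy : ∀ v, y ∈ Pg ζ ℓ v) : ∃ c : Kˣ, c ^ ℓ = y := by
  by_contra! hcon
  obtain ⟨L, _, _, _, ⟨D⟩⟩ := exists_kum hℓ hζ y hcon
  obtain ⟨S, -, hS, ht, hA⟩ := exists_good_finset hℓ hζ ∅ {y}
  have h := D.normIndex hodd hS ht (hA y (mem_singleton_self y))
  have hem : S.filter (fun v => (above L v).card = 1) = ∅ := by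
    rw [filter_eq_empty_iff]
    intro v _ hv
    obtain ⟨w, rfl⟩ := exists_above (L := L) v
    exact D.not_mem_Pg hv (hy _)
  rw [hem, card_empty, pow_zero] at h
  exact hℓ.one_lt.ne' (Nat.eq_one_of_mul_eq_one_left h)

/-- An element which is locally a power almost everywhere is a power. -/
theorem exists_pow_of_mem_Pg (hℓ : ℓ.Prime) (hodd : Odd ℓ) (hζ : IsPrimitiveRoot ζ ℓ) {y : Kˣ}
    (B : Finset (Pl K)) (hy : ∀ v ∉ B, y ∈ Pg ζ ℓ v) : ∃ c : Kˣ, c ^ ℓ = y := by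
  classical
  obtain ⟨S, hBS, hS, ht, hA⟩ := exists_good_finset hℓ hζ B {y}
  have := infinite_places (K := K)
  obtain ⟨t, htS⟩ := Infinite.exists_notMem_finset S
  obtain ⟨π, hπ⟩ := exists_ord_eq t 1
  obtain ⟨x, hx⟩ := weak_approx_Pg hℓ hζ (insert t S) (fun v => if v = t then π else 1)
  have hxS : ∀ v ∈ S, x ∈ Pg ζ ℓ v := by
    intro v hv
    have h1 := (hx v (mem_insert_of_mem hv)).1
    rwa [if_neg (by rintro rfl; exact htS hv), div_one] at h1
  have hxt : ord t x = 1 := by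
    rw [(hx t (mem_insert_self _ _)).2, if_pos rfl, hπ]
  have hyt : ord t y = 0 := hA y (mem_singleton_self y) t htS
  have hnp : ∀ c : Kˣ, c ^ ℓ ≠ y * x := by
    intro c hc
    have h1 : ord t (c ^ ℓ) = 1 := by rw [hc, ord_mul, hyt, hxt, zero_add]
    rw [ord_pow] at h1
    have h2 := Int.eq_one_or_neg_one_of_mul_eq_one h1
    have h3 := hℓ.one_lt
    omega
  obtain ⟨L, _, _, _, ⟨D⟩⟩ := exists_kum hℓ hζ (y * x) hnp
  have hloc : ∀ w : Pl L, inc K L y ∈ Pg (algebraMap K L ζ) ℓ w := by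
    intro w
    by_cases hw : below K w ∈ S
    · have h1 := inc_mem_Pg (L := L) hℓ hζ (hxS _ hw)
      have h2 : inc K L y = D.B ^ ℓ / inc K L x := by rw [D.hB, map_mul, mul_div_cancel_right]
      rw [h2]
      exact div_mem (pow_mem_Pg w _) h1
    · exact inc_mem_Pg hℓ hζ (hy _ fun h => hw (hBS h))
  obtain ⟨c, hc⟩ := exists_pow_of_forall_mem_Pg hℓ hodd D.hζL hloc
  obtain ⟨i, d, hd⟩ := D.exists_of_pow_mem hc
  have h1 := congrArg (ord t) hd
  rw [hyt, ord_mul, ord_pow, ord_pow, ord_mul, hyt, hxt, zero_add, mul_one] at h1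
  obtain ⟨j, rfl⟩ : ℓ ∣ i := by
    rw [← Int.natCast_dvd_natCast]
    exact ⟨-ord t d, by linarith⟩
  exact ⟨(y * x) ^ j * d, by rw [mul_pow, ← pow_mul, mul_comm j, ← hd]⟩

end nonsplit

section detecting
open Finset Module NumberField IsDedekindDomain WithZero

section group
variable {A : Type*} [CommGroup A] {ℓ : ℕ}

theorem mem_of_zpow_mem (hℓ : ℓ.Prime) {P : Subgroup A} {g : A} (hg : g ^ ℓ ∈ P) {n : ℤ} (hn : ¬ (ℓ : ℤ) ∣ n)
    (h : g ^ n ∈ P) : g ∈ P := by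
  have hc : IsCoprime (ℓ : ℤ) n := (Nat.prime_iff_prime_int.1 hℓ).coprime_iff_not_dvd.2 hn
  obtain ⟨a, c, hac⟩ := hc
  have : g = (g ^ ℓ) ^ a * (g ^ n) ^ c := by
    rw [← zpow_natCast, ← zpow_mul, ← zpow_mul, ← zpow_add, mul_comm _ a, mul_comm _ c, hac,
      zpow_one]
  rw [this]
  exact mul_mem (zpow_mem hg _) (zpow_mem h _)

theorem eq_of_pow_div_pow_mem (hℓ : ℓ.Prime) {P : Subgroup A} {g : A} (hg : g ^ ℓ ∈ P) (hgP : g ∉ P)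
    {i j : ℕ} (hi : i < ℓ) (hj : j < ℓ) (h : g ^ i / g ^ j ∈ P) : i = j := by
  by_contra hne
  refine hgP (mem_of_zpow_mem hℓ hg (n := (i : ℤ) - j) ?_ ?_)
  · intro hd
    have := Int.eq_zero_of_abs_lt_dvd hd (by rw [abs_lt]; constructor <;> omega)
    omega
  · rwa [zpow_sub, zpow_natCast, zpow_natCast, ← div_eq_mul_inv]

theorem mk_eq_mk_iff_div {P U : Subgroup A} {x y : U} :
    (QuotientGroup.mk x : U ⧸ P.subgroupOf U) = QuotientGroup.mk y ↔ (x : A) / y ∈ P := by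
  rw [eq_comm, QuotientGroup.eq, Subgroup.mem_subgroupOf, div_eq_inv_mul]
  rfl

theorem exists_div_pow_mem (hℓ : ℓ.Prime) {P U : Subgroup A} (h0 : P.relIndex U ≠ 0)
    (hle : P.relIndex U ≤ ℓ) {g u : A} (hgU : g ∈ U) (hgP : g ∉ P) (hg : g ^ ℓ ∈ P) (hu : u ∈ U) :
    ∃ i < ℓ, u / g ^ i ∈ P := by
  by_contra! hcon
  let F : Option (Fin ℓ) → U ⧸ P.subgroupOf U := fun o => o.elim (QuotientGroup.mk ⟨u, hu⟩)
    fun i => QuotientGroup.mk ⟨g ^ (i : ℕ), pow_mem hgU _⟩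
  have hF : Function.Injective F := by
    rintro (_ | i) (_ | j) h
    · rfl
    · exact absurd (mk_eq_mk_iff_div.1 h) (hcon j j.2)
    · exact absurd (mk_eq_mk_iff_div.1 h.symm) (hcon i i.2)
    · rw [Fin.ext (eq_of_pow_div_pow_mem hℓ hg hgP i.2 j.2 (mk_eq_mk_iff_div.1 h))]
  have hfin : Finite (U ⧸ P.subgroupOf U) := @Subgroup.finite_quotient_of_finiteIndex _ _ (P.subgroupOf U) ⟨h0⟩
  have := Nat.card_le_card_of_injective F hF
  rw [Nat.card_eq_fintype_card, Fintype.card_option, Fintype.card_fin] at this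
  change ℓ + 1 ≤ P.relIndex U at this
  omega

theorem pow_card_le_relIndex (hℓ : ℓ.Prime) {ι : Type*} (s : Finset ι) {X N : Subgroup A}
    {H : ι → Subgroup A} {g : ι → A} (hN : ∀ i ∈ s, N ≤ H i) (hg : ∀ i ∈ s, g i ∉ H i)
    (hpow : ∀ i ∈ s, g i ^ ℓ ∈ H i) (hsurj : ∀ f : ι → ℕ, ∃ x ∈ X, ∀ i ∈ s, x / g i ^ f i ∈ H i)
    (h0 : N.relIndex X ≠ 0) : ℓ ^ s.card ≤ N.relIndex X := by
  classical
  choose x hxX hx using fun f : s → Fin ℓ => hsurj fun i => if h : i ∈ s then f ⟨i, h⟩ else 0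
  let F : (s → Fin ℓ) → X ⧸ N.subgroupOf X := fun f => QuotientGroup.mk ⟨x f, hxX f⟩
  have hF : Function.Injective F := by
    intro f f' hff
    funext ⟨i, hi⟩
    have h1 := hN i hi (mk_eq_mk_iff_div.1 hff)
    have h2 := hx f i hi
    have h3 := hx f' i hi
    rw [dif_pos hi] at h2 h3
    refine Fin.ext (eq_of_pow_div_pow_mem hℓ (hpow i hi) (hg i hi) (Fin.is_lt _) (Fin.is_lt _) ?_)
    have h4 := div_mem (mul_mem h1 h3) h2
    rwa [div_mul_div_cancel, div_div_div_cancel_left] at h4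
  have hfin : Finite (X ⧸ N.subgroupOf X) := @Subgroup.finite_quotient_of_finiteIndex _ _ (N.subgroupOf X) ⟨h0⟩
  have := Nat.card_le_card_of_injective F hF
  rw [Nat.card_eq_fintype_card, Fintype.card_fun, Fintype.card_fin, Fintype.card_coe] at this
  exact this

theorem relIndex_map_pow (n : ℕ) (X : Subgroup A) :
    (X.map (powMonoidHom n)).relIndex X = (powMonoidHom n : X →* X).range.index := by
  rw [Subgroup.relIndex]
  congr 1
  ext x
  rw [Subgroup.mem_subgroupOf, Subgroup.mem_map, MonoidHom.mem_range]
  constructor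
  · rintro ⟨y, hy, h⟩; exact ⟨⟨y, hy⟩, Subtype.ext h⟩
  · rintro ⟨y, h⟩; exact ⟨y, y.2, congrArg Subtype.val h⟩

end group

variable {K : Type} [Field K] [NumberField K] {ℓ : ℕ} {ζ : K}

theorem mem_Pg_of_units (hℓ : ℓ.Prime) (hζ : IsPrimitiveRoot ζ ℓ) {v : Pl K} (hv : v.valuation K (ζ - 1) = 1)
    {g u : Kˣ} (hg : ord v g = 0) (hgP : g ∉ Pg ζ ℓ v) (hu : ord v u = 0) :
    ∃ i < ℓ, u / g ^ i ∈ Pg ζ ℓ v := by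
  obtain ⟨h1, h2⟩ := relIndex_Pg_unitsAt hℓ hζ v 0 (by simpa using hv)
  rw [mul_zero, pow_zero, one_mul] at h2
  exact exists_div_pow_mem hℓ h1 h2 (mem_unitsAt.2 hg) hgP (pow_mem_Pg v g) (mem_unitsAt.2 hu)

/-- `T` is a set of places, outside `S`, at which `b` is a power and where the `S`-units
realise all classes of units. -/
structure Detects (ζ : K) (ℓ : ℕ) (S T : Finset (Pl K)) : Prop where
  disj : ∀ t ∈ T, t ∉ S
  surj : ∀ u : Pl K → Kˣ, (∀ t ∈ T, ord t (u t) = 0) → ∃ x ∈ sUnits S, ∀ t ∈ T, x / u t ∈ Pg ζ ℓ t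

theorem Detects.insert [DecidableEq (Pl K)] (hℓ : ℓ.Prime) (hζ : IsPrimitiveRoot ζ ℓ) {S T : Finset (Pl K)}
    (h : Detects ζ ℓ S T) {t : Pl K} (ht : t ∉ S) (htame : t.valuation K (ζ - 1) = 1) {x : Kˣ} (hx : x ∈ sUnits S)
    (hxT : ∀ s ∈ T, x ∈ Pg ζ ℓ s) (hxt : x ∉ Pg ζ ℓ t) : Detects ζ ℓ S (insert t T) := by
  refine ⟨fun s hs => ?_, fun u hu => ?_⟩
  · rcases mem_insert.1 hs with rfl | hs
    · exact ht
    · exact h.disj s hs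
  · obtain ⟨y, hyS, hy⟩ := h.surj u fun s hs => hu s (mem_insert_of_mem hs)
    obtain ⟨i, -, hi⟩ := mem_Pg_of_units hℓ hζ htame (mem_sUnits.1 hx t ht) hxt (u := u t / y)
      (by rw [ord_div, hu t (mem_insert_self _ _), mem_sUnits.1 hyS t ht, sub_zero])
    refine ⟨y * x ^ i, mul_mem hyS (pow_mem hx i), fun s hs => ?_⟩
    rcases mem_insert.1 hs with rfl | hs
    · have := inv_mem hi
      convert this using 1
      rw [inv_div, div_div_eq_mul_div, mul_comm]
    · rw [mul_div_right_comm]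
      exact mul_mem (hy s hs) (pow_mem (hxT s hs) i)

theorem Detects.pow_card_le (hℓ : ℓ.Prime) (hζ : IsPrimitiveRoot ζ ℓ) {S T : Finset (Pl K)}
    (htame : ∀ v ∉ S, v.valuation K (ζ - 1) = 1) (h : Detects ζ ℓ S T) :
    T.card ≤ NumberField.Units.rank K + 1 + S.card := by
  have hg : ∀ t : Pl K, ∃ g : Kˣ, t ∈ T → ord t g = 0 ∧ g ∉ Pg ζ ℓ t := by
    intro t
    by_cases ht : t ∈ T
    · obtain ⟨g, hg⟩ := exists_ord_zero_not_mem_Pg hℓ hζ (htame t (h.disj t ht))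
      exact ⟨g, fun _ => hg⟩
    · exact ⟨1, fun h => absurd h ht⟩
  choose g hg using hg
  rw [← Nat.pow_le_pow_iff_right hℓ.one_lt, ← card_sUnits_mod hℓ hζ S, ← relIndex_map_pow]
  refine pow_card_le_relIndex hℓ T (H := fun t => Pg ζ ℓ t) (g := g) ?_ (fun t ht => (hg t ht).2)
    (fun t _ => pow_mem_Pg t _) (fun f => ?_) ?_
  · rintro t - _ ⟨x, -, rfl⟩
    exact pow_mem_Pg t x
  · exact h.surj (fun t => g t ^ f t) fun t ht => by rw [ord_pow, (hg t ht).1, mul_zero]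
  · rw [relIndex_map_pow, card_sUnits_mod hℓ hζ]
    exact pow_ne_zero _ hℓ.ne_zero

theorem Kum.inc_mem_Pg_of_div {L : Type} [Field L] [NumberField L] [Algebra K L] {b : Kˣ} (D : Kum K L ℓ ζ b)
    {w : Pl L} {x : Kˣ} {i : ℕ} (h : x / b ^ i ∈ Pg ζ ℓ (below K w)) :
    inc K L x ∈ Pg (algebraMap K L ζ) ℓ w := by
  have h1 := inc_mem_Pg (L := L) D.prime D.hζ h
  have h2 : inc K L x = inc K L (x / b ^ i) * (D.B ^ i) ^ ℓ := by
    rw [← pow_mul, mul_comm i, pow_mul, D.hB, ← map_pow, ← map_mul, div_mul_cancel]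
  rw [h2]
  exact mul_mem h1 (pow_mem_Pg w _)

/-- A finite set of places detecting the `ℓ`-th powers among the `S`-units. -/
theorem exists_detecting (hℓ : ℓ.Prime) (hodd : Odd ℓ) (hζ : IsPrimitiveRoot ζ ℓ) {S : Finset (Pl K)}
    (htame : ∀ v ∉ S, v.valuation K (ζ - 1) = 1) {b : Kˣ} (hb : b ∈ sUnits S) (hbp : ∀ c : Kˣ, c ^ ℓ ≠ b) :
    ∃ (T : Finset (Pl K)) (t₁ : Pl K), Detects ζ ℓ S T ∧ (∀ t ∈ T, t ≠ t₁ → b ∈ Pg ζ ℓ t) ∧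
      ∀ x ∈ sUnits S, (∀ t ∈ T, x ∈ Pg ζ ℓ t) → ∃ c : Kˣ, c ^ ℓ = x := by
  classical
  let good : Finset (Pl K) → Prop := fun T => Detects ζ ℓ S T ∧ ∀ t ∈ T, b ∈ Pg ζ ℓ t
  obtain ⟨T, hT, hmax⟩ : ∃ T, good T ∧ ∀ T', good T' → T'.card ≤ T.card := by
    let A : Set ℕ := {n | ∃ T, good T ∧ T.card = n}
    have hA : A.Nonempty := ⟨0, ∅, ⟨⟨by simp, fun u _ => ⟨1, one_mem _, by simp⟩⟩, by simp⟩, rfl⟩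
    have hbdd : BddAbove A := ⟨_, by
      rintro _ ⟨T, hT, rfl⟩
      exact hT.1.pow_card_le hℓ hζ htame⟩
    obtain ⟨T, hT, hc⟩ := Nat.sSup_mem hA hbdd
    exact ⟨T, hT, fun T' hT' => by rw [hc]; exact le_csSup hbdd ⟨T', hT', rfl⟩⟩
  have key : ∀ x ∈ sUnits S, (∀ t ∈ T, x ∈ Pg ζ ℓ t) → ∃ (i : ℕ) (c : Kˣ), x = b ^ i * c ^ ℓ := by
    intro x hx hxT
    obtain ⟨L, _, _, _, ⟨D⟩⟩ := exists_kum hℓ hζ b hbp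
    have hloc : ∀ w ∉ aboveSet L (S ∪ T), inc K L x ∈ Pg (algebraMap K L ζ) ℓ w := by
      intro w hw
      rw [mem_aboveSet, mem_union, not_or] at hw
      by_contra hxw
      have hxt : x ∉ Pg ζ ℓ (below K w) := fun h => hxw (inc_mem_Pg hℓ hζ h)
      have hbt : b ∈ Pg ζ ℓ (below K w) := by
        by_contra hbt
        obtain ⟨i, -, hi⟩ := mem_Pg_of_units hℓ hζ (htame _ hw.1) (mem_sUnits.1 hb _ hw.1) hbt (mem_sUnits.1 hx _ hw.1)
        exact hxw (D.inc_mem_Pg_of_div hi)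
      have hg : good (insert (below K w) T) := by
        refine ⟨hT.1.insert hℓ hζ hw.1 (htame _ hw.1) hx hxT hxt, fun t ht => ?_⟩
        rcases mem_insert.1 ht with rfl | ht
        · exact hbt
        · exact hT.2 t ht
      have := hmax _ hg
      rw [card_insert_of_notMem hw.2] at this
      omega
    obtain ⟨c, hc⟩ := exists_pow_of_mem_Pg hℓ hodd D.hζL _ hloc
    exact D.exists_of_pow_mem hc
  obtain ⟨t₁, ht₁, hbt₁⟩ : ∃ t₁ ∉ S, b ∉ Pg ζ ℓ t₁ := by
    by_contra! hcon
    obtain ⟨c, hc⟩ := exists_pow_of_mem_Pg hℓ hodd hζ S hcon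
    exact hbp c hc
  refine ⟨insert t₁ T, t₁, hT.1.insert hℓ hζ ht₁ (htame _ ht₁) hb hT.2 hbt₁, fun t ht hne => ?_, fun x hx hxT => ?_⟩
  · exact hT.2 t (mem_of_mem_insert_of_ne ht hne)
  · obtain ⟨i, c, rfl⟩ := key x hx fun t ht => hxT t (mem_insert_of_mem ht)
    have h1 := div_mem (hxT t₁ (mem_insert_self _ _)) (pow_mem_Pg (ζ := ζ) (ℓ := ℓ) t₁ c)
    rw [mul_div_cancel_right, ← zpow_natCast] at h1
    obtain ⟨j, rfl⟩ : ℓ ∣ i := by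
      by_contra hd
      exact hbt₁ (mem_of_zpow_mem hℓ (pow_mem_Pg t₁ b) (by rwa [Int.natCast_dvd_natCast]) h1)
    exact ⟨b ^ j * c, by rw [mul_pow, ← pow_mul, mul_comm j]⟩

theorem Detects.le_card (hℓ : ℓ.Prime) (hζ : IsPrimitiveRoot ζ ℓ) {S T : Finset (Pl K)}
    (htame : ∀ v ∉ S, v.valuation K (ζ - 1) = 1) (h : Detects ζ ℓ S T)
    (hT : ∀ x ∈ sUnits S, (∀ t ∈ T, x ∈ Pg ζ ℓ t) → ∃ c : Kˣ, c ^ ℓ = x) :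
    NumberField.Units.rank K + 1 + S.card ≤ T.card := by
  classical
  have : NeZero ℓ := ⟨hℓ.ne_zero⟩
  have hg : ∀ t : T, ∃ g : Kˣ, ord t.1 g = 0 ∧ g ∉ Pg ζ ℓ t.1 := fun t =>
    exists_ord_zero_not_mem_Pg hℓ hζ (htame t (h.disj t t.2))
  choose g hg0 hg using hg
  have hi : ∀ (x : Kˣ) (t : T), ∃ i : Fin ℓ, x ∈ sUnits S → x / g t ^ (i : ℕ) ∈ Pg ζ ℓ t.1 := by
    intro x t
    by_cases hx : x ∈ sUnits S
    · obtain ⟨i, hi, h1⟩ := mem_Pg_of_units hℓ hζ (htame t (h.disj t t.2)) (hg0 t) (hg t) (mem_sUnits.1 hx t (h.disj t t.2))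
      exact ⟨⟨i, hi⟩, fun _ => h1⟩
    · exact ⟨0, fun h => absurd h hx⟩
  choose i hi using hi
  rw [← Nat.pow_le_pow_iff_right hℓ.one_lt, ← card_sUnits_mod hℓ hζ S, ← relIndex_map_pow]
  refine ((relIndex_le_card _ _ i fun x hx y hy hxy => ?_).2).trans (le_of_eq ?_)
  · obtain ⟨c, hc⟩ := hT (x / y) (div_mem hx hy) fun t ht => by
      have h1 := div_mem (hi x ⟨t, ht⟩ hx) (hi y ⟨t, ht⟩ hy)
      rwa [hxy, div_div_div_cancel_right] at h1
    refine ⟨c, fun v hv => ?_, hc⟩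
    have h2 := mem_sUnits.1 (div_mem hx hy) v hv
    rw [← hc, ord_pow] at h2
    exact (mul_eq_zero.1 h2).resolve_left (by exact_mod_cast hℓ.ne_zero)
  · rw [Nat.card_eq_fintype_card, Fintype.card_fun, Fintype.card_fin, Fintype.card_coe]

theorem Detects.surj_all {S T : Finset (Pl K)} [DecidableEq (Pl K)] (h : Detects ζ ℓ S T) (hS : Kills S) (a : Pl K → Kˣ) :
    ∃ z ∈ sUnits (S ∪ T), ∀ t ∈ T, z / a t ∈ Pg ζ ℓ t := by
  obtain ⟨z₀, hz₀⟩ := hS.exists_ord (fun t => if t ∈ T then ord t (a t) else 0)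
    (T.finite_toSet.subset fun t ht => by
      by_contra hT
      exact ht (if_neg hT))
  obtain ⟨z₁, hz₁, hz⟩ := h.surj (fun t => a t / z₀) fun t ht => by
    rw [ord_div, hz₀ t (h.disj t ht), if_pos ht, sub_self]
  refine ⟨z₁ * z₀, mul_mem (sUnits_mono subset_union_left hz₁) fun v hv => ?_, fun t ht => ?_⟩
  · rw [mem_union, not_or] at hv
    rw [hz₀ v hv.1, if_neg hv.2]
  · have := hz t ht
    rwa [div_div_eq_mul_div] at this

end detecting

section tameHasse
open Finset Module NumberField IsDedekindDomain WithZero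

variable {K : Type} [Field K] [NumberField K] {ℓ : ℕ} {ζ : K}

theorem Kum.N_aboveSet_relIndex {L : Type} [Field L] [NumberField L] [Algebra K L] {b : Kˣ}
    (D : Kum K L ℓ ζ b) (hodd : Odd ℓ) {S : Finset (Pl K)} (hS : Kills S)
    (ht : ∀ v ∉ S, v.valuation K (ζ - 1) = 1) (hb : b ∈ sUnits S) :
    ((sUnits (aboveSet L S)).map D.N).relIndex (sUnits S) ≠ 0 := by
  intro h0
  have h := D.normIndex hodd hS ht hb
  rw [h0, zero_mul] at h
  exact pow_ne_zero _ D.prime.ne_zero h.symm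

theorem Detects.inj (hℓ : ℓ.Prime) (hodd : Odd ℓ) (hζ : IsPrimitiveRoot ζ ℓ) [DecidableEq (Pl K)] {S T : Finset (Pl K)}
    (hS : Kills S) (htame : ∀ v ∉ S, v.valuation K (ζ - 1) = 1) (h : Detects ζ ℓ S T)
    {x : Kˣ} (hx : x ∈ sUnits (S ∪ T)) (hxS : ∀ v ∈ S, x ∈ Pg ζ ℓ v) : ∃ c : Kˣ, c ^ ℓ = x := by
  by_contra! hcon
  obtain ⟨L, _, _, _, ⟨D⟩⟩ := exists_kum hℓ hζ x hcon
  have hS' : Kills (S ∪ T) := hS.mono subset_union_left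
  have ht' : ∀ v ∉ S ∪ T, v.valuation K (ζ - 1) = 1 := fun v hv => htame v fun h => hv (mem_union_left _ h)
  have hidx := D.normIndex hodd hS' ht' hx
  have h0 := D.N_aboveSet_relIndex hodd hS' ht' hx
  let s := (S ∪ T).filter fun v => (above L v).card = 1
  have hsT : ∀ t ∈ s, t ∈ T := by
    intro t ht
    obtain ⟨h1, h2⟩ := mem_filter.1 ht
    refine (mem_union.1 h1).resolve_left fun h3 => ?_
    obtain ⟨w, rfl⟩ := exists_above (L := L) t
    exact D.not_mem_Pg h2 (hxS _ h3)
  have hg : ∀ t : Pl K, ∃ g : Kˣ, t ∈ s → g ∉ H ζ ℓ t x := by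
    intro t
    by_cases ht : t ∈ s
    · obtain ⟨g, hg⟩ := D.exists_not_mem_H (htame t (h.disj t (hsT t ht))) (mem_filter.1 ht).2
      exact ⟨g, fun _ => hg⟩
    · exact ⟨1, fun h => absurd h ht⟩
  choose g hg using hg
  have := pow_card_le_relIndex hℓ s (X := sUnits (S ∪ T)) (N := (sUnits (aboveSet L (S ∪ T))).map D.N)
    (H := fun t => H ζ ℓ t x) (g := g) ?_ hg (fun t _ => pow_mem_H _ _ _) (fun f => ?_) h0
  · rw [← hidx] at this
    have h1 := hℓ.one_lt
    have h2 := Nat.pos_of_ne_zero h0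
    nlinarith
  · rintro t ht _ ⟨y, -, rfl⟩
    exact D.N_mem_H hodd (htame t (h.disj t (hsT t ht))) y
  · obtain ⟨z, hz, hz'⟩ := h.surj_all hS fun t => g t ^ f t
    exact ⟨z, hz, fun t ht => mem_H_of_mem_Pg hℓ hζ (htame t (h.disj t (hsT t ht))) (hz' t (hsT t ht)) x⟩

theorem exists_div_mem_of_prod_index_le {A ι : Type*} [CommGroup A] (s : Finset ι) (P : ι → Subgroup A)
    (X : Subgroup A) (hfin : ∀ i ∈ s, (P i).index ≠ 0)
    (h : ∏ i ∈ s, (P i).index ≤ (⨅ i ∈ s, P i).relIndex X) (a : ι → A) :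
    ∃ x ∈ X, ∀ i ∈ s, x / a i ∈ P i := by
  let Q := ⨅ i ∈ s, P i
  have hQ : ∀ x, x ∈ Q ↔ ∀ i ∈ s, x ∈ P i := fun x => by simp only [Q, Subgroup.mem_iInf]
  let F : X ⧸ Q.subgroupOf X → ((i : s) → A ⧸ P i.1) := fun q i => QuotientGroup.mk (q.out : X).1
  have hF : Function.Injective F := by
    intro q q' hqq
    rw [← q.out_eq', ← q'.out_eq']
    refine mk_eq_mk_iff_div.2 ((hQ _).2 fun i hi => ?_)
    have := QuotientGroup.eq.1 (congrFun hqq ⟨i, hi⟩).symm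
    rwa [div_eq_inv_mul]
  have hfin' : ∀ i : s, Finite (A ⧸ P i.1) := fun i =>
    @Subgroup.finite_quotient_of_finiteIndex _ _ _ ⟨hfin i i.2⟩
  have hcard : Nat.card ((i : s) → A ⧸ P i.1) ≤ Nat.card (X ⧸ Q.subgroupOf X) := by
    rw [Nat.card_pi]
    exact le_trans (le_of_eq (prod_coe_sort s fun i => (P i).index)) h
  obtain ⟨q, hq⟩ := (hF.bijective_of_nat_card_le hcard).2 fun i => QuotientGroup.mk (a i.1)
  refine ⟨q.out, (q.out : X).2, fun i hi => ?_⟩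
  have := QuotientGroup.eq.1 (congrFun hq ⟨i, hi⟩).symm
  rwa [div_eq_inv_mul]

theorem Detects.surj_base (hℓ : ℓ.Prime) (hodd : Odd ℓ) (hζ : IsPrimitiveRoot ζ ℓ) [DecidableEq (Pl K)] {S T : Finset (Pl K)}
    (hS : Kills S) (htame : ∀ v ∉ S, v.valuation K (ζ - 1) = 1) (h : Detects ζ ℓ S T)
    (hT : NumberField.Units.rank K + 1 + S.card ≤ T.card) (a : Pl K → Kˣ) :
    ∃ z ∈ sUnits (S ∪ T), ∀ v ∈ S, z / a v ∈ Pg ζ ℓ v := by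
  have h2 : 2 < ℓ := by
    have := hℓ.two_le
    rcases hodd with ⟨k, hk⟩
    omega
  let X := sUnits (S ∪ T)
  let Q := ⨅ v ∈ S, Pg ζ ℓ v
  have hidx : ∀ v, (Pg ζ ℓ v).index ≠ 0 := fun v => by
    obtain ⟨e, he⟩ := exists_exp_zeta_sub_one hℓ hζ v
    exact (index_Pg hℓ hζ v e he).1
  refine exists_div_mem_of_prod_index_le S _ X (fun v _ => hidx v) ?_ a
  have hle : Q ⊓ X ≤ X.map (powMonoidHom ℓ) := by
    rintro x ⟨hxQ, hx⟩
    have hxQ' : ∀ v ∈ S, x ∈ Pg ζ ℓ v := by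
      change x ∈ Q at hxQ
      simpa only [Q, Subgroup.mem_iInf] using hxQ
    obtain ⟨c, hc⟩ := h.inj hℓ hodd hζ hS htame hx hxQ'
    refine ⟨c, fun v hv => ?_, hc⟩
    have h3 := mem_sUnits.1 hx v hv
    rw [← hc, ord_pow] at h3
    exact (mul_eq_zero.1 h3).resolve_left (by exact_mod_cast hℓ.ne_zero)
  have h5 : Q.relIndex X ≠ 0 := by
    intro h0
    have h6 : (⨅ v : S, Pg ζ ℓ v.1).index ≠ 0 := Subgroup.index_iInf_ne_zero fun v => hidx v
    have h7 : Q = ⨅ v : S, Pg ζ ℓ v.1 := iInf_subtype'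
    have h8 := Subgroup.relIndex_dvd_index_of_normal Q X
    rw [h0, zero_dvd_iff, h7] at h8
    exact h6 h8
  have h4 := Subgroup.relIndex_le_of_le_left hle (by rwa [Subgroup.inf_relIndex_right])
  rw [Subgroup.inf_relIndex_right, relIndex_map_pow, card_sUnits_mod hℓ hζ,
      card_union_of_disjoint (disjoint_left.2 fun v hv hv' => h.disj v hv' hv)] at h4
  refine ((prod_index_Pg hℓ hζ S).trans ?_).trans h4
  rw [← units_rank_of_rootOfUnity h2 hζ]
  exact Nat.pow_le_pow_right hℓ.pos (by omega)

/-- An element which is a local norm at the tame places is a norm, if the extension is split at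
the other places. -/
theorem Kum.exists_norm {L : Type} [Field L] [NumberField L] [Algebra K L] {b : Kˣ} (D : Kum K L ℓ ζ b)
    (hodd : Odd ℓ) (hb : ∀ v, v.valuation K (ζ - 1) ≠ 1 → b ∈ Pg ζ ℓ v) {a : Kˣ}
    (ha : ∀ v, v.valuation K (ζ - 1) = 1 → a ∈ H ζ ℓ v b) : ∃ y : Lˣ, D.N y = a := by
  classical
  have hℓ := D.prime
  have hζ := D.hζ
  obtain ⟨S, -, hS, htame, hA⟩ := exists_good_finset hℓ hζ ∅ {a, b}
  have haS : a ∈ sUnits S := hA a (by simp)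
  have hbS : b ∈ sUnits S := hA b (by simp)
  obtain ⟨T, t₁, hT, hbT, hdet⟩ := exists_detecting hℓ hodd hζ htame hbS D.not_pow
  have hS' : Kills (S ∪ T) := hS.mono subset_union_left
  have ht' : ∀ v ∉ S ∪ T, v.valuation K (ζ - 1) = 1 := fun v hv => htame v fun h => hv (mem_union_left _ h)
  have hbS' : b ∈ sUnits (S ∪ T) := sUnits_mono subset_union_left hbS
  have hidx := D.normIndex hodd hS' ht' hbS'
  have h0 := D.N_aboveSet_relIndex hodd hS' ht' hbS'
  let N := (sUnits (aboveSet L (S ∪ T))).map D.N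
  let s := S.filter fun v => (above L v).card = 1
  have hns : ∀ v, (above L v).card = 1 → b ∉ Pg ζ ℓ v := by
    intro v hv
    obtain ⟨w, rfl⟩ := exists_above (L := L) v
    exact D.not_mem_Pg hv
  have hst : ∀ v ∈ s, v.valuation K (ζ - 1) = 1 := fun v hv => by
    by_contra h
    exact hns v (mem_filter.1 hv).2 (hb v h)
  have hcard : ((S ∪ T).filter fun v => (above L v).card = 1).card ≤ s.card + 1 := by
    refine (card_le_card (t := insert t₁ s) ?_).trans (card_insert_le _ _)
    intro v hv
    obtain ⟨h1, h2⟩ := mem_filter.1 hv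
    rcases mem_union.1 h1 with h1 | h1
    · exact mem_insert_of_mem (mem_filter.2 ⟨h1, h2⟩)
    · by_cases hne : v = t₁
      · exact hne ▸ mem_insert_self _ _
      · exact absurd (hbT v h1 hne) (hns v h2)
  let Q : Subgroup Kˣ := sUnits (S ∪ T) ⊓ ⨅ v ∈ s, H ζ ℓ v b
  have hQ : ∀ x, x ∈ Q ↔ x ∈ sUnits (S ∪ T) ∧ ∀ v ∈ s, x ∈ H ζ ℓ v b := fun x => by
    rw [Subgroup.mem_inf]; simp only [Subgroup.mem_iInf]
  have hNQ : N ≤ Q := by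
    rintro _ ⟨y, hy, rfl⟩
    exact (hQ _).2 ⟨D.N_mem_sUnits hy, fun v hv => D.N_mem_H hodd (hst v hv) y⟩
  have hmul := Subgroup.relIndex_mul_relIndex N Q (sUnits (S ∪ T)) hNQ inf_le_left
  have hle : N.relIndex (sUnits (S ∪ T)) ≤ ℓ ^ s.card := by
    have h1 : N.relIndex (sUnits (S ∪ T)) * ℓ ≤ ℓ ^ s.card * ℓ := by
      rw [hidx, ← pow_succ]
      exact Nat.pow_le_pow_right hℓ.pos hcard
    exact Nat.le_of_mul_le_mul_right h1 hℓ.pos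
  have hg : ∀ t : Pl K, ∃ g : Kˣ, t ∈ s → g ∉ H ζ ℓ t b := by
    intro t
    by_cases ht : t ∈ s
    · obtain ⟨g, hg⟩ := D.exists_not_mem_H (hst t ht) (mem_filter.1 ht).2
      exact ⟨g, fun _ => hg⟩
    · exact ⟨1, fun h => absurd h ht⟩
  choose g hg using hg
  have hQ0 : Q.relIndex (sUnits (S ∪ T)) ≠ 0 := fun h => h0 (by
    change N.relIndex _ = 0
    rw [← hmul, h, mul_zero])
  have hge := pow_card_le_relIndex hℓ s (X := sUnits (S ∪ T)) (N := Q)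
    (H := fun t => H ζ ℓ t b) (g := g) (fun v hv x hx => ((hQ x).1 hx).2 v hv) hg (fun t _ => pow_mem_H _ _ _)
    (fun f => by
      obtain ⟨z, hz, hz'⟩ := hT.surj_base hℓ hodd hζ hS htame (hT.le_card hℓ hζ htame hdet) fun t => g t ^ f t
      exact ⟨z, hz, fun t ht => mem_H_of_mem_Pg hℓ hζ (hst t ht) (hz' t (mem_filter.1 ht).1) b⟩) hQ0
  have hone : N.relIndex Q = 1 := by
    have hp : 0 < N.relIndex Q := Nat.pos_of_ne_zero fun h => h0 (by
      change N.relIndex _ = 0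
      rw [← hmul, h, zero_mul])
    have hq : 0 < ℓ ^ s.card := pow_pos hℓ.pos _
    by_contra hne
    have : 2 ≤ N.relIndex Q := by omega
    nlinarith
  have haQ : a ∈ Q := (hQ a).2 ⟨sUnits_mono subset_union_left haS, fun v hv => ha v (hst v hv)⟩
  obtain ⟨y, -, hy⟩ := Subgroup.relIndex_eq_one.1 hone haQ
  exact ⟨y, hy⟩

end tameHasse

section normSymmetry
open Finset Module Polynomial

namespace Kum
variable {K L M : Type} [Field K] [Field L] [Algebra K L] [Field M] [Algebra K M] {ℓ : ℕ} {ζ : K}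
  {a b : Kˣ} (D : Kum K L ℓ ζ b)

theorem isIntegral_B : IsIntegral K (D.B : L) := by
  have := D.finiteDimensional
  exact Algebra.IsIntegral.isIntegral _

theorem minpoly_B : minpoly K (D.B : L) = X ^ ℓ - C (b : K) := by
  symm
  apply minpoly.eq_of_irreducible_of_monic
  · apply X_pow_sub_C_irreducible_of_prime D.prime
    intro c hc
    have h0 : c ≠ 0 := by
      rintro rfl
      rw [zero_pow D.prime.ne_zero] at hc
      exact b.ne_zero hc.symm
    exact D.not_pow (Units.mk0 c h0) (Units.ext hc)
  · simp [D.B_pow]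
  · exact monic_X_pow_sub_C _ D.prime.ne_zero

theorem adjoin_B : Algebra.adjoin K {(D.B : L)} = ⊤ := by
  rw [Algebra.adjoin_singleton_eq_range_aeval, eq_top_iff]
  rintro x -
  exact D.exists_aeval x

/-- The algebra map out of a Kummer extension sending the generator to a given `ℓ`-th root. -/
noncomputable def lift {A : Type} [Ring A] [Algebra K A] (i : A) (hi : i ^ ℓ = algebraMap K A b) :
    L →ₐ[K] A :=
  (PowerBasis.ofAdjoinEqTop D.isIntegral_B D.adjoin_B).lift i (by
    rw [PowerBasis.ofAdjoinEqTop_gen, D.minpoly_B]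
    simp [hi])

theorem lift_B {A : Type} [Ring A] [Algebra K A] (i : A) (hi : i ^ ℓ = algebraMap K A b) :
    D.lift i hi D.B = i := by
  have h := PowerBasis.lift_gen (PowerBasis.ofAdjoinEqTop D.isIntegral_B D.adjoin_B) i (by
    rw [PowerBasis.ofAdjoinEqTop_gen, D.minpoly_B]
    simp [hi])
  exact (congrArg (D.lift i hi) (PowerBasis.ofAdjoinEqTop_gen D.isIntegral_B D.adjoin_B).symm).trans h

theorem exists_norm_symm (D' : Kum K M ℓ ζ a) {x : Lˣ} (hx : D.N x = a) : ∃ y : Mˣ, D'.N y = b := by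
  have := D.finiteDimensional
  have := D'.finiteDimensional
  let i : Module.End K L := LinearMap.mulLeft K (x : L) ∘ₗ D.σ.toLinearMap
  have hi : ∀ z, i z = x * D.σ z := fun _ => rfl
  have hik : ∀ (k : ℕ) (z : L), (i ^ k) z = (∏ m ∈ range k, (D.σ ^ m) (x : L)) * (D.σ ^ k) z := by
    intro k z
    induction k with
    | zero => simp
    | succ k ih =>
      rw [pow_succ', Module.End.mul_apply, ih, hi, prod_range_succ', map_mul, map_prod]
      simp only [pow_succ', AlgEquiv.mul_apply, pow_zero, AlgEquiv.one_apply]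
      ring
  have hiℓ : i ^ ℓ = algebraMap K (Module.End K L) a := by
    ext z
    rw [hik, D.σ_pow_ℓ, ← D.norm_eq, Module.algebraMap_end_apply, AlgEquiv.one_apply, Algebra.smul_def, ← hx]
    rfl
  let Φ := D'.lift i hiℓ
  have hΦA : Φ (D'.B : M) = i := D'.lift_B i hiℓ
  let j : Module.End K L := LinearMap.mulLeft K ((D.B⁻¹ : Lˣ) : L)
  have hj : ∀ z, j z = ((D.B⁻¹ : Lˣ) : L) * z := fun _ => rfl
  have hcomm : ∀ m : M, j * Φ m = Φ (D'.σ m) * j := by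
    have h1 : j * i = algebraMap K (Module.End K L) ζ * (i * j) := by
      ext z
      simp only [Module.End.mul_apply, hi, hj, Module.algebraMap_end_apply, Algebra.smul_def, map_mul]
      have h2 : D.σ ((D.B⁻¹ : Lˣ) : L) * (algebraMap K L ζ * D.B) = 1 := by
        rw [← D.hσ, ← map_mul, Units.inv_mul, map_one]
      have h3 : algebraMap K L ζ * D.σ ((D.B⁻¹ : Lˣ) : L) = ((D.B⁻¹ : Lˣ) : L) := by
        apply mul_right_cancel₀ D.B.ne_zero
        rw [Units.inv_mul]
        linear_combination h2
      conv_lhs => rw [← h3]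
      ring
    have hA : j * Φ (D'.B : M) = Φ (D'.σ D'.B) * j := by
      rw [D'.hσ, map_mul, AlgHom.commutes, hΦA, h1, mul_assoc]
    intro m
    obtain ⟨P, rfl⟩ := D'.exists_aeval m
    induction P using Polynomial.induction_on with
    | C c => simp [Algebra.commutes]
    | add p q hp hq => simp only [map_add, mul_add, add_mul, hp, hq]
    | monomial n c h =>
      rw [pow_succ, ← mul_assoc]
      generalize C c * X ^ n = Q at h ⊢
      rw [map_mul, map_mul, map_mul, map_mul, aeval_X, ← mul_assoc, h, mul_assoc, hA, mul_assoc]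
  let e : M →ₗ[K] L := LinearMap.applyₗ (1 : L) ∘ₗ Φ.toLinearMap
  have he : ∀ m, e m = Φ m 1 := fun _ => rfl
  have hinj : Function.Injective e := by
    rw [injective_iff_map_eq_zero]
    intro m hm
    by_contra h0
    have h1 : Φ m⁻¹ (Φ m 1) = 1 := by
      rw [← Module.End.mul_apply, ← map_mul, inv_mul_cancel₀ h0, map_one Φ, Module.End.one_apply]
    rw [← he, hm, map_zero] at h1
    exact zero_ne_one h1
  have hsurj : Function.Surjective e :=
    (LinearMap.injective_iff_surjective_of_finrank_eq_finrank (by rw [D.hfin, D'.hfin])).1 hinj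
  obtain ⟨y, hy⟩ := hsurj ((D.B⁻¹ : Lˣ) : L)
  have hpow : ∀ k : ℕ, Φ (∏ m ∈ range k, (D'.σ ^ m) y) 1 = ((D.B⁻¹ : Lˣ) : L) ^ k := by
    intro k
    induction k with
    | zero => simp
    | succ k ih =>
      have h1 : ∏ m ∈ range (k + 1), (D'.σ ^ m) y = D'.σ (∏ m ∈ range k, (D'.σ ^ m) y) * y := by
        rw [prod_range_succ', map_prod]
        simp only [pow_succ', AlgEquiv.mul_apply, pow_zero, AlgEquiv.one_apply]
      rw [h1, map_mul, Module.End.mul_apply, ← he y, hy]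
      have h2 := congrArg (fun f : Module.End K L => f 1) (hcomm (∏ m ∈ range k, (D'.σ ^ m) y))
      simp only [Module.End.mul_apply, hj, mul_one] at h2
      rw [← h2, ih, pow_succ']
  have hy0 : y ≠ 0 := by
    rintro rfl
    rw [map_zero] at hy
    exact (D.B⁻¹).ne_zero hy.symm
  refine ⟨(Units.mk0 y hy0)⁻¹, ?_⟩
  rw [map_inv, inv_eq_iff_eq_inv]
  have h1 := hpow ℓ
  rw [← D'.norm_eq, AlgHom.commutes, Module.algebraMap_end_apply, Algebra.smul_def, mul_one] at h1
  apply Units.ext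
  change Algebra.norm K y = _
  apply (algebraMap K L).injective
  rw [h1, ← Units.val_pow_eq_pow_val, inv_pow, D.hB, ← map_inv]
  rfl

end Kum
end normSymmetry

section hasseNorm
open Finset Module NumberField IsDedekindDomain WithZero

namespace Kum
variable {K L : Type} [Field K] [NumberField K] [Field L] [NumberField L] [Algebra K L] {ℓ : ℕ} {ζ : K}
  {a : Kˣ} (D : Kum K L ℓ ζ a)
include D

/-- Simultaneous approximation of finitely many local norms by a global norm. -/
theorem exists_norm_div_mem_Pg (W : Finset (Pl K)) (β : Pl K → Lˣ) :
    ∃ x : Lˣ, ∀ v ∈ W, D.N x / D.N (β v) ∈ Pg ζ ℓ v := by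
  classical
  have hζ := D.hζL
  let S : Finset (Pl L) := W.biUnion (above L)
  have hr : ∀ w : Pl L, w.valuation L (algebraMap K L ζ - 1) ^ ℓ ≠ 0 := fun v =>
    pow_ne_zero _ (valuation_zeta_sub_one_ne_zero D.prime hζ v)
  have hle : ∀ w : Pl L, w.valuation L (algebraMap K L ζ - 1) ^ ℓ ≤ 1 := fun v =>
    pow_le_one' (valuation_zeta_sub_one_le D.prime.ne_zero hζ v) _
  obtain ⟨r, hr0, hr⟩ : ∃ r : ℤᵐ⁰, r ≠ 0 ∧ ∀ w ∈ S, r ≤ w.valuation L (algebraMap K L ζ - 1) ^ ℓ := by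
    refine ⟨∏ v ∈ S, v.valuation L (algebraMap K L ζ - 1) ^ ℓ, prod_ne_zero_iff.2 fun v _ => hr v, fun v hv => ?_⟩
    rw [← mul_prod_erase S _ hv]
    exact mul_le_of_le_one_right' (prod_le_one' fun v _ => hle v)
  obtain ⟨x, hx⟩ := weak_approx S (fun w => β (below K w)) hr0
  refine ⟨x, fun v hv => (mem_Pg D.prime D.hζ).2 ⟨1, ?_⟩⟩
  have hu : ∀ w : Pl L, below K w = v → w.valuation L (((x / β v : Lˣ) : L) - 1) < r := by
    rintro w rfl
    rw [Units.val_div_eq_div_val]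
    exact hx w (mem_biUnion.2 ⟨_, hv, mem_above.2 rfl⟩)
  rw [← map_div]
  generalize x / β v = u at hu
  obtain ⟨w, rfl⟩ := exists_above (L := L) v
  have hwS : w ∈ S := mem_biUnion.2 ⟨_, hv, mem_above.2 rfl⟩
  have h1 : inc K L (D.N u) ∈ oneUnits w r hr0 := by
    rw [D.inc_N]
    refine prod_mem fun i _ => ?_
    have h2 : w.valuation L ((uact (D.σ ^ i) u : L) - 1) < r := by
      have h3 := valuation_conj (D.σ ^ i)⁻¹ w ((D.σ ^ i) ((u : L) - 1))
      have h4 : ((D.σ ^ i)⁻¹ : L ≃ₐ[K] L) ((D.σ ^ i) ((u : L) - 1)) = (u : L) - 1 := by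
        rw [← AlgEquiv.mul_apply, inv_mul_cancel, AlgEquiv.one_apply]
      rw [h4, map_sub (D.σ ^ i), map_one (D.σ ^ i)] at h3
      rw [Units.coe_map]
      exact h3.symm.trans_lt (hu _ (below_conj _ _))
    exact ⟨h2, h2.trans_le ((hr w hwS).trans (hle w))⟩
  have h5 : w.valuation L (algebraMap K L ((D.N u : K) - 1)) < w.valuation L (algebraMap K L ((ζ - 1) ^ ℓ)) := by
    have h6 := h1.1.trans_le (hr w hwS)
    rw [map_sub (algebraMap K L), map_one (algebraMap K L), map_pow, map_pow, map_sub (algebraMap K L), map_one (algebraMap K L)]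
    exact h6
  rw [valuation_lt_iff_algebraMap, map_pow] at h5
  simpa using h5

/-- An element which is everywhere close to a local norm is a norm. -/
theorem exists_norm_of_local (hodd : Odd ℓ) {b : Kˣ}
    (hb : ∀ v : Pl K, ∃ β : Lˣ, b / D.N β ∈ Pg ζ ℓ v) : ∃ y : Lˣ, D.N y = b := by
  choose β hβ using hb
  obtain ⟨x, hx⟩ := D.exists_norm_div_mem_Pg (finite_not_tame D.prime D.hζ).toFinset β
  have hwild : ∀ v : Pl K, v.valuation K (ζ - 1) ≠ 1 → b / D.N x ∈ Pg ζ ℓ v := by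
    intro v hv
    have h1 := div_mem (hβ v) (hx v (by simpa using hv))
    rwa [div_div_div_cancel_right] at h1
  have htame : ∀ v : Pl K, v.valuation K (ζ - 1) = 1 → a ∈ H ζ ℓ v (b / D.N x) := by
    intro v hv
    refine mem_H_symm (div_mem ?_ (D.N_mem_H hodd hv x))
    have h1 := mul_mem (mem_H_of_mem_Pg D.prime D.hζ hv (hβ v) a) (D.N_mem_H hodd hv (β v))
    rwa [div_mul_cancel] at h1
  suffices h : ∃ y : Lˣ, D.N y = b / D.N x by
    obtain ⟨y, hy⟩ := h
    exact ⟨y * x, by rw [map_mul, hy, div_mul_cancel]⟩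
  by_cases hp : ∃ c : Kˣ, c ^ ℓ = b / D.N x
  · obtain ⟨c, hc⟩ := hp
    exact ⟨inc K L c, by rw [D.N_inc, hc]⟩
  · push Not at hp
    obtain ⟨M, _, _, _, ⟨D'⟩⟩ := exists_kum D.prime D.hζ _ hp
    obtain ⟨y, hy⟩ := D'.exists_norm hodd hwild htame
    exact D'.exists_norm_symm D hy

end Kum
end hasseNorm

section liftGraphs
open Finset

/-- The normaliser of a subgroup. -/
abbrev nor {W : Type*} [Group W] (S : Subgroup W) : Subgroup W := Subgroup.normalizer (S : Set W)

theorem mem_nor {W : Type*} [Group W] {S : Subgroup W} {p : W} : p ∈ nor S ↔ ∀ w, w ∈ S ↔ p * w * p⁻¹ ∈ S :=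
  Subgroup.mem_normalizer_iff

/-- A central extension of `G` by `C`. -/
structure CentralExt (C Gt G : Type*) [CommGroup C] [Group Gt] [Group G] where
  ι : C →* Gt
  π : Gt →* G
  inj : Function.Injective ι
  surj : Function.Surjective π
  exact : ∀ g, π g = 1 ↔ ∃ k, ι k = g
  central : ∀ k g, ι k * g = g * ι k

variable {C Gt G Λ U : Type*} [CommGroup C] [Group Gt] [Group G] [Group Λ] [CommGroup U]
  [MulDistribMulAction Λ U]

namespace CentralExt
variable (X : CentralExt C Gt G)

@[simp] theorem π_ι (k : C) : X.π (X.ι k) = 1 := (X.exact _).2 ⟨k, rfl⟩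

theorem exists_mul_ι {g g' : Gt} (h : X.π g = X.π g') : ∃ k, g * X.ι k = g' := by
  obtain ⟨k, hk⟩ := (X.exact (g⁻¹ * g')).1 (by rw [map_mul, map_inv, h, inv_mul_cancel])
  exact ⟨k, by rw [hk, mul_inv_cancel_left]⟩

/-- The graph of a lift of `φ` to `Gt` over the subgroup `H`. -/
structure IsLift (φ : Λ →* G) (H : Subgroup Λ) (S : Subgroup (Gt × Λ)) : Prop where
  mem : ∀ {w}, w ∈ S → w.2 ∈ H
  proj : ∀ {w}, w ∈ S → X.π w.1 = φ w.2
  lift : ∀ {h}, h ∈ H → ∃ g, (g, h) ∈ S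
  ker : ∀ {g}, (g, 1) ∈ S → g = 1

variable {X} in
theorem IsLift.uniq {φ : Λ →* G} {H : Subgroup Λ} {S : Subgroup (Gt × Λ)} (hS : X.IsLift φ H S)
    {g g' : Gt} {h : Λ} (h1 : (g, h) ∈ S) (h2 : (g', h) ∈ S) : g = g' := by
  have h3 := S.mul_mem h1 (S.inv_mem h2)
  rw [Prod.inv_mk, Prod.mk_mul_mk, mul_inv_cancel] at h3
  exact mul_inv_eq_one.1 (hS.ker h3)

/-- Extension of a lift along a cyclic extension. -/
theorem IsLift.extend {φ : Λ →* G} {H H₁ : Subgroup Λ} {S : Subgroup (Gt × Λ)} (hS : X.IsLift φ H₁ S)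
    {γ : Λ} {g : Gt} {m : ℤ} (hγ : γ ∈ H) (hH₁ : H₁ ≤ H) (hm : ∀ n : ℤ, γ ^ n ∈ H₁ → m ∣ n)
    (hH : ∀ h ∈ H, ∃ n : ℤ, h * γ ^ n ∈ H₁) (hg : X.π g = φ γ) (hn : (g, γ) ∈ nor S)
    (hp : (g, γ) ^ m ∈ S) : ∃ S', S ≤ S' ∧ X.IsLift φ H S' := by
  have hcomm : ∀ (n : ℤ) (w : Gt × Λ), w ∈ S → (g, γ) ^ n * w * ((g, γ) ^ n)⁻¹ ∈ S := fun n w hw =>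
    (mem_nor.1 (zpow_mem hn n) w).1 hw
  let S' : Subgroup (Gt × Λ) :=
    { carrier := {w | ∃ n : ℤ, w * (g, γ) ^ n ∈ S}
      one_mem' := ⟨0, by simp [S.one_mem]⟩
      mul_mem' := by
        rintro a b ⟨n, hn⟩ ⟨m, hm⟩
        refine ⟨m + n, ?_⟩
        have h1 := S.mul_mem hn (hcomm (-n) _ hm)
        convert h1 using 1
        rw [zpow_add, zpow_neg]
        group
      inv_mem' := by
        rintro a ⟨n, hn⟩
        refine ⟨-n, ?_⟩
        have h1 := hcomm n _ (S.inv_mem hn)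
        convert h1 using 1
        group }
  refine ⟨S', fun w hw => ⟨0, by simpa using hw⟩, ?_, ?_, ?_, ?_⟩
  · rintro w ⟨n, hn⟩
    have h1 := hH₁ (hS.mem hn)
    rw [Prod.snd_mul, Prod.pow_snd] at h1
    exact (Subgroup.mul_mem_cancel_right H (zpow_mem hγ n)).1 h1
  · rintro w ⟨n, hn⟩
    have h1 := hS.proj hn
    rw [Prod.snd_mul, Prod.pow_snd, Prod.fst_mul, Prod.pow_fst, map_mul, map_mul, map_zpow, map_zpow, hg] at h1
    exact mul_right_cancel h1
  · intro h hh
    obtain ⟨n, hn⟩ := hH h hh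
    obtain ⟨t, ht⟩ := hS.lift hn
    refine ⟨t * g ^ (-n), n, ?_⟩
    convert ht using 1
    ext <;> simp
  · rintro t ⟨n, hn⟩
    have h1 := hS.mem hn
    rw [Prod.snd_mul, Prod.pow_snd, one_mul] at h1
    obtain ⟨j, rfl⟩ := hm n h1
    rw [zpow_mul] at hn
    exact hS.ker ((Subgroup.mul_mem_cancel_right S (zpow_mem hp j)).1 hn)

end CentralExt

/-- The group in which cocycles with values in `U` and lifts to `Gt` live together. -/
abbrev Amb (Gt Λ U : Type*) [Group Gt] [Group Λ] [CommGroup U] [MulDistribMulAction Λ U] : Type _ :=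
  Gt × (U ⋊[MulDistribMulAction.toMulAut Λ U] Λ)

namespace Amb

/-- The element of the ambient group with given components. -/
def mk (g : Gt) (δ : U) (h : Λ) : Amb Gt Λ U := (g, ⟨δ, h⟩)

theorem exists_mk (w : Amb Gt Λ U) : ∃ g δ h, w = mk g δ h := ⟨w.1, w.2.left, w.2.right, rfl⟩

theorem mk_inj {g g' : Gt} {δ δ' : U} {h h' : Λ} : mk g δ h = mk g' δ' h' ↔ g = g' ∧ δ = δ' ∧ h = h' := by
  rw [mk, mk, Prod.mk.injEq, SemidirectProduct.ext_iff]

theorem mk_mul (g g' : Gt) (δ δ' : U) (h h' : Λ) :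
    mk g δ h * mk g' δ' h' = mk (g * g') (δ * h • δ') (h * h') := rfl

theorem mk_one : mk (1 : Gt) (1 : U) (1 : Λ) = 1 := rfl

theorem mk_inv (g : Gt) (δ : U) (h : Λ) : (mk g δ h)⁻¹ = mk g⁻¹ (h⁻¹ • δ⁻¹) h⁻¹ := by
  symm
  apply eq_inv_of_mul_eq_one_right
  rw [mk_mul, smul_inv_smul]
  simp [mk_one]

theorem mk_pow (g : Gt) (δ : U) (h : Λ) (n : ℕ) :
    mk g δ h ^ n = mk (g ^ n) (∏ i ∈ range n, h ^ i • δ) (h ^ n) := by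
  induction n with
  | zero => simp [mk_one]
  | succ n ih => rw [pow_succ, ih, mk_mul, prod_range_succ, ← pow_succ, ← pow_succ]

/-- The embedding of `U`. -/
def T (Gt Λ : Type*) {U : Type*} [Group Gt] [Group Λ] [CommGroup U] [MulDistribMulAction Λ U] (y : U) :
    Amb Gt Λ U := mk 1 y 1

theorem T_mul (y y' : U) : T Gt Λ y * T Gt Λ y' = T Gt Λ (y * y') := by
  simp [T, mk_mul]

theorem T_one : T Gt Λ (1 : U) = 1 := rfl

theorem T_inv (y : U) : (T Gt Λ y)⁻¹ = T Gt Λ y⁻¹ := by simp [T, mk_inv]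

theorem T_mul_mk (y : U) (g : Gt) (δ : U) (h : Λ) : T Gt Λ y * mk g δ h = mk g (y * δ) h := by
  simp [T, mk_mul]

theorem T_conj (y : U) (g : Gt) (δ : U) (h : Λ) :
    T Gt Λ y * mk g δ h * (T Gt Λ y)⁻¹ = mk g (δ * (y / h • y)) h := by
  rw [T_inv, T_mul_mk, T, mk_mul, mul_one, mul_one, smul_inv', div_eq_mul_inv]
  congr 1
  rw [mul_comm y δ, mul_assoc]

theorem mk_conj_T (y : U) (g : Gt) (δ : U) (h : Λ) :
    mk g δ h * T Gt Λ y = T Gt Λ (h • y) * mk g δ h := by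
  rw [T_mul_mk, T, mk_mul, mul_one, mul_one, mul_comm]

theorem T_mul_mk_pow (y : U) (g : Gt) (δ : U) (h : Λ) (n : ℕ) :
    (T Gt Λ y * mk g δ h) ^ n = T Gt Λ (∏ i ∈ range n, h ^ i • y) * mk g δ h ^ n := by
  rw [T_mul_mk, mk_pow, mk_pow, T_mul_mk, ← prod_mul_distrib]
  simp only [smul_mul']

variable (X : CentralExt C Gt G) (z : C →* U)

/-- The subgroup of the ambient group generated by the graph of a lift and the antidiagonal
copy of `C`. -/
def plus (S : Subgroup (Gt × Λ)) (hz : ∀ w ∈ S, ∀ k, w.2 • z k = z k) : Subgroup (Amb Gt Λ U) where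
  carrier := {w | ∃ k, (w.1 * X.ι k, w.2.right) ∈ S ∧ w.2.left = z k}
  one_mem' := ⟨1, by rw [map_one, mul_one]; exact S.one_mem, by simp⟩
  mul_mem' := by
    rintro a b ⟨k, hk, hk'⟩ ⟨l, hl, hl'⟩
    refine ⟨k * l, ?_, ?_⟩
    · convert S.mul_mem hk hl using 1
      rw [Prod.mk_mul_mk, map_mul]
      congr 1
      change a.1 * b.1 * _ = a.1 * _ * (b.1 * _)
      rw [mul_assoc a.1, mul_assoc a.1, ← mul_assoc (X.ι k), X.central k b.1, mul_assoc b.1]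
    · have h1 : (a * b).2.left = a.2.left * a.2.right • b.2.left := rfl
      rw [h1, hk', hl', hz _ hk, map_mul]
  inv_mem' := by
    rintro a ⟨k, hk, hk'⟩
    refine ⟨k⁻¹, ?_, ?_⟩
    · convert S.inv_mem hk using 1
      refine Prod.ext ?_ rfl
      change a.1⁻¹ * X.ι k⁻¹ = (a.1 * X.ι k)⁻¹
      rw [mul_inv_rev, ← map_inv, X.central]
    · have h1 : a⁻¹.2.left = a.2.right⁻¹ • a.2.left⁻¹ := rfl
      rw [h1, hk', ← map_inv, inv_smul_eq_iff, hz _ hk]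

variable {X z} {S : Subgroup (Gt × Λ)} {hz : ∀ w ∈ S, ∀ k, w.2 • z k = z k}

theorem mem_plus {g : Gt} {δ : U} {h : Λ} : mk g δ h ∈ plus X z S hz ↔ ∃ k, (g * X.ι k, h) ∈ S ∧ δ = z k :=
  Iff.rfl

theorem mk_mem_plus {g : Gt} {h : Λ} (hw : (g, h) ∈ S) : mk g 1 h ∈ plus X z S hz :=
  mem_plus.2 ⟨1, by simpa using hw, by simp⟩

theorem anti_mem_plus (k : C) : mk (X.ι k) (z k)⁻¹ 1 ∈ plus X z S hz :=
  mem_plus.2 ⟨k⁻¹, by rw [map_inv, mul_inv_cancel]; exact S.one_mem, by rw [map_inv]⟩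

theorem anti_comm {g : Gt} {δ : U} {h : Λ} (hh : ∀ k, h • z k = z k) (k : C) :
    mk (X.ι k) (z k)⁻¹ 1 * mk g δ h = mk g δ h * mk (X.ι k) (z k)⁻¹ 1 := by
  rw [mk_mul, mk_mul, one_smul, smul_inv', hh, X.central, one_mul, mul_one, mul_comm δ]

variable {φ : Λ →* G} {H₁ : Subgroup Λ} (hS : X.IsLift φ H₁ S)
include hS

theorem eq_one_of_T_mem {y : U} (hy : T Gt Λ y ∈ plus X z S hz) : y = 1 := by
  obtain ⟨k, hk, rfl⟩ := mem_plus.1 hy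
  have h1 := hS.ker hk
  rw [one_mul, ← map_one X.ι] at h1
  rw [X.inj h1, map_one]

theorem mem_of_mem_plus {g : Gt} {δ : U} {h : Λ} (hw : mk g δ h ∈ plus X z S hz) : h ∈ H₁ := by
  obtain ⟨k, hk, -⟩ := mem_plus.1 hw
  exact hS.mem hk

theorem smul_eq_of_T_mem_nor {y : U} (hy : T Gt Λ y ∈ nor (plus X z S hz)) {h : Λ} (hh : h ∈ H₁) :
    h • y = y := by
  obtain ⟨g, hg⟩ := hS.lift hh
  have h1 := (mem_nor.1 hy _).1 (mk_mem_plus (hz := hz) hg)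
  have h2 := Subgroup.mul_mem _ h1 (Subgroup.inv_mem _ (mk_mem_plus (X := X) (z := z) (hz := hz) hg))
  rw [T_conj, one_mul] at h2
  have h3 : mk g (y / h • y) h * (mk g 1 h)⁻¹ = T Gt Λ (y / h • y) := by
    rw [mul_inv_eq_iff_eq_mul, T_mul_mk, mul_one]
  rw [h3] at h2
  exact (div_eq_one.1 (eq_one_of_T_mem hS h2)).symm

theorem T_comm {y : U} (hy : ∀ h ∈ H₁, h • y = y) {w : Amb Gt Λ U} (hw : w ∈ plus X z S hz) :
    T Gt Λ y * w = w * T Gt Λ y := by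
  obtain ⟨g, δ, h, rfl⟩ := exists_mk w
  rw [mk_conj_T, hy h (mem_of_mem_plus hS hw)]

theorem T_mem_nor {y : U} (hy : ∀ h ∈ H₁, h • y = y) : T Gt Λ y ∈ nor (plus X z S hz) := by
  refine mem_nor.2 fun w => ⟨fun hw => ?_, fun hw => ?_⟩
  · rwa [T_comm hS hy hw, mul_inv_cancel_right]
  · have h1 := T_comm hS hy hw
    rw [inv_mul_cancel_right] at h1
    rwa [mul_left_cancel h1] at hw

/-- An element conjugating the graph of a lift into the enlarged graph normalises it. -/
theorem mem_nor_plus {g : Gt} {δ : U} {γ : Λ} (hγ : γ ∈ nor H₁) (hγz : ∀ k, γ • z k = z k)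
    (h : ∀ t τ, (t, τ) ∈ S → mk g δ γ * mk t 1 τ * (mk g δ γ)⁻¹ ∈ plus X z S hz) :
    mk g δ γ ∈ nor (plus X z S hz) := by
  have key : ∀ w ∈ plus X z S hz, mk g δ γ * w * (mk g δ γ)⁻¹ ∈ plus X z S hz := by
    intro w hw
    obtain ⟨t, y, τ, rfl⟩ := exists_mk w
    obtain ⟨k, hk, rfl⟩ := mem_plus.1 hw
    have h1 : mk t (z k) τ = mk (t * X.ι k) 1 τ * mk (X.ι k⁻¹) (z k⁻¹)⁻¹ 1 := by
      rw [mk_mul, mul_assoc, ← map_mul, mul_inv_cancel, map_one, mul_one, ← map_inv, inv_inv,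
        hz _ hk, one_mul, mul_one]
    rw [h1, ← mul_assoc, mul_assoc _ _ (mk g δ γ)⁻¹, mk_inv, anti_comm (by
      intro l; rw [inv_smul_eq_iff, hγz]), ← mul_assoc, ← mk_inv]
    exact Subgroup.mul_mem _ (h _ _ hk) (anti_mem_plus _)
  refine mem_nor.2 fun w => ⟨key w, fun hw => ?_⟩
  obtain ⟨t, y, τ, rfl⟩ := exists_mk w
  have hτ : τ ∈ H₁ := by
    have h1 := hw
    rw [mk_inv, mk_mul, mk_mul] at h1
    exact (mem_nor.1 hγ τ).2 (mem_of_mem_plus hS h1)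
  obtain ⟨t', ht'⟩ := hS.lift hτ
  have hm := mk_mem_plus (X := X) (z := z) (hz := hz) ht'
  have h2 := Subgroup.mul_mem _ hw (Subgroup.inv_mem _ (key _ hm))
  have h3 : mk g δ γ * mk t y τ * (mk g δ γ)⁻¹ * (mk g δ γ * mk t' 1 τ * (mk g δ γ)⁻¹)⁻¹ =
      mk g δ γ * (mk t y τ * (mk t' 1 τ)⁻¹) * (mk g δ γ)⁻¹ := by group
  have h4 : mk t y τ * (mk t' 1 τ)⁻¹ = mk (t * t'⁻¹) y 1 := by
    rw [mk_inv, mk_mul, mul_inv_cancel, inv_one, smul_one, smul_one, mul_one]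
  have h5 : mk g δ γ * mk (t * t'⁻¹) y 1 * (mk g δ γ)⁻¹ = mk (g * (t * t'⁻¹) * g⁻¹) (γ • y) 1 := by
    rw [mk_inv, mk_mul, mk_mul, mul_one, mul_inv_cancel, smul_inv_smul, mul_right_comm, mul_inv_cancel, one_mul]
  rw [h3, h4, h5] at h2
  obtain ⟨k, hk, hky⟩ := mem_plus.1 h2
  have h6 := hS.ker hk
  have h7 : X.ι k * (t * t'⁻¹) = 1 := by
    rwa [← X.central, ← mul_assoc, ← mul_assoc, X.central, mul_assoc g, conj_eq_one_iff] at h6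
  have h8 : y = z k := smul_left_cancel γ (hky.trans (hγz k).symm)
  refine mem_plus.2 ⟨k, ?_, h8⟩
  have h9 : t * X.ι k = t' := by
    rw [← X.central]
    rw [← mul_assoc, mul_inv_eq_one] at h7
    exact h7
  rw [h9]
  exact ht'

end Amb
end liftGraphs

section kummerTheory
open Finset

section roots
variable {M : Type*} [CommGroup M] {ℓ : ℕ}

/-- The homomorphism from the cyclic group of order `ℓ` sending the generator to `ζ`. -/
def zhom [NeZero ℓ] (ζ : M) (hζ : ζ ^ ℓ = 1) : Multiplicative (ZMod ℓ) →* M where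
  toFun k := ζ ^ (Multiplicative.toAdd k).val
  map_one' := by simp
  map_mul' a b := by
    rw [toAdd_mul, ZMod.val_add, ← pow_add]
    exact (pow_eq_pow_mod _ hζ).symm

variable [NeZero ℓ] {ζ : M} {hζ : ζ ^ ℓ = 1}

theorem zhom_apply (k : Multiplicative (ZMod ℓ)) : zhom ζ hζ k = ζ ^ (Multiplicative.toAdd k).val := rfl

theorem zhom_pow (k : Multiplicative (ZMod ℓ)) : zhom ζ hζ k ^ ℓ = 1 := by
  rw [zhom_apply, ← pow_mul, mul_comm, pow_mul, hζ, one_pow]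

theorem zhom_natCast (n : ℕ) : zhom ζ hζ (Multiplicative.ofAdd (n : ZMod ℓ)) = ζ ^ n := by
  rw [zhom_apply, toAdd_ofAdd, ZMod.val_natCast]
  exact (pow_eq_pow_mod _ hζ).symm

theorem smul_zhom {Λ : Type*} [Group Λ] [MulDistribMulAction Λ M] {σ : Λ} (h : σ • ζ = ζ)
    (k : Multiplicative (ZMod ℓ)) : σ • zhom ζ hζ k = zhom ζ hζ k := by
  rw [zhom_apply, smul_pow', h]

end roots

variable {k Ω : Type} [Field k] [Field Ω] [Algebra k Ω] [IsGalois k Ω] {ℓ : ℕ}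

theorem sum_range_shift {f : ℕ → Ω} (hf : f ℓ = f 0) : ∑ i ∈ range ℓ, f (i + 1) = ∑ i ∈ range ℓ, f i := by
  have h1 := (sum_range_succ f ℓ).symm.trans (sum_range_succ' f ℓ)
  rw [hf] at h1
  exact (add_right_cancel h1).symm

theorem smul_pow_fixed {N : Subgroup (Ω ≃ₐ[k] Ω)} {γ : Ω ≃ₐ[k] Ω} (hγ : γ ∈ nor N) {x : Ω}
    (hx : ∀ τ ∈ N, τ x = x) (i : ℕ) {τ : Ω ≃ₐ[k] Ω} (hτ : τ ∈ N) : τ ((γ ^ i) x) = (γ ^ i) x := by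
  have h1 : (γ ^ i)⁻¹ * τ * γ ^ i ∈ N := by
    refine (mem_nor.1 (pow_mem hγ i) _).2 ?_
    convert hτ using 1
    group
  have h2 : τ * γ ^ i = γ ^ i * ((γ ^ i)⁻¹ * τ * γ ^ i) := by group
  rw [← AlgEquiv.mul_apply, h2, AlgEquiv.mul_apply, hx _ h1]

theorem exists_zhom [NeZero ℓ] {ζ : Ωˣ} (hp : IsPrimitiveRoot (ζ : Ω) ℓ) (hζ : ζ ^ ℓ = 1) {u : Ωˣ} (hu : u ^ ℓ = 1) :
    ∃ k, zhom ζ hζ k = u := by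
  obtain ⟨i, -, hi⟩ := hp.eq_pow_of_pow_eq_one (ξ := (u : Ω)) (by rw [← Units.val_pow_eq_pow_val, hu, Units.val_one])
  exact ⟨Multiplicative.ofAdd (i : ZMod ℓ), by rw [zhom_natCast]; exact Units.ext hi⟩

theorem mem_of_fixes_fixedField {N : Subgroup (Ω ≃ₐ[k] Ω)} (hN : IsOpen (N : Set (Ω ≃ₐ[k] Ω)))
    {σ : Ω ≃ₐ[k] Ω} (h : ∀ x, (∀ τ ∈ N, τ x = x) → σ x = x) : σ ∈ N := by
  have h1 := InfiniteGalois.fixingSubgroup_fixedField (⟨N, N.isClosed_of_isOpen hN⟩ : ClosedSubgroup (Ω ≃ₐ[k] Ω))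
  have h2 : σ ∈ (IntermediateField.fixedField N).fixingSubgroup :=
    (IntermediateField.mem_fixingSubgroup_iff _ _).2 fun x hx => h x ((IntermediateField.mem_fixedField_iff _ _).1 hx)
  rwa [h1] at h2

/-- An eigenvector for a cyclic automorphism group. -/
theorem exists_eigenvector {N : Subgroup (Ω ≃ₐ[k] Ω)} (hN : IsOpen (N : Set (Ω ≃ₐ[k] Ω)))
    {γ : Ω ≃ₐ[k] Ω} (hγ : γ ∈ nor N) (hγN : ∀ i : ℤ, γ ^ i ∈ N ↔ (ℓ : ℤ) ∣ i) (hℓ : 0 < ℓ) {ζ : Ωˣ} (hζ : ζ ^ ℓ = 1)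
    (hNζ : ∀ τ ∈ N, τ • ζ = ζ) (hγζ : γ • ζ = ζ) : ∃ A : Ωˣ, (∀ τ ∈ N, τ • A = A) ∧ γ • A = ζ * A := by
  let E := IntermediateField.fixedField N
  let χ : Fin ℓ → (E →* Ω) := fun i => ((γ ^ (i : ℕ) : Ω ≃ₐ[k] Ω) : Ω →* Ω).comp (algebraMap E Ω : E →* Ω)
  have hE : ∀ x : E, ∀ τ ∈ N, τ (x : Ω) = x := fun x => (IntermediateField.mem_fixedField_iff _ _).1 x.2
  have hχ : Function.Injective χ := by
    intro i j hij
    have h1 : ((γ ^ (i : ℕ))⁻¹ * γ ^ (j : ℕ)) ∈ N := by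
      refine mem_of_fixes_fixedField hN fun x hx => ?_
      have h2 : (γ ^ (i : ℕ)) x = (γ ^ (j : ℕ)) x :=
        DFunLike.congr_fun hij (⟨x, (IntermediateField.mem_fixedField_iff _ _).2 hx⟩ : E)
      rw [AlgEquiv.mul_apply, ← h2, ← AlgEquiv.mul_apply, inv_mul_cancel, AlgEquiv.one_apply]
    have h3 : γ ^ ((j : ℤ) - (i : ℤ)) ∈ N := by
      convert h1 using 1
      rw [sub_eq_neg_add, zpow_add, zpow_neg, zpow_natCast, zpow_natCast]
    have h4 := (hγN _).1 h3
    have h5 := Int.eq_zero_of_abs_lt_dvd h4 (by rw [abs_lt]; omega)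
    exact Fin.ext (by omega)
  have hli := (linearIndependent_monoidHom E Ω).comp χ hχ
  rw [Fintype.linearIndependent_iff] at hli
  obtain ⟨x, hx⟩ : ∃ x : E, ∑ i : Fin ℓ, ((ζ⁻¹ ^ (i : ℕ) : Ωˣ) : Ω) * (γ ^ (i : ℕ)) (x : Ω) ≠ 0 := by
    by_contra! hcon
    refine (ζ⁻¹ ^ ((⟨0, hℓ⟩ : Fin ℓ) : ℕ) : Ωˣ).ne_zero (hli (fun i => ((ζ⁻¹ ^ (i : ℕ) : Ωˣ) : Ω)) ?_ ⟨0, hℓ⟩)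
    funext x
    rw [Finset.sum_apply]
    exact hcon x
  rw [Fin.sum_univ_eq_sum_range (fun i => ((ζ⁻¹ ^ i : Ωˣ) : Ω) * (γ ^ i) (x : Ω)) ℓ] at hx
  have hγx : (γ ^ ℓ) (x : Ω) = x := hE x _ (by
    have := (hγN ℓ).2 dvd_rfl
    rwa [zpow_natCast] at this)
  refine ⟨Units.mk0 _ hx, fun τ hτ => Units.ext ?_, Units.ext ?_⟩
  · change τ (∑ i ∈ range ℓ, ((ζ⁻¹ ^ i : Ωˣ) : Ω) * (γ ^ i) (x : Ω)) = _
    rw [map_sum]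
    refine sum_congr rfl fun i _ => ?_
    have h1 : τ ((ζ⁻¹ ^ i : Ωˣ) : Ω) = ((ζ⁻¹ ^ i : Ωˣ) : Ω) := by
      have : τ • (ζ⁻¹ ^ i) = ζ⁻¹ ^ i := by rw [smul_pow', smul_inv', hNζ τ hτ]
      exact congrArg Units.val this
    rw [map_mul, h1, smul_pow_fixed hγ (hE x) i hτ]
  · change γ (∑ i ∈ range ℓ, ((ζ⁻¹ ^ i : Ωˣ) : Ω) * (γ ^ i) (x : Ω)) = ζ * ∑ i ∈ range ℓ, ((ζ⁻¹ ^ i : Ωˣ) : Ω) * (γ ^ i) (x : Ω)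
    rw [map_sum, ← sum_range_shift (f := fun i => ((ζ⁻¹ ^ i : Ωˣ) : Ω) * (γ ^ i) (x : Ω)) (by simp [hγx, hζ]), mul_sum]
    refine sum_congr rfl fun i _ => ?_
    have h1 : γ ((ζ⁻¹ ^ i : Ωˣ) : Ω) = ((ζ⁻¹ ^ i : Ωˣ) : Ω) := by
      have : γ • (ζ⁻¹ ^ i) = ζ⁻¹ ^ i := by rw [smul_pow', smul_inv', hγζ]
      exact congrArg Units.val this
    rw [map_mul, h1, ← mul_assoc, ← Units.val_mul, pow_succ' γ, pow_succ' ζ⁻¹, mul_inv_cancel_left,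
      AlgEquiv.mul_apply]

/-- Kummer theory: a character of an open subgroup is given by an element of `Ω`. -/
theorem exists_kummer_generator (hℓ : ℓ.Prime) [NeZero ℓ] {H : Subgroup (Ω ≃ₐ[k] Ω)} {ζ : Ωˣ} (hζ : ζ ^ ℓ = 1)
    (hHζ : ∀ τ ∈ H, τ • ζ = ζ) (χ : H →* Multiplicative (ZMod ℓ)) {V : Subgroup (Ω ≃ₐ[k] Ω)}
    (hV : IsOpen (V : Set (Ω ≃ₐ[k] Ω))) (hVH : V ≤ H) (hχV : ∀ τ : H, (τ : Ω ≃ₐ[k] Ω) ∈ V → χ τ = 1) :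
    ∃ δ : Ωˣ, ∀ τ : H, (τ : Ω ≃ₐ[k] Ω) • δ = zhom ζ hζ (χ τ) * δ := by
  by_cases htriv : ∀ τ, χ τ = 1
  · exact ⟨1, fun τ => by rw [htriv τ, map_one, smul_one, one_mul]⟩
  push Not at htriv
  obtain ⟨τ₁, hτ₁⟩ := htriv
  have : Fact ℓ.Prime := ⟨hℓ⟩
  obtain ⟨τ₀, hτ₀⟩ : ∃ τ₀, χ τ₀ = Multiplicative.ofAdd (1 : ZMod ℓ) := by
    have h1 : (Multiplicative.toAdd (χ τ₁)) ≠ 0 := hτ₁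
    refine ⟨τ₁ ^ ((Multiplicative.toAdd (χ τ₁))⁻¹).val, ?_⟩
    rw [map_pow]
    apply Multiplicative.toAdd.injective
    rw [toAdd_pow, toAdd_ofAdd, nsmul_eq_mul, ZMod.natCast_val, ZMod.cast_id, inv_mul_cancel₀ h1]
  let N := χ.ker.map H.subtype
  have hmem : ∀ τ : H, (τ : Ω ≃ₐ[k] Ω) ∈ N ↔ χ τ = 1 := by
    intro τ
    constructor
    · rintro ⟨τ', h1, h2⟩
      rwa [← Subtype.ext h2]
    · exact fun h => ⟨τ, h, rfl⟩
  have hNH : N ≤ H := by rintro _ ⟨τ, -, rfl⟩; exact τ.2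
  have hN : IsOpen (N : Set (Ω ≃ₐ[k] Ω)) :=
    Subgroup.isOpen_mono (fun τ hτ => (hmem ⟨τ, hVH hτ⟩).2 (hχV _ hτ)) hV
  have hpow : ∀ i : ℤ, χ (τ₀ ^ i) = Multiplicative.ofAdd (i : ZMod ℓ) := by
    intro i
    rw [map_zpow, hτ₀, ← ofAdd_zsmul, zsmul_eq_mul, mul_one]
  have hnor : (τ₀ : Ω ≃ₐ[k] Ω) ∈ nor N := by
    refine mem_nor.2 fun w => ⟨fun hw => ?_, fun hw => ?_⟩
    · have h1 := (hmem (τ₀ * ⟨w, hNH hw⟩ * τ₀⁻¹)).2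
      rw [Subgroup.coe_mul, Subgroup.coe_mul, Subgroup.coe_inv] at h1
      refine h1 ?_
      rw [map_mul, map_mul, (hmem ⟨w, hNH hw⟩).1 hw, mul_one, map_inv, mul_inv_cancel]
    · have hwH : w ∈ H := by
        have h1 := hNH hw
        rwa [Subgroup.mul_mem_cancel_right H (H.inv_mem τ₀.2), Subgroup.mul_mem_cancel_left H τ₀.2] at h1
      have h1 := (hmem (τ₀ * ⟨w, hwH⟩ * τ₀⁻¹)).1 (by simpa only [Subgroup.coe_mul, Subgroup.coe_inv] using hw)
      rw [map_mul, map_mul, map_inv, mul_inv_cancel_comm] at h1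
      exact (hmem ⟨w, hwH⟩).2 h1
  obtain ⟨A, hA1, hA2⟩ := exists_eigenvector hN hnor (ℓ := ℓ) (fun i => by
    rw [← Subgroup.coe_zpow, hmem, hpow, ofAdd_eq_one, ZMod.intCast_zmod_eq_zero_iff_dvd]) hℓ.pos hζ
    (fun τ hτ => hHζ τ (hNH hτ)) (hHζ _ τ₀.2)
  have hA3 : ∀ n : ℕ, ((τ₀ ^ n : H) : Ω ≃ₐ[k] Ω) • A = ζ ^ n * A := by
    intro n
    induction n with
    | zero => simp
    | succ n ih =>
      rw [pow_succ', Subgroup.coe_mul, mul_smul, ih, smul_mul', smul_pow', hHζ _ τ₀.2, hA2, ← mul_assoc, pow_succ]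
  refine ⟨A, fun τ => ?_⟩
  obtain ⟨n, hn⟩ : ∃ n : ℕ, χ τ = Multiplicative.ofAdd (n : ZMod ℓ) :=
    ⟨(Multiplicative.toAdd (χ τ)).val, by rw [ZMod.natCast_val, ZMod.cast_id]; rfl⟩
  have h1 : ((τ * (τ₀ ^ n)⁻¹ : H) : Ω ≃ₐ[k] Ω) ∈ N := by
    rw [hmem, map_mul, map_inv, hn, ← zpow_natCast, hpow, Int.cast_natCast, mul_inv_cancel]
  have h2 : (τ : Ω ≃ₐ[k] Ω) = ((τ * (τ₀ ^ n)⁻¹ : H) : Ω ≃ₐ[k] Ω) * ((τ₀ ^ n : H) : Ω ≃ₐ[k] Ω) := by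
    rw [← Subgroup.coe_mul, inv_mul_cancel_right]
  rw [h2, mul_smul, hA3, smul_mul', hA1 _ h1, smul_pow', hHζ _ (hNH h1), hn, zhom_natCast]

/-- Interpolation of an element of a Kummer extension by powers of the generator. -/
theorem exists_interpolation [CharZero Ω] {N : Subgroup (Ω ≃ₐ[k] Ω)} {γ : Ω ≃ₐ[k] Ω} (hγ : γ ∈ nor N) (hγN : γ ^ ℓ ∈ N)
    (hℓ : ℓ.Prime) {ζ : Ωˣ} (hp : IsPrimitiveRoot (ζ : Ω) ℓ) (hNζ : ∀ τ ∈ N, τ • ζ = ζ) (hγζ : γ • ζ = ζ)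
    {A : Ωˣ} (hNA : ∀ τ ∈ N, τ • A = A) (hγA : γ • A = ζ * A) {x : Ω} (hx : ∀ τ ∈ N, τ x = x) :
    ∃ c : ℕ → Ω, (∀ j, ∀ τ ∈ N, τ (c j) = c j) ∧ (∀ j, γ (c j) = c j) ∧ x = ∑ j ∈ range ℓ, c j * A ^ j := by
  have hζ : ζ ^ ℓ = 1 := Units.ext hp.pow_eq_one
  have hℓ0 : (ℓ : Ω) ≠ 0 := Nat.cast_ne_zero.2 hℓ.ne_zero
  let f : ℕ → ℕ → Ω := fun j i => (((ζ⁻¹ ^ j) ^ i : Ωˣ) : Ω) * (γ ^ i) x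
  have hf : ∀ j i, f j i = (((ζ⁻¹ ^ j) ^ i : Ωˣ) : Ω) * (γ ^ i) x := fun _ _ => rfl
  have hfix : ∀ σ : Ω ≃ₐ[k] Ω, σ • ζ = ζ → ∀ n m, σ (((ζ⁻¹ ^ n) ^ m : Ωˣ) : Ω) = (((ζ⁻¹ ^ n) ^ m : Ωˣ) : Ω) := by
    intro σ hσ n m
    have : σ • (ζ⁻¹ ^ n) ^ m = (ζ⁻¹ ^ n) ^ m := by rw [smul_pow', smul_pow', smul_inv', hσ]
    exact congrArg Units.val this
  have hγx : (γ ^ ℓ) x = x := hx _ hγN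
  refine ⟨fun j => (∑ i ∈ range ℓ, f j i) / (ℓ * (A : Ω) ^ j), fun j τ hτ => ?_, fun j => ?_, ?_⟩
  · have h1 : τ (A : Ω) = A := congrArg Units.val (hNA τ hτ)
    dsimp only
    rw [map_div₀, map_mul, map_pow, h1, map_natCast, map_sum]
    congr 1
    refine sum_congr rfl fun i _ => ?_
    rw [map_mul, hfix τ (hNζ τ hτ), smul_pow_fixed hγ hx i hτ]
  · have h1 : γ (A : Ω) = ζ * A := congrArg Units.val hγA
    dsimp only
    rw [map_div₀, map_mul, map_pow, h1, map_natCast, map_sum, ← sum_range_shift (f := f j) (by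
      rw [hf, hf, hγx, ← pow_mul, mul_comm j, pow_mul, inv_pow ζ, hζ]; simp)]
    have h2 : ∀ i, γ (f j i) = (ζ : Ω) ^ j * f j (i + 1) := by
      intro i
      rw [hf, hf, map_mul, hfix γ hγζ, pow_succ' γ, pow_succ' (ζ⁻¹ ^ j), Units.val_mul, mul_assoc, ← mul_assoc ((ζ : Ω) ^ j),
        ← Units.val_pow_eq_pow_val, ← Units.val_mul, inv_pow, mul_inv_cancel, Units.val_one, one_mul,
        AlgEquiv.mul_apply]
    simp only [h2]
    rw [← mul_sum, mul_pow]
    have := ζ.ne_zero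
    have := A.ne_zero
    field_simp
  · have h1 : ∀ j, (∑ i ∈ range ℓ, f j i) / (ℓ * (A : Ω) ^ j) * (A : Ω) ^ j = (∑ i ∈ range ℓ, f j i) / ℓ := by
      intro j
      have := A.ne_zero
      field_simp
    simp only [h1]
    rw [← sum_div, sum_comm, eq_div_iff hℓ0, sum_eq_single 0]
    · simp [hf, mul_comm]
    · intro i hi hi0
      have h2 : ∀ j, f j i = (((ζ⁻¹ ^ i : Ωˣ) : Ω)) ^ j * (γ ^ i) x := by
        intro j
        rw [hf, ← pow_mul, mul_comm j, pow_mul, Units.val_pow_eq_pow_val]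
      simp only [h2]
      rw [← sum_mul]
      have h3 : IsPrimitiveRoot ((ζ⁻¹ ^ i : Ωˣ) : Ω) ℓ := by
        have h4 : IsPrimitiveRoot (ζ⁻¹ : Ω) ℓ := hp.inv
        have h5 := h4.pow_of_coprime i ((Nat.coprime_of_lt_prime hi0 (mem_range.1 hi) hℓ).symm)
        simpa using h5
      rw [h3.geom_sum_eq_zero hℓ.one_lt, zero_mul]
    · intro h
      exact absurd (mem_range.2 hℓ.pos) h

end kummerTheory

section kummerLifts
open Finset CentralExt

/-- A lift is continuous if it is trivial on an open subgroup. -/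
def Cts {Gt Λ : Type*} [Group Gt] [Group Λ] [TopologicalSpace Λ] (S : Subgroup (Gt × Λ)) : Prop :=
  ∃ V : Subgroup Λ, IsOpen (V : Set Λ) ∧ ∀ v ∈ V, ((1 : Gt), v) ∈ S

section group
variable {C Gt G Λ : Type*} [CommGroup C] [Group Gt] [Group G] [Group Λ]

/-- Two lifts of the same homomorphism differ by a character. -/
theorem CentralExt.IsLift.exists_character {X : CentralExt C Gt G} {φ : Λ →* G} {H : Subgroup Λ}
    {S S' : Subgroup (Gt × Λ)} (hS : X.IsLift φ H S) (hS' : X.IsLift φ H S') :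
    ∃ χ : H →* C, ∀ (h : H) (g g' : Gt), (g, (h : Λ)) ∈ S → (g', (h : Λ)) ∈ S' → g * X.ι (χ h) = g' := by
  have h1 : ∀ h : H, ∃ c, ∀ (g g' : Gt), (g, (h : Λ)) ∈ S → (g', (h : Λ)) ∈ S' → g * X.ι c = g' := by
    intro h
    obtain ⟨g, hg⟩ := hS.lift h.2
    obtain ⟨g', hg'⟩ := hS'.lift h.2
    obtain ⟨c, hc⟩ := X.exists_mul_ι ((hS.proj hg).trans (hS'.proj hg').symm)
    refine ⟨c, fun g₁ g₁' h₁ h₁' => ?_⟩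
    rw [hS.uniq h₁ hg, hS'.uniq h₁' hg', hc]
  choose χ hχ using h1
  refine ⟨MonoidHom.mk' χ fun a b => ?_, hχ⟩
  obtain ⟨ga, hga⟩ := hS.lift a.2
  obtain ⟨ga', hga'⟩ := hS'.lift a.2
  obtain ⟨gb, hgb⟩ := hS.lift b.2
  obtain ⟨gb', hgb'⟩ := hS'.lift b.2
  have h2 := hχ (a * b) (ga * gb) (ga' * gb') (S.mul_mem hga hgb) (S'.mul_mem hga' hgb')
  rw [← hχ a ga ga' hga hga', ← hχ b gb gb' hgb hgb', mul_assoc ga (X.ι _), ← mul_assoc (X.ι _) gb, X.central,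
    mul_assoc gb, ← mul_assoc ga, mul_right_inj, ← map_mul] at h2
  exact X.inj h2

/-- The conjugate of a lift. -/
theorem CentralExt.IsLift.conj {X : CentralExt C Gt G} {φ : Λ →* G} {H : Subgroup Λ}
    {S : Subgroup (Gt × Λ)} (hS : X.IsLift φ H S) {γ : Λ} (hγ : γ ∈ nor H) {g : Gt} (hg : X.π g = φ γ) :
    X.IsLift φ H (S.map (MulAut.conj (g, γ)).toMonoidHom) := by
  constructor
  · rintro _ ⟨w, hw, rfl⟩
    exact (mem_nor.1 hγ _).1 (hS.mem hw)
  · rintro _ ⟨w, hw, rfl⟩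
    change X.π (g * w.1 * g⁻¹) = φ (γ * w.2 * γ⁻¹)
    simp only [map_mul, map_inv, hg, hS.proj hw]
  · intro h hh
    obtain ⟨t, ht⟩ := hS.lift (h := γ⁻¹ * h * γ) ((mem_nor.1 hγ _).2 (by convert hh using 1; group))
    refine ⟨g * t * g⁻¹, _, ht, ?_⟩
    change (g * t * g⁻¹, γ * (γ⁻¹ * h * γ) * γ⁻¹) = _
    congr 1
    group
  · rintro t ⟨w, hw, hwt⟩
    have h1 : g * w.1 * g⁻¹ = t := congrArg Prod.fst hwt
    have h2 : γ * w.2 * γ⁻¹ = 1 := congrArg Prod.snd hwt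
    rw [conj_eq_one_iff] at h2
    have h3 : (w.1, (1 : Λ)) ∈ S := by rw [← h2]; exact hw
    rw [← h1, hS.ker h3, mul_one, mul_inv_cancel]

end group

variable {Gt G : Type*} [Group Gt] [Group G] {k Ω : Type} [Field k] [Field Ω] [Algebra k Ω] [IsGalois k Ω] {ℓ : ℕ} [NeZero ℓ]

theorem isOpen_comap_mulAut {Λ : Type*} [Group Λ] [TopologicalSpace Λ] [IsTopologicalGroup Λ] {V : Subgroup Λ}
    (hV : IsOpen (V : Set Λ)) (γ : Λ) : IsOpen (V.comap (MulAut.conj γ).toMonoidHom : Set Λ) :=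
  hV.preimage (show Continuous fun x : Λ => γ * x * γ⁻¹ by fun_prop)

theorem isOpen_inf {Λ : Type*} [Group Λ] [TopologicalSpace Λ] {V W : Subgroup Λ}
    (hV : IsOpen (V : Set Λ)) (hW : IsOpen (W : Set Λ)) : IsOpen ((V ⊓ W : Subgroup Λ) : Set Λ) :=
  hV.inter hW

/-- Two continuous lifts become conjugate in the ambient group. -/
theorem exists_conj_lift (hℓ : ℓ.Prime) {X : CentralExt (Multiplicative (ZMod ℓ)) Gt G} {φ : (Ω ≃ₐ[k] Ω) →* G}
    {H : Subgroup (Ω ≃ₐ[k] Ω)} {S S' : Subgroup (Gt × (Ω ≃ₐ[k] Ω))} (hS : X.IsLift φ H S) (hS' : X.IsLift φ H S')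
    (hc : Cts S) (hc' : Cts S') {ζ : Ωˣ} (hζ : ζ ^ ℓ = 1) (hHζ : ∀ τ ∈ H, τ • ζ = ζ)
    (hz : ∀ w ∈ S, ∀ k, w.2 • zhom ζ hζ k = zhom ζ hζ k) :
    ∃ δ : Ωˣ, ∀ g h, (g, h) ∈ S' → Amb.T Gt _ δ * Amb.mk g 1 h * (Amb.T Gt _ δ)⁻¹ ∈ Amb.plus X (zhom ζ hζ) S hz := by
  obtain ⟨χ, hχ⟩ := hS.exists_character hS'
  obtain ⟨V, hV, hVS⟩ := hc
  obtain ⟨V', hV', hVS'⟩ := hc'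
  obtain ⟨δ, hδ⟩ := exists_kummer_generator hℓ hζ hHζ χ (isOpen_inf hV hV') (fun v hv => hS.mem (hVS v hv.1)) (by
    intro τ hτ
    have h1 := hχ τ 1 1 (hVS _ hτ.1) (hVS' _ hτ.2)
    rw [one_mul, ← map_one X.ι] at h1
    exact X.inj h1)
  refine ⟨δ, fun g h hg => ?_⟩
  have hh := hS'.mem hg
  obtain ⟨g₀, hg₀⟩ := hS.lift hh
  have h1 := hχ ⟨h, hh⟩ g₀ g hg₀ hg
  rw [Amb.T_conj, one_mul, Amb.mem_plus]
  refine ⟨(χ ⟨h, hh⟩)⁻¹, ?_, ?_⟩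
  · rw [← h1, mul_assoc, ← map_mul, mul_inv_cancel, map_one, mul_one]
    exact hg₀
  · have h2 := hδ ⟨h, hh⟩
    rw [h2, map_inv, div_mul_cancel_right]

/-- A continuous lift over a subgroup together with an automorphism normalising it, of order `ℓ`
modulo the subgroup. -/
structure Step (X : CentralExt (Multiplicative (ZMod ℓ)) Gt G) (φ : (Ω ≃ₐ[k] Ω) →* G) (ζ : Ωˣ)
    (H H₁ : Subgroup (Ω ≃ₐ[k] Ω)) (S : Subgroup (Gt × (Ω ≃ₐ[k] Ω))) (γ : Ω ≃ₐ[k] Ω) : Prop where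
  prime : ℓ.Prime
  primitive : IsPrimitiveRoot (ζ : Ω) ℓ
  fix : ∀ h ∈ H, h • ζ = ζ
  le : H₁ ≤ H
  mem : γ ∈ H
  nor : γ ∈ nor H₁
  pow_mem : ∀ i : ℤ, γ ^ i ∈ H₁ ↔ (ℓ : ℤ) ∣ i
  exists_pow : ∀ h ∈ H, ∃ n : ℤ, h * γ ^ n ∈ H₁
  isLift : X.IsLift φ H₁ S
  cts : Cts S

namespace Step
variable {X : CentralExt (Multiplicative (ZMod ℓ)) Gt G} {φ : (Ω ≃ₐ[k] Ω) →* G} {ζ : Ωˣ}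
    {H H₁ : Subgroup (Ω ≃ₐ[k] Ω)} {S : Subgroup (Gt × (Ω ≃ₐ[k] Ω))} {γ : Ω ≃ₐ[k] Ω} (P : Step X φ ζ H H₁ S γ)
include P

theorem pow_eq_one : ζ ^ ℓ = 1 := Units.ext P.primitive.pow_eq_one

theorem smul_z {h : Ω ≃ₐ[k] Ω} (hh : h ∈ H) (c : Multiplicative (ZMod ℓ)) :
    h • zhom ζ P.pow_eq_one c = zhom ζ P.pow_eq_one c := smul_zhom (P.fix h hh) c

theorem smul_z_lift : ∀ w ∈ S, ∀ c, w.2 • zhom ζ P.pow_eq_one c = zhom ζ P.pow_eq_one c :=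
  fun _ hw c => P.smul_z (P.le (P.isLift.mem hw)) c

/-- The enlarged graph of the lift. -/
abbrev Sp : Subgroup (Amb Gt (Ω ≃ₐ[k] Ω) Ωˣ) := Amb.plus X (zhom ζ P.pow_eq_one) S P.smul_z_lift

theorem exists_mem_nor : ∃ g δ, X.π g = φ γ ∧ Amb.mk g δ γ ∈ EmbeddingProblem.nor P.Sp := by
  obtain ⟨g, hg⟩ := X.surj (φ γ)
  have hc : Cts (S.map (MulAut.conj (g, γ)).toMonoidHom) := by
    obtain ⟨V, hV, hVS⟩ := P.cts
    refine ⟨_, isOpen_comap_mulAut hV γ⁻¹, fun v hv => ⟨_, hVS _ hv, ?_⟩⟩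
    change (g * 1 * g⁻¹, γ * (γ⁻¹ * v * γ⁻¹⁻¹) * γ⁻¹) = _
    congr 1 <;> group
  obtain ⟨δ, hδ⟩ := exists_conj_lift P.prime P.isLift (P.isLift.conj P.nor hg) P.cts hc P.pow_eq_one
    (fun τ hτ => P.fix τ (P.le hτ)) P.smul_z_lift
  refine ⟨g, δ, hg, Amb.mem_nor_plus P.isLift P.nor (P.smul_z P.mem) fun t τ ht => ?_⟩
  have h1 := hδ _ _ (⟨_, ht, rfl⟩ : (g * t * g⁻¹, γ * τ * γ⁻¹) ∈ S.map (MulAut.conj (g, γ)).toMonoidHom)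
  convert h1 using 1
  have h2 : Amb.mk g δ γ = Amb.T Gt _ δ * Amb.mk g 1 γ := by rw [Amb.T_mul_mk, mul_one]
  have h3 : Amb.mk (g * t * g⁻¹) (1 : Ωˣ) (γ * τ * γ⁻¹) = Amb.mk g 1 γ * Amb.mk t 1 τ * (Amb.mk g 1 γ)⁻¹ := by
    rw [Amb.mk_inv, Amb.mk_mul, Amb.mk_mul, inv_one, smul_one, smul_one, smul_one, mul_one, mul_one]
  rw [h2, h3]
  group

end Step
end kummerLifts

section stepFacts
open Finset CentralExt

section amb
variable {C Gt G Λ U : Type*} [CommGroup C] [Group Gt] [Group G] [Group Λ] [CommGroup U]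
  [MulDistribMulAction Λ U] {X : CentralExt C Gt G} {z : C →* U} {S : Subgroup (Gt × Λ)}
  {hz : ∀ w ∈ S, ∀ k, w.2 • z k = z k} {φ : Λ →* G} {H₁ : Subgroup Λ}

/-- An element lying over the base of the lift is a member of the enlarged graph up to translation. -/
theorem Amb.exists_eq_T_mul (hS : X.IsLift φ H₁ S) {g : Gt} {δ : U} {h : Λ} (hh : h ∈ H₁) (hg : X.π g = φ h) :
    ∃ b, ∃ q ∈ plus X z S hz, mk g δ h = T Gt Λ b * q := by
  obtain ⟨t, ht⟩ := hS.lift hh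
  obtain ⟨c, hc⟩ := X.exists_mul_ι (hg.trans (hS.proj ht).symm)
  refine ⟨δ / z c, mk g (z c) h, mem_plus.2 ⟨c, by rwa [hc], rfl⟩, ?_⟩
  rw [T_mul_mk, div_mul_cancel]

theorem exists_mul_pow {W : Type*} [Group W] {S : Subgroup W} {p q : W} (hp : p ∈ nor S) (hq : q ∈ S) (n : ℕ) :
    ∃ q' ∈ S, (q * p) ^ n = q' * p ^ n := by
  induction n with
  | zero => exact ⟨1, S.one_mem, by simp⟩
  | succ n ih =>
    obtain ⟨q', hq', h⟩ := ih
    refine ⟨q' * (p ^ n * q * (p ^ n)⁻¹), S.mul_mem hq' ((mem_nor.1 (pow_mem hp n) q).1 hq), ?_⟩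
    rw [pow_succ, h, pow_succ]
    group

theorem mem_nor_self {W : Type*} [Group W] {S : Subgroup W} {q : W} (hq : q ∈ S) : q ∈ nor S :=
  Subgroup.le_normalizer hq

theorem Amb.mk_conj_mk (g t : Gt) (δ : U) (γ τ : Λ) :
    mk g δ γ * mk t 1 τ * (mk g δ γ)⁻¹ = mk (g * t * g⁻¹) (δ / (γ * τ * γ⁻¹) • δ) (γ * τ * γ⁻¹) := by
  rw [mk_inv, mk_mul, mk_mul, smul_one, mul_one, smul_inv', smul_inv', ← mul_smul, div_eq_mul_inv]

theorem smul_eq_of_mul_inv_mem {hS : X.IsLift φ H₁ S} {p q : Amb Gt Λ U} (hp : p ∈ nor (Amb.plus X z S hz))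
    {n : ℕ} {b : U} (hq : q ∈ Amb.plus X z S hz) (h : p ^ n = Amb.T Gt Λ b * q) : p.2.right • b = b := by
  obtain ⟨g, δ, γ, rfl⟩ := Amb.exists_mk p
  have h1 : Amb.mk g δ γ * (Amb.T Gt Λ b * q) * (Amb.mk g δ γ)⁻¹ = Amb.T Gt Λ b * q := by
    rw [← h]; group
  have h2 : Amb.mk g δ γ * (Amb.T Gt Λ b * q) * (Amb.mk g δ γ)⁻¹ =
      Amb.T Gt Λ (γ • b) * (Amb.mk g δ γ * q * (Amb.mk g δ γ)⁻¹) := by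
    rw [← mul_assoc, Amb.mk_conj_T]; group
  have h3 : Amb.T Gt Λ (γ • b / b) = q * (Amb.mk g δ γ * q * (Amb.mk g δ γ)⁻¹)⁻¹ := by
    rw [eq_mul_inv_iff_mul_eq, div_eq_inv_mul, ← Amb.T_mul, ← Amb.T_inv, mul_assoc, ← h2, h1, inv_mul_cancel_left]
  have h4 : Amb.T Gt Λ (γ • b / b) ∈ Amb.plus X z S hz := by
    rw [h3]
    exact Subgroup.mul_mem _ hq (Subgroup.inv_mem _ ((mem_nor.1 hp _).1 hq))
  exact div_eq_one.1 (Amb.eq_one_of_T_mem hS h4)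

theorem smul_eq_of_factor {hS : X.IsLift φ H₁ S} {p q : Amb Gt Λ U} (hp : p ∈ nor (Amb.plus X z S hz))
    {b : U} (hq : q ∈ Amb.plus X z S hz) (h : p = Amb.T Gt Λ b * q) {τ : Λ} (hτ : τ ∈ H₁) : τ • b = b := by
  refine Amb.smul_eq_of_T_mem_nor hS (hz := hz) ?_ hτ
  rw [← mul_inv_eq_iff_eq_mul] at h
  rw [← h]
  exact Subgroup.mul_mem _ hp (Subgroup.inv_mem _ (mem_nor_self hq))

end amb

variable {Gt G : Type*} [Group Gt] [Group G] {k Ω : Type} [Field k] [Field Ω] [Algebra k Ω] [IsGalois k Ω] {ℓ : ℕ} [NeZero ℓ]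

namespace Step
variable {X : CentralExt (Multiplicative (ZMod ℓ)) Gt G} {φ : (Ω ≃ₐ[k] Ω) →* G} {ζ : Ωˣ}
    {H H₁ : Subgroup (Ω ≃ₐ[k] Ω)} {S : Subgroup (Gt × (Ω ≃ₐ[k] Ω))} {γ : Ω ≃ₐ[k] Ω} (P : Step X φ ζ H H₁ S γ)
include P

theorem pow_ell_mem : γ ^ ℓ ∈ H₁ := by
  have := (P.pow_mem ℓ).2 dvd_rfl
  rwa [zpow_natCast] at this

theorem isOpen : IsOpen (H₁ : Set (Ω ≃ₐ[k] Ω)) := by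
  obtain ⟨V, hV, hVS⟩ := P.cts
  exact Subgroup.isOpen_mono (fun v hv => P.isLift.mem (hVS v hv)) hV

/-- The data of a lift of the generator and the obstruction to extending the lift. -/
structure Obstruction (g : Gt) (δ b : Ωˣ) (q : Amb Gt (Ω ≃ₐ[k] Ω) Ωˣ) : Prop where
  proj : X.π g = φ γ
  nor : Amb.mk g δ γ ∈ EmbeddingProblem.nor P.Sp
  mem : q ∈ P.Sp
  eq : Amb.mk g δ γ ^ ℓ = Amb.T Gt _ b * q

theorem exists_obstruction : ∃ g δ b q, P.Obstruction g δ b q := by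
  obtain ⟨g, δ, hg, hn⟩ := P.exists_mem_nor
  obtain ⟨b, q, hq, h⟩ := Amb.exists_eq_T_mul (δ := ∏ i ∈ range ℓ, γ ^ i • δ) (z := zhom ζ P.pow_eq_one)
    (hz := P.smul_z_lift) P.isLift P.pow_ell_mem (show X.π (g ^ ℓ) = φ (γ ^ ℓ) by rw [map_pow, map_pow, hg])
  exact ⟨g, δ, b, q, hg, hn, hq, by rw [Amb.mk_pow, h]⟩

theorem fixed_of_fixed {x : Ωˣ} (h1 : ∀ τ ∈ H₁, τ • x = x) (h2 : γ • x = x) {h : Ω ≃ₐ[k] Ω} (hh : h ∈ H) : h • x = x := by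
  obtain ⟨n, hn⟩ := P.exists_pow h hh
  have h3 : γ ^ n ∈ MulAction.stabilizer (Ω ≃ₐ[k] Ω) x := zpow_mem h2 n
  have h4 : h = (h * γ ^ n) * (γ ^ n)⁻¹ := by group
  rw [h4, mul_smul, inv_mem h3, h1 _ hn]

variable {P} in
theorem Obstruction.fixed {g : Gt} {δ b : Ωˣ} {q : Amb Gt (Ω ≃ₐ[k] Ω) Ωˣ} (O : P.Obstruction g δ b q)
    {h : Ω ≃ₐ[k] Ω} (hh : h ∈ H) : h • b = b :=
  P.fixed_of_fixed (fun _ hτ => smul_eq_of_factor (hS := P.isLift) (hz := P.smul_z_lift) (_root_.pow_mem O.nor ℓ) O.mem O.eq hτ)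
    (smul_eq_of_mul_inv_mem (hS := P.isLift) O.nor O.mem O.eq) hh

theorem exists_eigenvector : ∃ A : Ωˣ, (∀ τ ∈ H₁, τ • A = A) ∧ γ • A = ζ * A :=
  EmbeddingProblem.exists_eigenvector P.isOpen P.nor P.pow_mem P.prime.pos P.pow_eq_one (fun τ hτ => P.fix τ (P.le hτ))
    (P.fix γ P.mem)

variable {P} in
/-- If the obstruction is a norm, a generator can be chosen with trivial obstruction. -/
theorem Obstruction.adjust {g : Gt} {δ b y : Ωˣ} {q : Amb Gt (Ω ≃ₐ[k] Ω) Ωˣ} (O : P.Obstruction g δ b q)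
    (hy : ∀ τ ∈ H₁, τ • y = y) (hb : ∏ i ∈ range ℓ, γ ^ i • y = b) : ∃ δ', P.Obstruction g δ' 1 q := by
  refine ⟨y⁻¹ * δ, O.proj, ?_, O.mem, ?_⟩
  · rw [← Amb.T_mul_mk]
    exact Subgroup.mul_mem _ (Amb.T_mem_nor P.isLift fun h hh => by rw [smul_inv', hy h hh]) O.nor
  · rw [← Amb.T_mul_mk, Amb.T_mul_mk_pow, O.eq, ← mul_assoc, Amb.T_mul]
    congr 2
    simp only [smul_inv', prod_inv_distrib, hb, inv_mul_cancel]

variable {P} in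
theorem Obstruction.smul_pow {g : Gt} {δ b : Ωˣ} {q : Amb Gt (Ω ≃ₐ[k] Ω) Ωˣ} (O : P.Obstruction g δ b q)
    {τ : Ω ≃ₐ[k] Ω} (hτ : τ ∈ H₁) : τ • δ ^ ℓ = δ ^ ℓ := by
  have h0 : γ * (γ⁻¹ * τ * γ) * γ⁻¹ = τ := by group
  obtain ⟨t, ht⟩ := P.isLift.lift (h := γ⁻¹ * τ * γ) ((mem_nor.1 P.nor _).2 (by rwa [h0]))
  have h1 := (mem_nor.1 O.nor _).1 (Amb.mk_mem_plus (hz := P.smul_z_lift) ht)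
  rw [Amb.mk_conj_mk, h0] at h1
  obtain ⟨c, -, hc⟩ := Amb.mem_plus.1 h1
  have h2 := congrArg (· ^ ℓ) hc
  simp only [zhom_pow, div_pow] at h2
  rw [smul_pow', div_eq_one.1 h2]

variable {P} in
theorem Obstruction.prod_smul_pow {g : Gt} {δ : Ωˣ} {q : Amb Gt (Ω ≃ₐ[k] Ω) Ωˣ} (O : P.Obstruction g δ 1 q) :
    ∏ i ∈ range ℓ, γ ^ i • δ ^ ℓ = 1 := by
  have h1 := O.eq
  rw [Amb.T_one, one_mul, Amb.mk_pow] at h1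
  have h2 := O.mem
  rw [← h1] at h2
  obtain ⟨c, -, hc⟩ := Amb.mem_plus.1 h2
  simp only [smul_pow', prod_pow]
  rw [hc, zhom_pow]

end Step
end stepFacts

section stepModels
open Finset CentralExt

variable {Gt G : Type*} [Group Gt] [Group G] {k Ω : Type} [Field k] [Field Ω] [Algebra k Ω] [IsGalois k Ω] {ℓ : ℕ} [NeZero ℓ]

theorem zhom_injective {ζ : Ωˣ} (hp : IsPrimitiveRoot (ζ : Ω) ℓ) (hζ : ζ ^ ℓ = 1) :
    Function.Injective (zhom ζ hζ) := by
  rw [injective_iff_map_eq_one]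
  intro c hc
  rw [zhom_apply] at hc
  have h1 := (hp.pow_eq_one_iff_dvd _).1 (show (ζ : Ω) ^ _ = 1 from congrArg Units.val hc)
  exact (ZMod.val_eq_zero _).1 (Nat.eq_zero_of_dvd_of_lt h1 (ZMod.val_lt _))

namespace Step
variable {X : CentralExt (Multiplicative (ZMod ℓ)) Gt G} {φ : (Ω ≃ₐ[k] Ω) →* G} {ζ : Ωˣ}
    {H H₁ : Subgroup (Ω ≃ₐ[k] Ω)} {S : Subgroup (Gt × (Ω ≃ₐ[k] Ω))} {γ : Ω ≃ₐ[k] Ω} (P : Step X φ ζ H H₁ S γ)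

/-- The Kummer extension cut out by `H₁` inside `H`. -/
structure Model (P : Step X φ ζ H H₁ S γ) (K L : Type) [Field K] [Field L] [Algebra K L] (ζK : K) (a : Kˣ) (A : Ωˣ) where
  D : Kum K L ℓ ζK a
  κ : K →+* Ω
  f : L →+* Ω
  f_algebraMap : ∀ c, f (algebraMap K L c) = κ c
  κ_ζ : κ ζK = ζ
  smul_κ : ∀ h ∈ H, ∀ c, h (κ c) = κ c
  exists_κ : ∀ x, (∀ h ∈ H, h x = x) → ∃ c, κ c = x
  f_B : f D.B = A
  smul_f : ∀ τ ∈ H₁, ∀ x, τ (f x) = f x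
  f_σ : ∀ x, f (D.σ x) = γ (f x)
  smul_A : ∀ τ ∈ H₁, τ • A = A
  γ_A : γ • A = ζ * A

include P in
theorem fixed_of_fixed' {x : Ω} (h1 : ∀ τ ∈ H₁, τ x = x) (h2 : γ x = x) {h : Ω ≃ₐ[k] Ω} (hh : h ∈ H) : h x = x := by
  by_cases hx : x = 0
  · rw [hx, map_zero]
  · exact congrArg Units.val (P.fixed_of_fixed (x := Units.mk0 x hx) (fun τ hτ => Units.ext (h1 τ hτ)) (Units.ext h2) hh)

variable {P} {K L : Type} [Field K] [Field L] [Algebra K L] {ζK : K} {a : Kˣ} {A : Ωˣ} (M : P.Model K L ζK a A)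

include M

theorem Model.exists_f [CharZero Ω] {x : Ω} (hx : ∀ τ ∈ H₁, τ x = x) : ∃ y, M.f y = x := by
  obtain ⟨c, hc1, hc2, hc⟩ := exists_interpolation P.nor P.pow_ell_mem P.prime P.primitive
    (fun τ hτ => P.fix τ (P.le hτ)) (P.fix γ P.mem) M.smul_A M.γ_A hx
  choose d hd using fun j => M.exists_κ (c j) fun h hh => P.fixed_of_fixed' (hc1 j) (hc2 j) hh
  refine ⟨∑ j ∈ range ℓ, algebraMap K L (d j) * (M.D.B : L) ^ j, ?_⟩
  rw [hc, map_sum]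
  refine sum_congr rfl fun j _ => ?_
  rw [map_mul, map_pow, M.f_algebraMap, hd, M.f_B]

theorem Model.f_σ_pow (i : ℕ) (x : L) : M.f ((M.D.σ ^ i) x) = (γ ^ i) (M.f x) := by
  induction i with
  | zero => rfl
  | succ i ih => rw [pow_succ', pow_succ', AlgEquiv.mul_apply, AlgEquiv.mul_apply, M.f_σ, ih]

theorem Model.f_norm (x : L) : M.κ (Algebra.norm K x) = ∏ i ∈ range ℓ, (γ ^ i) (M.f x) := by
  rw [← M.f_algebraMap, M.D.norm_eq, map_prod]
  exact prod_congr rfl fun i _ => M.f_σ_pow i x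

theorem Model.κ_N (x : Lˣ) : Units.map (M.κ : K →* Ω) (M.D.N x) = ∏ i ∈ range ℓ, γ ^ i • Units.map (M.f : L →* Ω) x := by
  refine Units.ext ?_
  rw [Units.coe_prod]
  exact M.f_norm x

theorem Model.hilbert90 [CharZero Ω] {d : Ωˣ} (hd : ∀ τ ∈ H₁, τ • d = d) (h1 : ∏ i ∈ range ℓ, γ ^ i • d = 1) :
    ∃ w : Ωˣ, (∀ τ ∈ H₁, τ • w = w) ∧ d = γ • w / w := by
  obtain ⟨x, hx⟩ := M.exists_f (x := d) fun τ hτ => congrArg Units.val (hd τ hτ)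
  have hx0 : x ≠ 0 := by
    rintro rfl
    exact d.ne_zero (by rw [← hx, map_zero])
  have hxd : Units.map (M.f : L →* Ω) (Units.mk0 x hx0) = d := Units.ext hx
  have hN : M.D.N (Units.mk0 x hx0) = 1 := by
    apply Units.map_injective (f := (M.κ : K →* Ω)) M.κ.injective
    rw [M.κ_N, hxd, h1, map_one]
  obtain ⟨y, hy⟩ := M.D.hilbert90 hN
  refine ⟨Units.map (M.f : L →* Ω) y, fun τ hτ => Units.ext (M.smul_f τ hτ y), ?_⟩
  rw [← hxd, hy, map_div]
  congr 1
  exact Units.ext (M.f_σ y)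

/-- The lift extends if the obstruction is a norm. -/
theorem Model.exists_extension [CharZero Ω] [IsAlgClosed Ω] {g : Gt} {δ b : Ωˣ} {q : Amb Gt (Ω ≃ₐ[k] Ω) Ωˣ}
    (O : P.Obstruction g δ b q) {y : Lˣ} (hy : Units.map (M.κ : K →* Ω) (M.D.N y) = b) :
    ∃ S', X.IsLift φ H S' ∧ Cts S' := by
  obtain ⟨δ, O⟩ := O.adjust (y := Units.map (M.f : L →* Ω) y) (fun τ hτ => Units.ext (M.smul_f τ hτ y))
    (by rw [← M.κ_N, hy])
  obtain ⟨w, hw1, hw2⟩ := M.hilbert90 (fun τ hτ => O.smul_pow hτ) O.prod_smul_pow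
  obtain ⟨η', hη'⟩ := IsAlgClosed.exists_pow_nat_eq (w : Ω) P.prime.pos
  have hη0 : η' ≠ 0 := by
    rintro rfl
    rw [zero_pow P.prime.ne_zero] at hη'
    exact w.ne_zero hη'.symm
  obtain ⟨η, rfl⟩ : ∃ η : Ωˣ, (η : Ω) = η' := ⟨Units.mk0 η' hη0, rfl⟩
  have hη : η ^ ℓ = w := Units.ext hη'
  obtain ⟨j, hj⟩ := exists_zhom P.primitive P.pow_eq_one (u := δ * (η / γ • η)) (by
    rw [mul_pow, div_pow, ← smul_pow', hη, hw2]; simp)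
  have hτη : ∀ τ ∈ H₁, (η / τ • η) ^ ℓ = 1 := by
    intro τ hτ
    rw [div_pow, ← smul_pow', hη, hw1 τ hτ, div_self']
  let inj : Gt × (Ω ≃ₐ[k] Ω) →* Amb Gt (Ω ≃ₐ[k] Ω) Ωˣ :=
    { toFun := fun w => Amb.mk w.1 1 w.2
      map_one' := rfl
      map_mul' := fun a b => by rw [Amb.mk_mul, smul_one, one_mul]; rfl }
  let S' : Subgroup (Gt × (Ω ≃ₐ[k] Ω)) := P.Sp.comap ((MulAut.conj (Amb.T Gt _ η)⁻¹).toMonoidHom.comp inj)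
  have hS' : ∀ t τ, (t, τ) ∈ S' ↔ ∃ c, (t * X.ι c, τ) ∈ S ∧ τ • η / η = zhom ζ P.pow_eq_one c := by
    intro t τ
    change (Amb.T Gt _ η)⁻¹ * Amb.mk t 1 τ * (Amb.T Gt _ η)⁻¹⁻¹ ∈ P.Sp ↔ _
    rw [Amb.T_inv, Amb.T_conj, Amb.mem_plus, one_mul, smul_inv', inv_div_inv]
  have hlift : X.IsLift φ H₁ S' := by
    constructor
    · rintro ⟨t, τ⟩ h
      obtain ⟨c, hc, -⟩ := (hS' _ _).1 h
      exact (P.isLift.mem hc : _)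
    · rintro ⟨t, τ⟩ h
      obtain ⟨c, hc, -⟩ := (hS' _ _).1 h
      have := P.isLift.proj hc
      rwa [map_mul, X.π_ι, mul_one] at this
    · intro τ hτ
      obtain ⟨t, ht⟩ := P.isLift.lift hτ
      obtain ⟨c, hc⟩ := exists_zhom P.primitive P.pow_eq_one (u := τ • η / η) (by
        rw [← inv_div, inv_pow, hτη τ hτ, inv_one])
      exact ⟨t * (X.ι c)⁻¹, (hS' _ _).2 ⟨c, by rwa [inv_mul_cancel_right], hc.symm⟩⟩
    · intro t h
      obtain ⟨c, hc, hc'⟩ := (hS' _ _).1 h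
      rw [one_smul, div_self'] at hc'
      have h1 := zhom_injective P.primitive P.pow_eq_one (hc'.symm.trans (map_one _).symm)
      rw [h1, map_one, mul_one] at hc
      exact P.isLift.ker hc
  have hconj : Amb.mk g (zhom ζ P.pow_eq_one j) γ = Amb.T Gt _ η * Amb.mk g δ γ * (Amb.T Gt _ η)⁻¹ := by
    rw [Amb.T_conj, hj]
  have hmem : ∀ w, w ∈ S' ↔ (Amb.T Gt _ η)⁻¹ * inj w * Amb.T Gt _ η ∈ P.Sp := by
    intro w
    change (Amb.T Gt _ η)⁻¹ * inj w * (Amb.T Gt _ η)⁻¹⁻¹ ∈ P.Sp ↔ _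
    rw [inv_inv]
  have hPS : ∀ w, w ∈ S' ↔ (g, γ) * w * (g, γ)⁻¹ ∈ S' := by
    rintro ⟨t, τ⟩
    by_cases hτ : τ ∈ H₁
    · have h1 : γ * τ * γ⁻¹ ∈ H₁ := (mem_nor.1 P.nor τ).1 hτ
      have h2 : inj ((g, γ) * (t, τ) * (g, γ)⁻¹) =
          Amb.T Gt _ η * (Amb.mk g δ γ * ((Amb.T Gt _ η)⁻¹ * inj (t, τ) * Amb.T Gt _ η) * (Amb.mk g δ γ)⁻¹) *
            (Amb.T Gt _ η)⁻¹ := by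
        have h3 := Amb.mk_conj_mk g t (zhom ζ P.pow_eq_one j) γ τ
        rw [P.smul_z (P.le h1), div_self', hconj] at h3
        refine h3.symm.trans ?_
        change _ * inj (t, τ) * _ = _
        group
      rw [hmem, hmem, h2, mem_nor.1 O.nor]
      refine iff_of_eq (congrArg (· ∈ P.Sp) ?_)
      group
    · refine iff_of_false (fun h => hτ (hlift.mem h)) fun h => hτ ?_
      exact (mem_nor.1 P.nor τ).2 (hlift.mem h)
  obtain ⟨S'', hS'', hl⟩ := hlift.extend X (γ := γ) (g := g) (m := ℓ) P.mem P.le (fun n => (P.pow_mem n).1) P.exists_pow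
    O.proj (mem_nor.2 hPS) (by
      have h1 := congrArg (· ^ ℓ) hconj
      simp only [conj_pow] at h1
      rw [O.eq, Amb.T_one, one_mul, Amb.mk_pow] at h1
      have h2 : ∏ i ∈ range ℓ, γ ^ i • zhom ζ P.pow_eq_one j = 1 := by
        rw [prod_congr rfl fun i _ => P.smul_z (_root_.pow_mem P.mem i) j, prod_const, card_range, zhom_pow]
      rw [h2] at h1
      rw [zpow_natCast, hmem, Prod.pow_mk]
      change (Amb.T Gt _ η)⁻¹ * Amb.mk (g ^ ℓ) 1 (γ ^ ℓ) * Amb.T Gt _ η ∈ P.Sp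
      rw [h1]
      convert O.mem using 1
      group)
  refine ⟨S'', hl, ?_⟩
  obtain ⟨V, hV, hVS⟩ := P.cts
  have hst : IsOpen ((MulAction.stabilizer (Ω ≃ₐ[k] Ω) η : Subgroup (Ω ≃ₐ[k] Ω)) : Set (Ω ≃ₐ[k] Ω)) := by
    have : FiniteDimensional k (IntermediateField.adjoin k {(η : Ω)}) :=
      IntermediateField.adjoin.finiteDimensional (Algebra.IsIntegral.isIntegral _)
    refine Subgroup.isOpen_mono ?_ (IntermediateField.fixingSubgroup_isOpen (IntermediateField.adjoin k {(η : Ω)}))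
    intro σ hσ
    exact Units.ext ((IntermediateField.mem_fixingSubgroup_iff _ _).1 hσ _
      (IntermediateField.mem_adjoin_simple_self k (η : Ω)))
  refine ⟨_, isOpen_inf hV hst, fun v hv => hS'' ((hS' _ _).2 ⟨1, by simpa using hVS v hv.1, ?_⟩)⟩
  rw [show v • η = η from hv.2, div_self', map_one]

end Step
end stepModels

section models
open Finset CentralExt

variable {Gt G : Type*} [Group Gt] [Group G] {Ω : Type} [Field Ω] [Algebra ℚ Ω] [IsGalois ℚ Ω] {ℓ : ℕ} [NeZero ℓ]

namespace Step
variable {X : CentralExt (Multiplicative (ZMod ℓ)) Gt G} {φ : (Ω ≃ₐ[ℚ] Ω) →* G} {ζ : Ωˣ}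
    {H H₁ : Subgroup (Ω ≃ₐ[ℚ] Ω)} {S : Subgroup (Gt × (Ω ≃ₐ[ℚ] Ω))} {γ : Ω ≃ₐ[ℚ] Ω} (P : Step X φ ζ H H₁ S γ)
include P

theorem exists_model : ∃ (K L : Type) (_ : Field K) (_ : NumberField K) (_ : Field L) (_ : NumberField L)
    (_ : Algebra K L) (ζK : K) (a : Kˣ) (A : Ωˣ), Nonempty (P.Model K L ζK a A) := by
  obtain ⟨A, hA1, hA2⟩ := P.exists_eigenvector
  let K := IntermediateField.fixedField H
  have hHo : IsOpen (H : Set (Ω ≃ₐ[ℚ] Ω)) := Subgroup.isOpen_mono P.le P.isOpen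
  have hH : K.fixingSubgroup = H :=
    InfiniteGalois.fixingSubgroup_fixedField (⟨H, H.isClosed_of_isOpen hHo⟩ : ClosedSubgroup (Ω ≃ₐ[ℚ] Ω))
  have hfd : FiniteDimensional ℚ K := (InfiniteGalois.isOpen_iff_finite K).1 (by rwa [hH])
  have : CharZero Ω := algebraRat.charZero Ω
  have hK : NumberField K :=
    { to_charZero := inferInstance
      to_finiteDimensional := by
        convert hfd
        exact Subsingleton.elim _ _ }
  have hmem : ∀ x, x ∈ K ↔ ∀ h ∈ H, h x = x := IntermediateField.mem_fixedField_iff H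
  let ζK : K := ⟨ζ, (hmem _).2 fun h hh => congrArg Units.val (P.fix h hh)⟩
  have hζK : IsPrimitiveRoot ζK ℓ := P.primitive.of_map_of_injective (f := algebraMap K Ω) (algebraMap K Ω).injective
  have hAℓ : ∀ h ∈ H, h • A ^ ℓ = A ^ ℓ := fun h hh => P.fixed_of_fixed
    (fun τ hτ => by rw [smul_pow', hA1 τ hτ]) (by rw [smul_pow', hA2, mul_pow, P.pow_eq_one, one_mul]) hh
  let aK : K := ⟨(A : Ω) ^ ℓ, (hmem _).2 fun h hh => congrArg Units.val (hAℓ h hh)⟩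
  have haK : aK ≠ 0 := fun h => pow_ne_zero ℓ A.ne_zero (congrArg Subtype.val h)
  obtain ⟨L, hL, hLN, hLA, ⟨D⟩⟩ := exists_kum P.prime hζK (Units.mk0 aK haK) (by
    intro c hc
    have h1 : ((c : K) : Ω) ^ ℓ = (A : Ω) ^ ℓ := congrArg (fun x : Kˣ => ((x : K) : Ω)) hc
    have hc0 : ((c : K) : Ω) ≠ 0 := fun h => c.ne_zero (Subtype.ext h)
    obtain ⟨i, -, hi⟩ := P.primitive.eq_pow_of_pow_eq_one (ξ := (A : Ω) / (c : K)) (by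
      rw [div_pow, h1, div_self (pow_ne_zero _ A.ne_zero)])
    have h2 : (A : Ω) = (ζ : Ω) ^ i * (c : K) := by rw [hi, div_mul_cancel₀ _ hc0]
    have h3 : γ (A : Ω) = ζ * A := congrArg Units.val hA2
    have h4 : γ (A : Ω) = A := by
      rw [h2, map_mul, map_pow, (hmem _).1 (c : K).2 γ P.mem, show γ (ζ : Ω) = ζ from congrArg Units.val (P.fix γ P.mem)]
    rw [h4, eq_comm, mul_eq_right₀ A.ne_zero] at h3
    exact P.primitive.ne_one P.prime.one_lt h3)
  let f : L →ₐ[K] Ω := D.lift (A : Ω) rfl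
  have hfB : f D.B = A := D.lift_B (A : Ω) rfl
  have hB : ∀ (σ : Ω ≃ₐ[ℚ] Ω) (hσ : σ ∈ H) (c : L ≃ₐ[K] L), σ (A : Ω) = f (c D.B) → ∀ x, f (c x) = σ (f x) := by
    intro σ hσ c hc x
    let f₂ : L →ₐ[K] Ω :=
      { (σ : Ω →+* Ω).comp (f : L →+* Ω) with
        commutes' := fun r => (congrArg σ (f.commutes r)).trans ((hmem _).1 r.2 σ hσ) }
    have h1 : f.comp (c : L →ₐ[K] L) = f₂ := D.ext_B (hc.symm.trans (congrArg σ hfB.symm))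
    exact DFunLike.congr_fun h1 x
  refine ⟨K, L, inferInstance, hK, hL, hLN, hLA, ζK, Units.mk0 aK haK, A, ⟨
    { D := D
      κ := algebraMap K Ω
      f := f
      f_algebraMap := f.commutes
      κ_ζ := rfl
      smul_κ := fun h hh c => (hmem _).1 c.2 h hh
      exists_κ := fun x hx => ⟨⟨x, (hmem x).2 hx⟩, rfl⟩
      f_B := hfB
      smul_f := fun τ hτ x => (hB τ (P.le hτ) 1 ((congrArg Units.val (hA1 τ hτ)).trans hfB.symm) x).symm
      f_σ := hB γ P.mem D.σ (by
        rw [D.hσ, map_mul, hfB, f.commutes]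
        exact congrArg Units.val hA2)
      smul_A := hA1
      γ_A := hA2 }⟩⟩

end Step
end models

section localObstruction
open Finset CentralExt

variable {Gt G : Type*} [Group Gt] [Group G] {k Ω : Type} [Field k] [Field Ω] [Algebra k Ω] [IsGalois k Ω]
  {k' Ω' : Type} [Field k'] [Field Ω'] [Algebra k' Ω'] [IsGalois k' Ω'] {ℓ : ℕ} [NeZero ℓ]

theorem map_zhom (emb : Ω →+* Ω') {ζ : Ωˣ} {hζ : ζ ^ ℓ = 1} {hζ' : Units.map (emb : Ω →* Ω') ζ ^ ℓ = 1}
    (c : Multiplicative (ZMod ℓ)) :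
    Units.map (emb : Ω →* Ω') (zhom ζ hζ c) = zhom (Units.map (emb : Ω →* Ω') ζ) hζ' c := by
  rw [zhom_apply, map_pow, zhom_apply]

section
variable {C Λ Λ' : Type*} [CommGroup C] [Group Λ] [Group Λ'] {X : CentralExt C Gt G} {φ : Λ →* G}

theorem CentralExt.IsLift.comap {H : Subgroup Λ} {S : Subgroup (Gt × Λ)} (hS : X.IsLift φ H S) (ρ : Λ' →* Λ) :
    X.IsLift (φ.comp ρ) (H.comap ρ) (S.comap (MonoidHom.prodMap (MonoidHom.id Gt) ρ)) where
  mem h := hS.mem h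
  proj h := hS.proj h
  lift h := hS.lift h
  ker h := hS.ker (by simpa using h)

theorem isLift_graph (N : Subgroup Λ) (ψ : Λ →* Gt) (hψ : X.π.comp ψ = φ) :
    X.IsLift φ N (N.map (ψ.prod (MonoidHom.id Λ))) where
  mem := by rintro _ ⟨h, hh, rfl⟩; exact hh
  proj := by rintro _ ⟨h, hh, rfl⟩; exact DFunLike.congr_fun hψ h
  lift := fun {h} hh => ⟨ψ h, h, hh, rfl⟩
  ker := by
    rintro g ⟨h, hh, e⟩
    have h1 : h = 1 := congrArg Prod.snd e
    have h2 : ψ h = g := congrArg Prod.fst e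
    rw [← h2, h1, map_one]

end

namespace Step
variable {X : CentralExt (Multiplicative (ZMod ℓ)) Gt G} {φ : (Ω ≃ₐ[k] Ω) →* G} {ζ : Ωˣ}
    {H H₁ : Subgroup (Ω ≃ₐ[k] Ω)} {S : Subgroup (Gt × (Ω ≃ₐ[k] Ω))} {γ : Ω ≃ₐ[k] Ω} {P : Step X φ ζ H H₁ S γ}

/-- A local lift exhibits the obstruction as a local norm. -/
theorem Obstruction.exists_local_norm {g : Gt} {δ b : Ωˣ} {q : Amb Gt (Ω ≃ₐ[k] Ω) Ωˣ} (O : P.Obstruction g δ b q)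
    (emb : Ω →+* Ω') (ρ : (Ω' ≃ₐ[k'] Ω') →* (Ω ≃ₐ[k] Ω)) (hρ : Continuous ρ) (he : ∀ σ x, emb (ρ σ x) = σ (emb x))
    (ψ : (Ω' ≃ₐ[k'] Ω') →* Gt) (hψ : X.π.comp ψ = φ.comp ρ)
    (hψo : IsOpen (ψ.ker : Set (Ω' ≃ₐ[k'] Ω'))) {σ : Ω' ≃ₐ[k'] Ω'} (hσ : ρ σ * γ⁻¹ ∈ H₁) :
    ∃ y : Ω'ˣ, (∀ τ ∈ H₁.comap ρ, τ • y = y) ∧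
      Units.map (emb : Ω →* Ω') b = ∏ i ∈ range ℓ, σ ^ i • y := by
  let e : Ωˣ →* Ω'ˣ := Units.map (emb : Ω →* Ω')
  have hee : ∀ τ u, e (ρ τ • u) = τ • e u := fun τ u => Units.ext (he τ u)
  have hζ' : e ζ ^ ℓ = 1 := by rw [← map_pow, P.pow_eq_one, map_one]
  let z := zhom ζ P.pow_eq_one
  let z' := zhom (e ζ) hζ'
  have hzz : ∀ c, e (z c) = z' c := map_zhom emb
  let S' := S.comap (MonoidHom.prodMap (MonoidHom.id Gt) ρ)
  let N := H₁.comap ρ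
  have hS' : X.IsLift (φ.comp ρ) N S' := P.isLift.comap ρ
  have hfix : ∀ τ, ρ τ ∈ H → ∀ c, τ • z' c = z' c := fun τ hτ c => by
    rw [← hzz, ← hee, P.smul_z hτ]
  have hfixN : ∀ τ ∈ N, ∀ c, τ • z' c = z' c := fun τ hτ => hfix τ (P.le hτ)
  have hz' : ∀ w ∈ S', ∀ c, w.2 • z' c = z' c := fun w hw => hfixN _ (hS'.mem hw)
  let R := Amb.plus X z' S' hz'
  have hρσ : ρ σ = (ρ σ * γ⁻¹) * γ := by group
  have hσH : ρ σ ∈ H := by rw [hρσ]; exact H.mul_mem (P.le hσ) P.mem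
  have hσnor : ρ σ ∈ EmbeddingProblem.nor H₁ := by
    rw [hρσ]; exact Subgroup.mul_mem _ (mem_nor_self hσ) P.nor
  have hσN : σ ∈ EmbeddingProblem.nor N := mem_nor.2 fun w => by
    have := mem_nor.1 hσnor (ρ w)
    rwa [← map_inv, ← map_mul, ← map_mul] at this
  have hcts : Cts S' := by
    obtain ⟨V, hV, hVS⟩ := P.cts
    exact ⟨V.comap ρ, hV.preimage hρ, fun v hv => hVS _ hv⟩
  have hNo : IsOpen (N : Set (Ω' ≃ₐ[k'] Ω')) := P.isOpen.preimage hρ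
  -- the element over `ρ σ`
  obtain ⟨t₁, ht₁⟩ := P.isLift.lift hσ
  obtain ⟨g₁, δ₁, hp₁⟩ : ∃ g₁ δ₁, Amb.mk t₁ 1 (ρ σ * γ⁻¹) * Amb.mk g δ γ = Amb.mk g₁ δ₁ (ρ σ) :=
    ⟨_, _, by rw [Amb.mk_mul, ← hρσ]⟩
  have hq₁ : Amb.mk t₁ (1 : Ωˣ) (ρ σ * γ⁻¹) ∈ P.Sp := Amb.mk_mem_plus ht₁
  have hn₁ : Amb.mk g₁ δ₁ (ρ σ) ∈ EmbeddingProblem.nor P.Sp := by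
    rw [← hp₁]; exact Subgroup.mul_mem _ (mem_nor_self hq₁) O.nor
  have hg₁ : X.π g₁ = φ (ρ σ) := by
    have h1 := (Amb.mk_inj.1 ((Amb.mk_mul _ _ _ _ _ _).symm.trans hp₁)).1
    rw [← h1, map_mul, P.isLift.proj ht₁, O.proj, ← map_mul, ← hρσ]
  obtain ⟨q₃, hq₃, hpow⟩ : ∃ q₃ ∈ P.Sp, Amb.mk g₁ δ₁ (ρ σ) ^ ℓ = Amb.T Gt _ b * q₃ := by
    obtain ⟨q₂, hq₂, h⟩ := exists_mul_pow O.nor hq₁ ℓ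
    refine ⟨q₂ * q, Subgroup.mul_mem _ hq₂ O.mem, ?_⟩
    rw [← hp₁, h, O.eq, ← mul_assoc, ← mul_assoc,
      Amb.T_comm P.isLift (fun h hh => O.fixed (P.le hh)) hq₂]
  -- its local counterpart
  have hn₁' : Amb.mk g₁ (e δ₁) σ ∈ EmbeddingProblem.nor R := by
    refine Amb.mem_nor_plus hS' hσN (hfix σ hσH) fun t τ ht => ?_
    have h1 := (mem_nor.1 hn₁ _).1 (Amb.mk_mem_plus (hz := P.smul_z_lift) (show (t, ρ τ) ∈ S from ht))
    rw [Amb.mk_conj_mk] at h1 ⊢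
    obtain ⟨c, hc, hc'⟩ := Amb.mem_plus.1 h1
    refine Amb.mem_plus.2 ⟨c, ?_, ?_⟩
    · change (g₁ * t * g₁⁻¹ * X.ι c, ρ (σ * τ * σ⁻¹)) ∈ S
      rwa [map_mul, map_mul, map_inv]
    · rw [← hzz, ← hc', map_div, ← hee, map_mul, map_mul, map_inv]
  obtain ⟨q₃', hq₃', hpow'⟩ : ∃ q₃' ∈ R, Amb.mk g₁ (e δ₁) σ ^ ℓ = Amb.T Gt _ (e b) * q₃' := by
    obtain ⟨g₃, δ₃, h₃, rfl⟩ := Amb.exists_mk q₃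
    obtain ⟨c, hc, rfl⟩ := Amb.mem_plus.1 hq₃
    rw [Amb.mk_pow, Amb.T_mul_mk, Amb.mk_inj] at hpow
    obtain ⟨hpa, hpb, hpc⟩ := hpow
    refine ⟨Amb.mk g₃ (z' c) (σ ^ ℓ), Amb.mem_plus.2 ⟨c, ?_, rfl⟩, ?_⟩
    · change (g₃ * X.ι c, ρ (σ ^ ℓ)) ∈ S
      rwa [map_pow, hpc]
    · rw [Amb.mk_pow, Amb.T_mul_mk, hpa, ← hzz, ← map_mul]
      congr 1
      rw [← hpb, map_prod]
      exact prod_congr rfl fun i _ => by rw [← hee, map_pow]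
  -- the element coming from the local lift
  obtain ⟨ε, hε⟩ := exists_conj_lift P.prime hS' (isLift_graph N ψ hψ) hcts
    ⟨ψ.ker ⊓ N, isOpen_inf hψo hNo, fun v hv => ⟨v, hv.2, Prod.ext hv.1 rfl⟩⟩ hζ'
    (fun τ hτ => by rw [← hee, P.fix _ (P.le hτ)]) hz'
  have hε' : ∀ τ ∈ N, Amb.T Gt _ ε * Amb.mk (ψ τ) 1 τ * (Amb.T Gt _ ε)⁻¹ ∈ R := fun τ hτ =>
    hε _ _ ⟨τ, hτ, rfl⟩
  obtain ⟨r, hr⟩ : ∃ r, r = Amb.T Gt _ ε * Amb.mk (ψ σ) 1 σ * (Amb.T Gt _ ε)⁻¹ := ⟨_, rfl⟩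
  have hr' : r = Amb.mk (ψ σ) (ε / σ • ε) σ := by rw [hr, Amb.T_conj, one_mul]
  have hσℓ : σ ^ ℓ ∈ N := by
    obtain ⟨w, hw, h⟩ := exists_mul_pow P.nor hσ ℓ
    change ρ (σ ^ ℓ) ∈ H₁
    rw [map_pow, hρσ, h]
    exact H₁.mul_mem hw P.pow_ell_mem
  have hrpow : r ^ ℓ ∈ R := by
    have h1 := hε' _ hσℓ
    rw [hr, conj_pow]
    convert h1 using 3
    rw [Amb.mk_pow, map_pow]
    congr 1
    simp
  have hrn : r ∈ EmbeddingProblem.nor R := by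
    rw [hr']
    refine Amb.mem_nor_plus hS' hσN (hfix σ hσH) fun t τ ht => ?_
    rw [← hr']
    have hτ : τ ∈ N := hS'.mem ht
    have h1 := hε' τ hτ
    have h2 := hε' _ ((mem_nor.1 hσN τ).1 hτ)
    have h3 : Amb.mk (ψ (σ * τ * σ⁻¹)) (1 : Ω'ˣ) (σ * τ * σ⁻¹) = Amb.mk (ψ σ) 1 σ * Amb.mk (ψ τ) 1 τ * (Amb.mk (ψ σ) 1 σ)⁻¹ := by
      rw [Amb.mk_conj_mk, smul_one, div_one, map_mul, map_mul, map_inv]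
    have h4 : Amb.T Gt _ ε * Amb.mk (ψ (σ * τ * σ⁻¹)) 1 (σ * τ * σ⁻¹) * (Amb.T Gt _ ε)⁻¹ =
        r * (Amb.T Gt _ ε * Amb.mk (ψ τ) 1 τ * (Amb.T Gt _ ε)⁻¹) * r⁻¹ := by
      rw [h3, hr]; group
    rw [h4] at h2
    rw [Amb.T_conj, one_mul] at h1 h2
    obtain ⟨c, hc, hc'⟩ := Amb.mem_plus.1 h1
    have h5 : t = ψ τ * X.ι c := hS'.uniq ht hc
    have h6 : Amb.mk t 1 τ = Amb.mk (ψ τ) (ε / τ • ε) τ * Amb.mk (X.ι c) (z' c)⁻¹ 1 := by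
      rw [Amb.mk_mul, hc', smul_inv', hfixN τ hτ, mul_inv_cancel, mul_one, h5]
    have h7 : r⁻¹ = Amb.mk r⁻¹.1 r⁻¹.2.left σ⁻¹ := by rw [hr']; rfl
    have h8 : Amb.mk (X.ι c) (z' c)⁻¹ 1 * r⁻¹ = r⁻¹ * Amb.mk (X.ι c) (z' c)⁻¹ 1 := by
      rw [h7]
      exact Amb.anti_comm (fun d => by rw [inv_smul_eq_iff, hfix σ hσH]) c
    rw [h6, mul_assoc, mul_assoc, h8, ← mul_assoc, ← mul_assoc]
    exact Subgroup.mul_mem _ h2 (Amb.anti_mem_plus c)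
  -- comparison
  obtain ⟨c, hc⟩ := X.exists_mul_ι (hg₁.trans (DFunLike.congr_fun hψ σ).symm)
  have hanti := Amb.anti_mem_plus (X := X) (z := z') (hz := hz') c
  have hcomm : Commute (Amb.mk (X.ι c) (z' c)⁻¹ 1) r := by
    rw [hr']
    exact Amb.anti_comm (hfix σ hσH) c
  obtain ⟨s, hs⟩ : ∃ s, s = (Amb.mk (X.ι c) (z' c)⁻¹ 1)⁻¹ * r := ⟨_, rfl⟩
  have hsn : s ∈ EmbeddingProblem.nor R := by
    rw [hs]
    exact Subgroup.mul_mem _ (Subgroup.inv_mem _ (mem_nor_self hanti)) hrn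
  have hspow : s ^ ℓ ∈ R := by
    rw [hs, hcomm.inv_left.mul_pow, inv_pow]
    exact Subgroup.mul_mem _ (Subgroup.inv_mem _ (Subgroup.pow_mem _ hanti _)) hrpow
  obtain ⟨d, hd⟩ : ∃ d, s = Amb.mk g₁ d σ := by
    have h1 : (X.ι c)⁻¹ * ψ σ = g₁ := by rw [← hc, ← X.central, inv_mul_cancel_left]
    rw [hs, hr', Amb.mk_inv, Amb.mk_mul, h1, inv_one, one_mul]
    exact ⟨_, rfl⟩
  have hy : Amb.mk g₁ (e δ₁) σ = Amb.T Gt _ (e δ₁ / d) * s := by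
    rw [hd, Amb.T_mul_mk, div_mul_cancel]
  have hT : Amb.T Gt _ (e δ₁ / d) ∈ EmbeddingProblem.nor R := by
    rw [← mul_inv_eq_iff_eq_mul] at hy
    rw [← hy]
    exact Subgroup.mul_mem _ hn₁' (Subgroup.inv_mem _ hsn)
  refine ⟨e δ₁ / d, fun τ hτ => Amb.smul_eq_of_T_mem_nor hS' hT hτ, ?_⟩
  rw [hy, hd, Amb.T_mul_mk_pow, ← hd] at hpow'
  have h1 : Amb.T Gt _ (e b / ∏ i ∈ range ℓ, σ ^ i • (e δ₁ / d)) = s ^ ℓ * q₃'⁻¹ := by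
    rw [eq_mul_inv_iff_mul_eq, div_eq_inv_mul, ← Amb.T_mul, ← Amb.T_inv, mul_assoc, ← hpow', inv_mul_cancel_left]
  exact div_eq_one.1 (Amb.eq_one_of_T_mem hS' (hz := hz') (by
    rw [h1]
    exact Subgroup.mul_mem _ hspow (Subgroup.inv_mem _ hq₃')))

end Step
end localObstruction

section localCoefficients
open Finset CentralExt

theorem sum_range_root_pow {F : Type*} [Field F] {ℓ : ℕ} {ζ : F} (hζ : IsPrimitiveRoot ζ ℓ) {i : ℕ} (hi : i < ℓ) :
    ∑ j ∈ range ℓ, (ζ ^ i) ^ j = if i = 0 then (ℓ : F) else 0 := by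
  split_ifs with h
  · simp [h]
  · have h1 : ζ ^ i - 1 ≠ 0 := sub_ne_zero.2 (hζ.pow_ne_one_of_pos_of_lt h hi)
    apply mul_left_cancel₀ h1
    rw [mul_comm, geom_sum_mul, ← pow_mul, mul_comm i, pow_mul, hζ.pow_eq_one, one_pow, sub_self, mul_zero]

/-- Every element is a product of conjugates of an explicit polynomial. -/
theorem eq_prod_sum_root_pow {F : Type*} [Field F] [CharZero F] {ℓ : ℕ} (hℓ : 0 < ℓ) {ζ : F} (hζ : IsPrimitiveRoot ζ ℓ)
    {A : F} (hA : A ≠ 0) (b : F) :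
    b = ∏ i ∈ range ℓ, ∑ j ∈ range ℓ, ((if j = 0 then 1 else 0) + (b - 1) / (ℓ * A ^ j)) * (ζ ^ i * A) ^ j := by
  have hℓ0 : (ℓ : F) ≠ 0 := Nat.cast_ne_zero.2 hℓ.ne'
  have h1 : ∀ i ∈ range ℓ, ∑ j ∈ range ℓ, ((if j = 0 then 1 else 0) + (b - 1) / (ℓ * A ^ j)) * (ζ ^ i * A) ^ j =
      if i = 0 then b else 1 := by
    intro i hi
    have h2 : ∀ j ∈ range ℓ, ((if j = 0 then 1 else 0) + (b - 1) / (ℓ * A ^ j)) * (ζ ^ i * A) ^ j =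
        (if j = 0 then 1 else 0) + (b - 1) / ℓ * (ζ ^ i) ^ j := by
      intro j _
      have hAj : A ^ j ≠ 0 := pow_ne_zero _ hA
      rw [add_mul, mul_pow]
      congr 1
      · split_ifs with h
        · simp [h]
        · simp
      · field_simp
    rw [sum_congr rfl h2, sum_add_distrib, ← mul_sum, sum_range_root_pow hζ (mem_range.1 hi), sum_ite_eq',
      if_pos (mem_range.2 hℓ)]
    split_ifs with h
    · field_simp; ring
    · ring
  rw [prod_congr rfl h1, prod_ite_eq', if_pos (mem_range.2 hℓ)]

variable {Gt G : Type*} [Group Gt] [Group G] {k Ω : Type} [Field k] [Field Ω] [Algebra k Ω] [IsGalois k Ω]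
  {k' Ω' : Type} [Field k'] [Field Ω'] [Algebra k' Ω'] [IsGalois k' Ω'] {ℓ : ℕ} [NeZero ℓ]

namespace Step
variable {X : CentralExt (Multiplicative (ZMod ℓ)) Gt G} {φ : (Ω ≃ₐ[k] Ω) →* G} {ζ : Ωˣ}
    {H H₁ : Subgroup (Ω ≃ₐ[k] Ω)} {S : Subgroup (Gt × (Ω ≃ₐ[k] Ω))} {γ : Ω ≃ₐ[k] Ω} {P : Step X φ ζ H H₁ S γ}

theorem exists_pow_mul_inv_mem (P : Step X φ ζ H H₁ S γ) {h : Ω ≃ₐ[k] Ω} (hh : h ∈ H) (hh₁ : h ∉ H₁) :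
    ∃ m : ℕ, h ^ m * γ⁻¹ ∈ H₁ := by
  obtain ⟨n, hn⟩ := P.exists_pow h hh
  have hℓn : ¬ (ℓ : ℤ) ∣ n := fun hd => hh₁ ((Subgroup.mul_mem_cancel_right H₁ ((P.pow_mem n).2 hd)).1 hn)
  obtain ⟨u, w, huw⟩ := ((Nat.prime_iff_prime_int.1 P.prime).coprime_iff_not_dvd.2 hℓn)
  have hℓ0 : (ℓ : ℤ) ≠ 0 := by exact_mod_cast P.prime.ne_zero
  obtain ⟨m, hm⟩ := Int.eq_ofNat_of_zero_le (Int.emod_nonneg (-w) hℓ0)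
  refine ⟨m, ?_⟩
  obtain ⟨q, hq, h1⟩ := exists_mul_pow (zpow_mem P.nor (-n)) hn m
  have h2 : h = h * γ ^ n * γ ^ (-n) := by group
  have h3 : γ ^ (-n * m - 1) ∈ H₁ := by
    rw [P.pow_mem, ← hm, Int.emod_def]
    exact ⟨-u + n * (-w / ℓ), by linear_combination huw⟩
  have h4 : h ^ m * γ⁻¹ = q * γ ^ (-n * m - 1) := by
    rw [h2, h1, zpow_sub, zpow_mul, zpow_natCast, zpow_one, mul_assoc]
  rw [h4]
  exact H₁.mul_mem hq h3

/-- A local lift exhibits the obstruction as the norm of an explicit polynomial. -/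
theorem Obstruction.exists_local_coeffs [CharZero Ω'] {g : Gt} {δ b : Ωˣ} {q : Amb Gt (Ω ≃ₐ[k] Ω) Ωˣ}
    (O : P.Obstruction g δ b q) (emb : Ω →+* Ω') (ρ : (Ω' ≃ₐ[k'] Ω') →* (Ω ≃ₐ[k] Ω)) (hρ : Continuous ρ)
    (he : ∀ σ x, emb (ρ σ x) = σ (emb x)) (ψ : (Ω' ≃ₐ[k'] Ω') →* Gt) (hψ : X.π.comp ψ = φ.comp ρ)
    (hψo : IsOpen (ψ.ker : Set (Ω' ≃ₐ[k'] Ω'))) {A : Ωˣ} (hA1 : ∀ τ ∈ H₁, τ • A = A) (hA2 : γ • A = ζ * A) :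
    ∃ c : ℕ → Ω', (∀ j σ, ρ σ ∈ H → σ (c j) = c j) ∧
      emb b = ∏ i ∈ range ℓ, ∑ j ∈ range ℓ, c j * (emb ζ ^ i * emb A) ^ j := by
  have hζ' : IsPrimitiveRoot (emb ζ) ℓ := P.primitive.map_of_injective emb.injective
  by_cases hH : ∃ σ, ρ σ ∈ H ∧ ρ σ ∉ H₁
  · obtain ⟨σ₀, h0, h1⟩ := hH
    obtain ⟨m, hm⟩ := P.exists_pow_mul_inv_mem h0 h1
    obtain ⟨σ, hσm⟩ : ∃ σ, σ = σ₀ ^ m := ⟨_, rfl⟩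
    have hσ : ρ σ * γ⁻¹ ∈ H₁ := by rwa [hσm, map_pow]
    obtain ⟨y, hy1, hy2⟩ := O.exists_local_norm emb ρ hρ he ψ hψ hψo hσ
    have hρσ : ρ σ = (ρ σ * γ⁻¹) * γ := by group
    have hσH : ρ σ ∈ H := by rw [hρσ]; exact H.mul_mem (P.le hσ) P.mem
    have hσnor : ρ σ ∈ EmbeddingProblem.nor H₁ := by
      rw [hρσ]; exact Subgroup.mul_mem _ (mem_nor_self hσ) P.nor
    have hσN : σ ∈ EmbeddingProblem.nor (H₁.comap ρ) := mem_nor.2 fun w => by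
      have := mem_nor.1 hσnor (ρ w)
      rwa [← map_inv, ← map_mul, ← map_mul] at this
    have hσℓ : σ ^ ℓ ∈ H₁.comap ρ := by
      obtain ⟨w, hw, h⟩ := exists_mul_pow P.nor hσ ℓ
      change ρ (σ ^ ℓ) ∈ H₁
      rw [map_pow, hρσ, h]
      exact H₁.mul_mem hw P.pow_ell_mem
    let e : Ωˣ →* Ω'ˣ := Units.map (emb : Ω →* Ω')
    have hee : ∀ τ u, e (ρ τ • u) = τ • e u := fun τ u => Units.ext (he τ u)
    have hσζ : σ • e ζ = e ζ := by rw [← hee, P.fix _ hσH]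
    have hσA : σ • e A = e ζ * e A := by
      rw [← hee, hρσ, mul_smul, hA2, smul_mul', P.fix _ (P.le hσ), hA1 _ hσ, map_mul]
    obtain ⟨c, hc1, hc2, hc⟩ := exists_interpolation (ζ := e ζ) (A := e A) hσN hσℓ P.prime hζ'
      (fun τ hτ => by rw [← hee, P.fix _ (P.le hτ)]) hσζ (fun τ hτ => by rw [← hee, hA1 _ hτ]) hσA
      (x := y) (fun τ hτ => congrArg Units.val (hy1 τ hτ))
    refine ⟨c, fun j τ hτ => ?_, ?_⟩
    · by_cases hτ1 : ρ τ ∈ H₁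
      · exact hc1 j τ hτ1
      · obtain ⟨n, hn⟩ := P.exists_pow _ hτ
        have h3 : τ * σ ^ n ∈ H₁.comap ρ := by
          change ρ (τ * σ ^ n) ∈ H₁
          have h5 : ∃ w ∈ H₁, ρ σ ^ n = γ ^ n * w := by
            obtain ⟨n, rfl | rfl⟩ := n.eq_nat_or_neg
            · obtain ⟨w, hw, h⟩ := exists_mul_pow P.nor hσ n
              refine ⟨(γ ^ n)⁻¹ * w * γ ^ n, ?_, ?_⟩
              · have := (mem_nor.1 (inv_mem (_root_.pow_mem P.nor n)) w).1 hw
                rwa [inv_inv] at this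
              · rw [zpow_natCast, zpow_natCast, hρσ, h]; group
            · obtain ⟨w, hw, h⟩ := exists_mul_pow P.nor hσ n
              refine ⟨w⁻¹, H₁.inv_mem hw, ?_⟩
              rw [zpow_neg, zpow_neg, zpow_natCast, zpow_natCast, hρσ, h, mul_inv_rev]
          obtain ⟨w, hw, h⟩ := h5
          rw [map_mul, map_zpow, h, ← mul_assoc]
          exact H₁.mul_mem hn hw
        have h6 : ∀ n : ℤ, (σ ^ n) (c j) = c j := fun n =>
          zpow_mem (show σ ∈ MulAction.stabilizer (Ω' ≃ₐ[k'] Ω') (c j) from hc2 j) n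
        have h7 := hc1 j _ h3
        rwa [AlgEquiv.mul_apply, h6] at h7
    · have h1 : emb b = ∏ i ∈ range ℓ, (σ ^ i) (y : Ω') := by
        have := congrArg Units.val hy2
        rwa [Units.coe_prod] at this
      rw [h1]
      refine prod_congr rfl fun i _ => ?_
      have hi : ∀ i : ℕ, (σ ^ i) (emb A) = emb ζ ^ i * emb A ∧ ∀ j, (σ ^ i) (c j) = c j := by
        intro i
        induction i with
        | zero => simp
        | succ i ih =>
          refine ⟨?_, fun j => by rw [pow_succ', AlgEquiv.mul_apply, ih.2, hc2]⟩
          have hA : σ (emb A) = emb ζ * emb A := congrArg Units.val hσA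
          have hz : σ (emb ζ) = emb ζ := congrArg Units.val hσζ
          rw [pow_succ', AlgEquiv.mul_apply, ih.1, map_mul, map_pow, hz, hA, pow_succ, mul_assoc]
      rw [hc, map_sum]
      refine sum_congr rfl fun j _ => ?_
      rw [map_mul, map_pow, (hi i).2]
      exact congrArg (fun x => c j * x ^ j) (hi i).1
  · push Not at hH
    refine ⟨fun j => (if j = 0 then 1 else 0) + (emb b - 1) / (ℓ * emb A ^ j), fun j σ hσ => ?_,
      eq_prod_sum_root_pow P.prime.pos hζ' ((map_ne_zero emb).2 A.ne_zero) _⟩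
    have h1 : σ (emb b) = emb b := by rw [← he]; exact congrArg (fun u : Ωˣ => emb u) (O.fixed hσ)
    have h2 : σ (emb A) = emb A := by rw [← he]; exact congrArg (fun u : Ωˣ => emb u) (hA1 _ (hH σ hσ))
    rw [map_add, map_div₀, map_sub, map_one, map_mul, map_natCast, map_pow, h1, h2]
    split_ifs <;> simp [*]

end Step
end localCoefficients

section restriction

/-- An embedding of algebraic closures induces a continuous map on Galois groups. -/
theorem exists_restriction {k Ω k' Ω' : Type*} [Field k] [Field Ω] [Algebra k Ω] [Normal k Ω] [Field k'] [Field Ω']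
    [Algebra k' Ω'] [Algebra.IsAlgebraic k' Ω'] [Algebra k k'] [Algebra k Ω'] [IsScalarTower k k' Ω'] (emb : Ω →ₐ[k] Ω') :
    ∃ ρ : (Ω' ≃ₐ[k'] Ω') →* (Ω ≃ₐ[k] Ω), Continuous ρ ∧ ∀ σ x, emb (ρ σ x) = σ (emb x) := by
  let : Algebra Ω Ω' := emb.toRingHom.toAlgebra
  have : IsScalarTower k Ω Ω' := IsScalarTower.of_algebraMap_eq fun x => (emb.commutes x).symm
  let ρ : (Ω' ≃ₐ[k'] Ω') →* (Ω ≃ₐ[k] Ω) := (AlgEquiv.restrictNormalHom Ω).comp (AlgEquiv.restrictScalarsHom k)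
  have he : ∀ σ x, emb (ρ σ x) = σ (emb x) := fun σ x =>
    AlgEquiv.restrictNormal_commutes (σ.restrictScalars k) Ω x
  refine ⟨ρ, continuous_of_continuousAt_one ρ ?_, he⟩
  rw [ContinuousAt, map_one, Filter.tendsto_def]
  intro s hs
  obtain ⟨E, hE, hEs⟩ := (krullTopology_mem_nhds_one_iff _ _ _).1 hs
  rw [krullTopology_mem_nhds_one_iff]
  let B := Module.finBasis k E
  refine ⟨IntermediateField.adjoin k' (Set.range fun i => emb (B i : Ω)),
    IntermediateField.finiteDimensional_adjoin fun x _ => Algebra.IsIntegral.isIntegral x, fun σ hσ => hEs ?_⟩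
  refine (IntermediateField.mem_fixingSubgroup_iff _ _).2 fun x hx => ?_
  have h1 : ∀ i, ρ σ (B i : Ω) = B i := fun i => emb.injective (by
    refine (he _ _).trans ?_
    exact (IntermediateField.mem_fixingSubgroup_iff _ _).1 hσ _ (IntermediateField.subset_adjoin _ _ ⟨i, rfl⟩))
  have h2 : ((ρ σ).toLinearMap.comp E.val.toLinearMap) = E.val.toLinearMap := B.ext h1
  exact LinearMap.congr_fun h2 ⟨x, hx⟩

end restriction

section density
open Filter Topology

variable {p : ℕ} [Fact p.Prime]

/-- Elements of `ℚ̄_p` fixed by the decomposition group of a number field are limits of elements of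
that number field. -/
theorem mem_closure_range {Ω K : Type} [Field Ω] [Algebra ℚ Ω] [IsGalois ℚ Ω] [Field K] (κ : K →+* Ω) {H : Subgroup (Ω ≃ₐ[ℚ] Ω)}
    (hH : IsOpen (H : Set (Ω ≃ₐ[ℚ] Ω))) (hκ : ∀ x, (∀ h ∈ H, h x = x) → ∃ c, κ c = x) (emb : Ω →+* PadicAlgCl p)
    (ρ : (PadicAlgCl p ≃ₐ[ℚ_[p]] PadicAlgCl p) →* (Ω ≃ₐ[ℚ] Ω)) (he : ∀ σ x, emb (ρ σ x) = σ (emb x))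
    {x : PadicAlgCl p} (hx : ∀ σ, ρ σ ∈ H → σ x = x) : x ∈ closure (Set.range (emb.comp κ)) := by
  let T : Subring (PadicAlgCl p) := (emb.comp κ).range.topologicalClosure
  have hT : ∀ y : ℚ_[p], algebraMap ℚ_[p] (PadicAlgCl p) y ∈ T := by
    intro y
    change _ ∈ closure (Set.range (emb.comp κ))
    rw [Metric.mem_closure_iff]
    intro ε hε
    obtain ⟨r, hr⟩ := Padic.rat_dense p y hε
    have : CharZero Ω := algebraRat.charZero Ω
    have : CharZero K := (RingHom.charZero_iff κ.injective).2 this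
    refine ⟨_, ⟨(r : K), rfl⟩, ?_⟩
    have h1 : (emb.comp κ) (r : K) = algebraMap ℚ_[p] (PadicAlgCl p) (r : ℚ_[p]) := by
      rw [map_ratCast, map_ratCast]
    rw [h1, dist_eq_norm, ← map_sub]
    exact (PadicAlgCl.norm_extends p _).trans_lt hr
  let F := IntermediateField.adjoin ℚ_[p] (Set.range (emb.comp κ))
  have hF : x ∈ F := by
    rw [← InfiniteGalois.fixedField_fixingSubgroup F, IntermediateField.mem_fixedField_iff]
    intro σ hσ
    refine hx σ (mem_of_fixes_fixedField hH fun y hy => ?_)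
    obtain ⟨c, rfl⟩ := hκ y hy
    apply emb.injective
    rw [he]
    exact (IntermediateField.mem_fixingSubgroup_iff _ _).1 hσ _ (IntermediateField.subset_adjoin _ _ ⟨c, rfl⟩)
  have hF' : x ∈ Algebra.adjoin ℚ_[p] (Set.range (emb.comp κ)) := by
    rw [← IntermediateField.adjoin_toSubalgebra_of_isAlgebraic fun y _ => Algebra.IsAlgebraic.isAlgebraic y]
    exact hF
  change x ∈ T
  clear hF hx
  induction hF' using Algebra.adjoin_induction with
  | mem y hy => exact subset_closure hy
  | algebraMap y => exact hT y
  | add y z _ _ h1 h2 => exact T.add_mem h1 h2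
  | mul y z _ _ h1 h2 => exact T.mul_mem h1 h2

end density

section places
open NumberField IsDedekindDomain

variable {K : Type*} [Field K] [NumberField K]

theorem norm_le_one_of_integer {p : ℕ} [Fact p.Prime] (e : K →+* PadicAlgCl p) (x : 𝓞 K) : ‖e x‖ ≤ 1 := by
  let R := (PadicAlgCl.valued p).v.valuationSubring
  have hx : IsIntegral ℤ (e x) := (RingOfIntegers.isIntegral_coe x).map e.toIntAlgHom
  have h1 : IsIntegral R (e x) := hx.tower_top
  obtain ⟨y, hy⟩ := IsIntegrallyClosed.isIntegral_iff.1 h1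
  have h2 : Valued.v (e x) ≤ 1 := by rw [← hy]; exact y.2
  rw [PadicAlgCl.valuation_def] at h2
  exact_mod_cast h2

/-- Every finite place is induced by an embedding into some `ℚ̄_p`. -/
theorem exists_embedding (v : Pl K) : ∃ (p : ℕ) (_ : Fact p.Prime) (e : K →+* PadicAlgCl p),
    ∀ x y : K, ‖e x‖ < ‖e y‖ → v.valuation K x < v.valuation K y := by
  have hne : Ideal.absNorm v.asIdeal ≠ 1 := fun h => v.isPrime.ne_top (Ideal.absNorm_eq_one_iff.1 h)
  let p := (Ideal.absNorm v.asIdeal).minFac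
  have hp : Fact p.Prime := ⟨Nat.minFac_prime hne⟩
  let q : (K →ₐ[ℚ] PadicAlgCl p) → Ideal (𝓞 K) := fun e =>
    { carrier := {x | ‖e (algebraMap (𝓞 K) K x)‖ < 1}
      zero_mem' := by simp
      add_mem' := by
        intro x y hx hy
        have := (PadicAlgCl.isNonarchimedean p) (e (algebraMap (𝓞 K) K x)) (e (algebraMap (𝓞 K) K y))
        simp only [Set.mem_ofPred_eq] at hx hy ⊢
        rw [map_add, map_add]
        exact this.trans_lt (max_lt hx hy)
      smul_mem' := by
        intro c x hx
        simp only [Set.mem_ofPred_eq, smul_eq_mul] at hx ⊢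
        rw [map_mul, map_mul, norm_mul]
        exact (mul_le_of_le_one_left (norm_nonneg _) (norm_le_one_of_integer e.toRingHom c)).trans_lt hx }
  have hq : ∀ e x, x ∈ q e ↔ ‖e (algebraMap (𝓞 K) K x)‖ < 1 := fun _ _ => Iff.rfl
  have hprime : ∀ e, (q e).IsPrime := by
    intro e
    refine ⟨fun h => ?_, fun {x y} hxy => ?_⟩
    · have h1 : (1 : 𝓞 K) ∈ q e := h ▸ Submodule.mem_top
      rw [hq, map_one, map_one, norm_one] at h1
      exact lt_irrefl _ h1
    · rw [hq, hq]
      by_contra! h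
      rw [hq, map_mul, map_mul, norm_mul] at hxy
      exact absurd hxy (not_lt.2 (one_le_mul_of_one_le_of_one_le h.1 h.2))
  have hcover : ((v.asIdeal : Ideal (𝓞 K)) : Set (𝓞 K)) ⊆ ⋃ e ∈ ((Finset.univ : Finset (K →ₐ[ℚ] PadicAlgCl p)) : Set _), q e := by
    intro x hx
    by_contra hcon
    have h1 : ∀ e : K →ₐ[ℚ] PadicAlgCl p, ‖e x‖ = 1 := by
      intro e
      refine le_antisymm (norm_le_one_of_integer e.toRingHom x) (not_lt.1 fun h => hcon ?_)
      simp only [Finset.coe_univ, Set.mem_univ, Set.iUnion_true, Set.mem_iUnion]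
      exact ⟨e, h⟩
    have h2 : (p : ℤ) ∣ Algebra.norm ℤ x := by
      rw [Int.natCast_dvd, ← Ideal.absNorm_span_singleton]
      exact (Nat.minFac_dvd _).trans (Ideal.absNorm_dvd_absNorm_of_le ((Ideal.span_singleton_le_iff_mem _).2 hx))
    have h3 := Algebra.norm_eq_prod_embeddings ℚ (PadicAlgCl p) (x : K)
    have h4 : algebraMap ℚ (PadicAlgCl p) (Algebra.norm ℚ (x : K)) =
        algebraMap ℚ_[p] (PadicAlgCl p) ((Algebra.norm ℤ x : ℤ) : ℚ_[p]) := by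
      rw [← Algebra.coe_norm_int, map_intCast, map_intCast]
    have h5 := congrArg norm h3
    rw [h4, norm_prod, Finset.prod_congr rfl fun e _ => h1 e, Finset.prod_const_one] at h5
    have h6 : ‖((Algebra.norm ℤ x : ℤ) : ℚ_[p])‖ = 1 := (PadicAlgCl.norm_extends p _).symm.trans h5
    have h7 := (Padic.norm_intCast_lt_one_iff (p := p)).2 h2
    rw [h6] at h7
    exact lt_irrefl _ h7
  by_cases hK : Nonempty (K →ₐ[ℚ] PadicAlgCl p)
  swap
  · rw [not_nonempty_iff] at hK
    have h1 := hcover v.asIdeal.zero_mem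
    simp at h1
  obtain ⟨e₀⟩ := hK
  obtain ⟨e, -, he⟩ := (Ideal.subset_union_prime e₀ e₀ fun e _ _ _ => hprime e).1 hcover
  have heq : v.asIdeal = q e := v.isMaximal.eq_of_le (hprime e).ne_top he
  have hle : ∀ t : K, v.valuation K t ≤ 1 → ‖e t‖ ≤ 1 := by
    intro t ht
    obtain ⟨n, d, hnd⟩ := v.exists_primeCompl_mul_eq_of_integer t ht
    have hd : ‖e (algebraMap (𝓞 K) K d)‖ = 1 := by
      refine le_antisymm (norm_le_one_of_integer e.toRingHom _) (not_lt.1 fun h => ?_)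
      exact d.2 (heq.ge ((hq e _).2 h))
    have h1 : ‖e (t * algebraMap (𝓞 K) K d)‖ = ‖e (algebraMap (𝓞 K) K n)‖ := by rw [hnd]
    rw [map_mul, norm_mul, hd, mul_one] at h1
    rw [h1]
    exact norm_le_one_of_integer e.toRingHom n
  refine ⟨p, hp, e.toRingHom, fun x y hxy => ?_⟩
  by_contra hcon
  push Not at hcon
  have hx : x ≠ 0 := by
    rintro rfl
    rw [map_zero, le_zero_iff, map_eq_zero] at hcon
    rw [hcon] at hxy
    exact lt_irrefl _ hxy
  have h1 := hle (y / x) (by rw [map_div₀]; exact div_le_one_of_le₀ hcon zero_le)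
  rw [map_div₀, norm_div, div_le_one (norm_pos_iff.2 ((map_ne_zero e).2 hx))] at h1
  exact absurd hxy (not_lt.2 h1)

end places

section localGlobal
open Finset CentralExt Filter Topology

variable {Gt G : Type*} [Group Gt] [Group G] {Ω : Type} [Field Ω] [Algebra ℚ Ω] [IsGalois ℚ Ω] {ℓ : ℕ} [NeZero ℓ]

/-- Solvability of all the local embedding problems. -/
def LocallySolvable (X : CentralExt (Multiplicative (ZMod ℓ)) Gt G) (φ : (Ω ≃ₐ[ℚ] Ω) →* G) : Prop :=
  ∀ (p : ℕ) [Fact p.Prime] (ρ : (PadicAlgCl p ≃ₐ[ℚ_[p]] PadicAlgCl p) →* (Ω ≃ₐ[ℚ] Ω)) (emb : Ω →ₐ[ℚ] PadicAlgCl p),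
    Continuous ρ → (∀ σ x, emb (ρ σ x) = σ (emb x)) →
      ∃ ψ : (PadicAlgCl p ≃ₐ[ℚ_[p]] PadicAlgCl p) →* Gt,
        IsOpen (ψ.ker : Set (PadicAlgCl p ≃ₐ[ℚ_[p]] PadicAlgCl p)) ∧ X.π.comp ψ = φ.comp ρ

namespace Step
variable {X : CentralExt (Multiplicative (ZMod ℓ)) Gt G} {φ : (Ω ≃ₐ[ℚ] Ω) →* G} {ζ : Ωˣ}
    {H H₁ : Subgroup (Ω ≃ₐ[ℚ] Ω)} {S : Subgroup (Gt × (Ω ≃ₐ[ℚ] Ω))} {γ : Ω ≃ₐ[ℚ] Ω} {P : Step X φ ζ H H₁ S γ}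

theorem Model.γ_pow_A {K L : Type} [Field K] [Field L] [Algebra K L] {ζK : K} {a : Kˣ} {A : Ωˣ}
    (M : P.Model K L ζK a A) (i : ℕ) : (γ ^ i) (A : Ω) = ζ ^ i * A := by
  have hA : γ (A : Ω) = ζ * A := congrArg Units.val M.γ_A
  have hz : γ (ζ : Ω) = ζ := congrArg Units.val (P.fix γ P.mem)
  induction i with
  | zero => simp
  | succ i ih => rw [pow_succ', AlgEquiv.mul_apply, ih, map_mul, map_pow, hz, hA, pow_succ, mul_assoc]

theorem Model.κ_norm_sum {K L : Type} [Field K] [Field L] [Algebra K L] {ζK : K} {a : Kˣ} {A : Ωˣ}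
    (M : P.Model K L ζK a A) (c : ℕ → K) :
    M.κ (Algebra.norm K (∑ j ∈ range ℓ, algebraMap K L (c j) * (M.D.B : L) ^ j)) =
      ∏ i ∈ range ℓ, ∑ j ∈ range ℓ, M.κ (c j) * ((ζ : Ω) ^ i * A) ^ j := by
  rw [M.f_norm]
  refine prod_congr rfl fun i _ => ?_
  rw [map_sum, map_sum]
  refine sum_congr rfl fun j _ => ?_
  rw [map_mul, map_pow, M.f_algebraMap, M.f_B, map_mul, map_pow, M.γ_pow_A, M.smul_κ _ (_root_.pow_mem P.mem i)]

/-- The obstruction is a norm locally everywhere. -/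
theorem Model.mem_Pg_of_locallySolvable (hloc : LocallySolvable X φ) {K L : Type} [Field K] [NumberField K]
    [Field L] [NumberField L] [Algebra K L] {ζK : K} {a : Kˣ} {A : Ωˣ} (M : P.Model K L ζK a A) {g : Gt} {δ : Ωˣ}
    {b : Kˣ} {q : Amb Gt (Ω ≃ₐ[ℚ] Ω) Ωˣ} (O : P.Obstruction g δ (Units.map (M.κ : K →* Ω) b) q) (v : Pl K) :
    ∃ β : Lˣ, b / M.D.N β ∈ Pg ζK ℓ v := by
  obtain ⟨p, _, e, he⟩ := exists_embedding v
  have : CharZero Ω := algebraRat.charZero Ω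
  obtain ⟨emb, hemb⟩ : ∃ emb : Ω →ₐ[ℚ] PadicAlgCl p, ∀ x, emb (M.κ x) = e x := by
    let : Algebra K Ω := M.κ.toAlgebra
    let : Algebra K (PadicAlgCl p) := e.toAlgebra
    have : Algebra.IsAlgebraic K Ω := Algebra.IsAlgebraic.tower_top (K := ℚ) K
    let f : Ω →ₐ[K] PadicAlgCl p := IsAlgClosed.lift
    exact ⟨f.toRingHom.toRatAlgHom, fun x => f.commutes x⟩
  obtain ⟨ρ, hρ, hρe⟩ := exists_restriction (k' := ℚ_[p]) emb
  obtain ⟨ψ, hψo, hψ⟩ := hloc p ρ emb hρ hρe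
  obtain ⟨c, hc, hbc⟩ := O.exists_local_coeffs (emb : Ω →+* PadicAlgCl p) ρ hρ hρe ψ hψ hψo M.smul_A M.γ_A
  have hHo : IsOpen (H : Set (Ω ≃ₐ[ℚ] Ω)) := Subgroup.isOpen_mono P.le P.isOpen
  have hcl : ∀ j, ∃ u : ℕ → K, Tendsto (fun n => e (u n)) atTop (𝓝 (c j)) := by
    intro j
    obtain ⟨w, hw, hlim⟩ := mem_closure_iff_seq_limit.1
      (mem_closure_range M.κ hHo M.exists_κ (emb : Ω →+* PadicAlgCl p) ρ hρe (hc j))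
    choose u hu using hw
    refine ⟨u, ?_⟩
    convert hlim using 2 with n
    rw [← hu, ← hemb]; rfl
  choose u hu using hcl
  let β : ℕ → L := fun n => ∑ j ∈ range ℓ, algebraMap K L (u j n) * (M.D.B : L) ^ j
  have hβ : ∀ n, e (Algebra.norm K (β n)) =
      ∏ i ∈ range ℓ, ∑ j ∈ range ℓ, e (u j n) * (emb ζ ^ i * emb A) ^ j := by
    intro n
    rw [← hemb, M.κ_norm_sum, map_prod]
    refine prod_congr rfl fun i _ => ?_
    rw [map_sum]
    refine sum_congr rfl fun j _ => ?_
    rw [map_mul, map_pow, map_mul, map_pow, hemb]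
  have hlim : Tendsto (fun n => e (Algebra.norm K (β n))) atTop (𝓝 (e b)) := by
    have h1 : e b = ∏ i ∈ range ℓ, ∑ j ∈ range ℓ, c j * (emb ζ ^ i * emb A) ^ j := by
      rw [← hemb]; exact hbc
    rw [h1]
    simp_rw [hβ]
    exact tendsto_finsetProd _ fun i _ => tendsto_finsetSum _ fun j _ => (hu j).mul_const _
  have hb0 : e (b : K) ≠ 0 := (map_ne_zero e).2 b.ne_zero
  have hlim2 : Tendsto (fun n => ‖e b / e (Algebra.norm K (β n)) - 1‖) atTop (𝓝 0) := by
    have h1 := ((tendsto_const_nhds (x := e (b : K))).div hlim hb0).sub_const 1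
    rw [div_self hb0, sub_self] at h1
    simpa using h1.norm
  have hr0 : e ((ζK - 1) ^ ℓ) ≠ 0 := (map_ne_zero e).2 (pow_ne_zero _ (sub_ne_zero.2 (M.D.hζ.ne_one P.prime.one_lt)))
  obtain ⟨n, hn1, hn2⟩ := ((hlim.eventually_ne hb0).and (hlim2.eventually_lt_const (norm_pos_iff.2 hr0))).exists
  have hβ0 : β n ≠ 0 := by
    intro h
    have hfd : FiniteDimensional K L := FiniteDimensional.of_finrank_pos (by rw [M.D.hfin]; exact P.prime.pos)
    refine hn1 ?_
    rw [h, Algebra.norm_zero, map_zero]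
  refine ⟨Units.mk0 (β n) hβ0, (mem_Pg P.prime M.D.hζ).2 ⟨1, ?_⟩⟩
  rw [← map_pow]
  apply he
  rw [Units.val_one, one_pow, div_one, map_sub, map_one, Units.val_div_eq_div_val, map_div₀]
  exact hn2

/-- If all local embedding problems are solvable, the lift extends. -/
theorem exists_lift [IsAlgClosed Ω] (P : Step X φ ζ H H₁ S γ) (hodd : Odd ℓ) (hloc : LocallySolvable X φ) :
    ∃ S', X.IsLift φ H S' ∧ Cts S' := by
  have : CharZero Ω := algebraRat.charZero Ω
  obtain ⟨g, δ, b, q, O⟩ := P.exists_obstruction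
  obtain ⟨K, L, _, _, _, _, _, ζK, a, A, ⟨M⟩⟩ := P.exists_model
  obtain ⟨c, hc⟩ := M.exists_κ b fun h hh => congrArg Units.val (O.fixed hh)
  have hc0 : c ≠ 0 := by
    rintro rfl
    exact b.ne_zero (by rw [← hc, map_zero])
  obtain rfl : Units.map (M.κ : K →* Ω) (Units.mk0 c hc0) = b := Units.ext hc
  obtain ⟨y, hy⟩ := M.D.exists_norm_of_local hodd (M.mem_Pg_of_locallySolvable hloc O)
  exact M.exists_extension O (y := y) (by rw [hy])

end Step
end localGlobal

section rootOfUnityLift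
open CentralExt

/-- A subgroup of index `ℓ` in an `ℓ`-group, pulled back to a subgroup `H` mapping onto it. -/
theorem exists_index_prime {Λ G : Type*} [Group Λ] [Group G] {ℓ : ℕ} (hℓ : ℓ.Prime) (φ : Λ →* G) (H : Subgroup Λ) {n : ℕ}
    (hn : Nat.card (H.map φ) = ℓ ^ (n + 1)) :
    ∃ H₁ ≤ H, φ.ker ⊓ H ≤ H₁ ∧ Nat.card (H₁.map φ) = ℓ ^ n ∧ ∃ γ ∈ H, γ ∈ nor H₁ ∧
      (∀ i : ℤ, γ ^ i ∈ H₁ ↔ (ℓ : ℤ) ∣ i) ∧ ∀ h ∈ H, ∃ i : ℤ, h * γ ^ i ∈ H₁ := by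
  have : Fact ℓ.Prime := ⟨hℓ⟩
  have hfin : Finite (H.map φ) := Nat.finite_of_card_ne_zero (by rw [hn]; exact pow_ne_zero _ hℓ.ne_zero)
  obtain ⟨G₁, hG₁⟩ := Sylow.exists_subgroup_card_pow_prime ℓ (G := H.map φ) (n := n) (by rw [hn]; exact pow_dvd_pow _ n.le_succ)
  have hidx : G₁.index = ℓ := by
    have h1 := G₁.card_mul_index
    rw [hG₁, hn, pow_succ] at h1
    exact Nat.eq_of_mul_eq_mul_left (pow_pos hℓ.pos n) h1
  have hnor : G₁.Normal := Subgroup.normal_of_index_eq_minFac_card (by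
    rw [hidx, hn, hℓ.pow_minFac n.succ_ne_zero])
  let q : H →* (H.map φ) ⧸ G₁ := (QuotientGroup.mk' G₁).comp (φ.subgroupMap H)
  have hq : Function.Surjective q := (QuotientGroup.mk'_surjective G₁).comp (φ.subgroupMap_surjective H)
  have hcard : Nat.card ((H.map φ) ⧸ G₁) = ℓ := hidx
  have : Nontrivial ((H.map φ) ⧸ G₁) := by
    have : Finite ((H.map φ) ⧸ G₁) := inferInstance
    exact Finite.one_lt_card_iff_nontrivial.1 (by rw [hcard]; exact hℓ.one_lt)
  obtain ⟨y, hy⟩ := exists_ne (1 : (H.map φ) ⧸ G₁)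
  obtain ⟨γ, rfl⟩ := hq y
  have hmem : ∀ {h : Λ} (hh : h ∈ H), h ∈ q.ker.map H.subtype ↔ q ⟨h, hh⟩ = 1 := by
    intro h hh
    constructor
    · rintro ⟨x, hx, rfl⟩
      exact hx
    · intro hx
      exact ⟨⟨h, hh⟩, hx, rfl⟩
  have hq1 : ∀ x : H, q x = 1 ↔ φ.subgroupMap H x ∈ G₁ := fun x => QuotientGroup.eq_one_iff _
  refine ⟨q.ker.map H.subtype, ?_, ?_, ?_, γ, γ.2, ?_, ?_, ?_⟩
  · rintro _ ⟨x, -, rfl⟩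
    exact x.2
  · rintro h ⟨h1, h2⟩
    rw [hmem h2, hq1]
    convert G₁.one_mem
    exact Subtype.ext h1
  · have h1 : (q.ker.map H.subtype).map φ = G₁.map (H.map φ).subtype := by
      ext g
      constructor
      · rintro ⟨_, ⟨x, hx, rfl⟩, rfl⟩
        exact ⟨_, (hq1 x).1 hx, rfl⟩
      · rintro ⟨⟨_, x, hx, rfl⟩, hg, rfl⟩
        exact ⟨x, (hmem hx).2 ((hq1 ⟨x, hx⟩).2 hg), rfl⟩
    rw [h1, ← hG₁]
    exact Subgroup.card_map_of_injective (H.map φ).subtype_injective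
  · refine mem_nor.2 fun w => ?_
    have key : w ∈ H ↔ (γ : Λ) * w * (γ : Λ)⁻¹ ∈ H := by
      rw [Subgroup.mul_mem_cancel_right _ (inv_mem γ.2), Subgroup.mul_mem_cancel_left _ γ.2]
    constructor
    · intro hw
      have hwH : w ∈ H := by
        obtain ⟨x, -, rfl⟩ := hw
        exact x.2
      rw [hmem (key.1 hwH)]
      have h2 : (⟨_, key.1 hwH⟩ : H) = γ * ⟨w, hwH⟩ * γ⁻¹ := rfl
      rw [h2, map_mul, map_mul, (hmem hwH).1 hw, mul_one, map_inv, mul_inv_cancel]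
    · intro hw
      have hwH : w ∈ H := by
        rw [key]
        obtain ⟨x, -, hx⟩ := hw
        rw [← hx]
        exact x.2
      rw [hmem hwH]
      have h2 : (⟨_, key.1 hwH⟩ : H) = γ * ⟨w, hwH⟩ * γ⁻¹ := rfl
      have h3 := (hmem (key.1 hwH)).1 hw
      rw [h2, map_mul, map_mul, map_inv, conj_eq_one_iff] at h3
      exact h3
  · intro i
    have h1 : orderOf (q γ) = ℓ := by
      refine orderOf_eq_prime ?_ hy
      rw [← hcard]
      exact pow_card_eq_one'
    rw [hmem (zpow_mem γ.2 i), ← h1, orderOf_dvd_iff_zpow_eq_one, ← map_zpow]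
    rfl
  · intro h hh
    obtain ⟨i, hi⟩ := mem_zpowers_of_prime_card (g := q γ) (g' := q ⟨h, hh⟩) hcard hy
    refine ⟨-i, ?_⟩
    rw [hmem (mul_mem hh (zpow_mem γ.2 _))]
    have h2 : (⟨_, mul_mem hh (zpow_mem γ.2 (-i))⟩ : H) = ⟨h, hh⟩ * γ ^ (-i) := rfl
    rw [h2, map_mul, map_zpow, ← hi, ← zpow_add, add_neg_cancel, zpow_zero]

variable {Gt G : Type*} [Group Gt] [Group G] {Ω : Type} [Field Ω] [Algebra ℚ Ω] [IsGalois ℚ Ω] {ℓ : ℕ} [NeZero ℓ]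

/-- If the local embedding problems are solvable, there is a lift over every open subgroup that
fixes a primitive `ℓ`-th root of unity. -/
theorem exists_lift_of_fix [IsAlgClosed Ω] (hℓ : ℓ.Prime) (hodd : Odd ℓ) {X : CentralExt (Multiplicative (ZMod ℓ)) Gt G}
    {φ : (Ω ≃ₐ[ℚ] Ω) →* G} (hφ : IsOpen (φ.ker : Set (Ω ≃ₐ[ℚ] Ω))) {ζ : Ωˣ} (hζ : IsPrimitiveRoot (ζ : Ω) ℓ)
    (hloc : LocallySolvable X φ) (n : ℕ) (H : Subgroup (Ω ≃ₐ[ℚ] Ω)) (hH : IsOpen (H : Set (Ω ≃ₐ[ℚ] Ω)))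
    (hHζ : ∀ h ∈ H, h • ζ = ζ) (hn : Nat.card (H.map φ) = ℓ ^ n) : ∃ S, X.IsLift φ H S ∧ Cts S := by
  induction n generalizing H with
  | zero =>
    rw [pow_zero, Subgroup.card_eq_one] at hn
    refine ⟨(⊥ : Subgroup Gt).prod H, ⟨fun hw => hw.2, ?_, fun hh => ⟨1, Subgroup.one_mem _, hh⟩, fun hg => hg.1⟩,
      H, hH, fun v hv => ⟨Subgroup.one_mem _, hv⟩⟩
    rintro ⟨g, h⟩ ⟨rfl, hh⟩
    have h1 : φ h ∈ H.map φ := ⟨h, hh, rfl⟩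
    rw [hn] at h1
    exact (map_one _).trans (Subgroup.mem_bot.1 h1).symm
  | succ n ih =>
    obtain ⟨H₁, hle, hker, hcard, γ, hγ, hnor, hpow, hex⟩ := exists_index_prime hℓ φ H hn
    obtain ⟨S, hS, hc⟩ := ih H₁ (Subgroup.isOpen_mono hker (isOpen_inf hφ hH)) (fun h hh => hHζ h (hle hh)) hcard
    exact Step.exists_lift ⟨hℓ, hζ, hHζ, hle, hγ, hnor, hpow, hex, hS, hc⟩ hodd hloc

end rootOfUnityLift

section coprimeTransfer
open CentralExt

theorem exists_normal_le_of_isOpen {Λ : Type*} [Group Λ] [TopologicalSpace Λ] [IsTopologicalGroup Λ] [CompactSpace Λ]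
    {V : Subgroup Λ} (hV : IsOpen (V : Set Λ)) : ∃ U ≤ V, U.Normal ∧ IsOpen (U : Set Λ) := by
  have h1 : Finite (Λ ⧸ V) := V.quotient_finite_of_isOpen hV
  have h2 : V.FiniteIndex := Subgroup.finiteIndex_of_finite_quotient
  exact ⟨V.normalCore, V.normalCore_le, inferInstance,
    Subgroup.isOpen_of_isClosed_of_finiteIndex _ (V.normalCore_isClosed (V.isClosed_of_isOpen hV))⟩

variable {Gt G : Type*} [Group Gt] [Group G] {ℓ : ℕ} {C : Type*} [CommGroup C]

/-- A lift over a normal subgroup of finite index gives a character of the fibre product that raises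
the central elements to the power of the index. -/
theorem CentralExt.IsLift.exists_transfer {Λ : Type*} [Group Λ] {X : CentralExt C Gt G} {φ : Λ →* G} {N : Subgroup Λ}
    [N.Normal] [N.FiniteIndex] {S : Subgroup (Gt × Λ)} (hS : X.IsLift φ N S) {E : Subgroup (Gt × Λ)}
    (hE : ∀ w, w ∈ E ↔ X.π w.1 = φ w.2) :
    ∃ V : E →* C, (∀ (c : C) (hc : (X.ι c, 1) ∈ E), V ⟨_, hc⟩ = c ^ N.index) ∧
      ∀ U : Subgroup Λ, U.Normal → (∀ u ∈ U, (1, u) ∈ S) → ∀ u ∈ U, ∀ hu : (1, u) ∈ E, V ⟨_, hu⟩ = 1 := by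
  classical
  let p : E →* Λ := (MonoidHom.snd Gt Λ).comp E.subtype
  have hp : Function.Surjective p := by
    intro h
    obtain ⟨g, hg⟩ := X.surj (φ h)
    exact ⟨⟨(g, h), (hE _).2 hg⟩, rfl⟩
  let E₁ : Subgroup E := N.comap p
  have hidx : E₁.index = N.index := Subgroup.index_comap_of_surjective N hp
  have hfi : E₁.FiniteIndex := ⟨by rw [hidx]; exact Subgroup.FiniteIndex.index_ne_zero⟩
  have hex : ∀ e : E₁, ∃ c, ((e : E) : Gt × Λ) * (X.ι c⁻¹, 1) ∈ S := by
    intro e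
    obtain ⟨g, hg⟩ := hS.lift (h := p e) e.2
    obtain ⟨c, hc⟩ := X.exists_mul_ι (((hE _).1 (e : E).2).trans (hS.proj hg).symm)
    refine ⟨c⁻¹, ?_⟩
    rw [inv_inv]
    convert hg using 1
    exact Prod.ext hc (mul_one _)
  choose r hr using hex
  have hruniq : ∀ (e : E₁) (c : C), ((e : E) : Gt × Λ) * (X.ι c⁻¹, 1) ∈ S → r e = c := by
    intro e c hc
    have h1 := S.mul_mem (S.inv_mem (hr e)) hc
    have h2 : (((e : E) : Gt × Λ) * (X.ι (r e)⁻¹, 1))⁻¹ * (((e : E) : Gt × Λ) * (X.ι c⁻¹, 1)) = (X.ι (r e * c⁻¹), 1) := by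
      rw [mul_inv_rev, mul_assoc, inv_mul_cancel_left]
      ext <;> simp
    rw [h2] at h1
    have h3 := hS.ker h1
    rw [← map_one X.ι] at h3
    exact mul_inv_eq_one.1 (X.inj h3)
  let R : E₁ →* C := MonoidHom.mk' r fun a b => hruniq _ _ (by
    convert S.mul_mem (hr a) (hr b) using 1
    refine Prod.ext ?_ ?_
    · change ((a : E) : Gt × Λ).1 * ((b : E) : Gt × Λ).1 * X.ι _ =
        ((a : E) : Gt × Λ).1 * X.ι _ * (((b : E) : Gt × Λ).1 * X.ι _)
      rw [mul_inv, map_mul, mul_assoc _ (X.ι _), ← mul_assoc (X.ι _) _ (X.ι _), X.central _ (((b : E) : Gt × Λ).1)]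
      simp only [mul_assoc]
    · change ((a : E) : Gt × Λ).2 * ((b : E) : Gt × Λ).2 * 1 = ((a : E) : Gt × Λ).2 * 1 * (((b : E) : Gt × Λ).2 * 1)
      simp only [mul_one])
  refine ⟨MonoidHom.transfer R, ?_, ?_⟩
  · intro c hc
    have hcomm : ∀ e : E, Commute (⟨_, hc⟩ : E) e := fun e =>
      Subtype.ext (Prod.ext (X.central _ _) ((one_mul _).trans (mul_one _).symm))
    have hkey : ∀ (k : ℕ) (e : E), e⁻¹ * (⟨_, hc⟩ : E) ^ k * e = (⟨_, hc⟩ : E) ^ k := by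
      intro k e
      rw [mul_assoc, ((hcomm e).pow_left k).eq, inv_mul_cancel_left]
    rw [MonoidHom.transfer_eq_pow R _ fun k e _ => hkey k e]
    refine hruniq _ _ ?_
    convert S.one_mem
    refine Prod.ext ?_ ?_
    · change X.ι c ^ E₁.index * _ = 1
      rw [hidx, ← map_pow, ← map_mul, mul_inv_cancel, map_one]
    · change (1 : Λ) ^ E₁.index * 1 = 1
      rw [one_pow, one_mul]
  · intro U hU hUS u hu huE
    have key : ∀ (n : ℕ) (e : E), ((e⁻¹ * (⟨_, huE⟩ : E) ^ n * e : E) : Gt × Λ) ∈ S := by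
      intro n e
      have h1 := hUS _ (hU.conj_mem _ (U.pow_mem hu n) (p e)⁻¹)
      convert h1 using 1
      refine Prod.ext ?_ ?_
      · change (e : Gt × Λ).1⁻¹ * 1 ^ n * (e : Gt × Λ).1 = 1
        rw [one_pow, mul_one, inv_mul_cancel]
      · change (e : Gt × Λ).2⁻¹ * u ^ n * (e : Gt × Λ).2 = (e : Gt × Λ).2⁻¹ * u ^ n * (e : Gt × Λ).2⁻¹⁻¹
        rw [inv_inv]
    have : Fintype (Quotient (MulAction.orbitRel (Subgroup.zpowers (⟨_, huE⟩ : E)) (E ⧸ E₁))) := Fintype.ofFinite _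
    rw [MonoidHom.transfer_eq_prod_quotient_orbitRel_zpowers_quot R]
    refine Finset.prod_eq_one fun q _ => hruniq _ _ ?_
    rw [inv_one, map_one, ← Prod.one_eq_mk, mul_one]
    exact key _ _

/-- A continuous lift over an open normal subgroup of index prime to the exponent of the kernel yields a continuous
lift over the whole group. -/
theorem exists_hom_of_lift {Λ : Type*} [Group Λ] [TopologicalSpace Λ] [IsTopologicalGroup Λ] [CompactSpace Λ]
    {X : CentralExt C Gt G} {φ : Λ →* G} {N : Subgroup Λ} [N.Normal] [N.FiniteIndex]
    {S : Subgroup (Gt × Λ)} (hS : X.IsLift φ N S) (hc : Cts S) {m : ℕ} (hm : ∀ c : C, (c ^ N.index) ^ m = c) :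
    ∃ φt : Λ →* Gt, IsOpen (φt.ker : Set Λ) ∧ X.π.comp φt = φ := by
  let E : Subgroup (Gt × Λ) := (X.π.comp (MonoidHom.fst Gt Λ)).eqLocus (φ.comp (MonoidHom.snd Gt Λ))
  have hE : ∀ w, w ∈ E ↔ X.π w.1 = φ w.2 := fun w => Iff.rfl
  obtain ⟨V, hV, hVU⟩ := hS.exists_transfer hE
  let p : E →* Λ := (MonoidHom.snd Gt Λ).comp E.subtype
  have hp : Function.Surjective p := by
    intro h
    obtain ⟨g, hg⟩ := X.surj (φ h)
    exact ⟨⟨(g, h), (hE _).2 hg⟩, rfl⟩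
  let Ψ : E →* Gt := MonoidHom.mk' (fun e => (e : Gt × Λ).1 * X.ι ((V e ^ m)⁻¹)) fun a b => by
    rw [map_mul, mul_pow, mul_inv, map_mul]
    change ((a : Gt × Λ).1 * (b : Gt × Λ).1) * _ = _
    rw [mul_assoc _ (X.ι _), ← mul_assoc (X.ι _) _ (X.ι _), X.central _ ((b : Gt × Λ).1)]
    simp only [mul_assoc]
  have hker : p.ker ≤ Ψ.ker := by
    rintro ⟨⟨g, h⟩, he⟩ (rfl : h = 1)
    obtain ⟨c, rfl⟩ := (X.exact g).1 (((hE _).1 he).trans (map_one φ))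
    change X.ι c * X.ι ((V ⟨_, he⟩ ^ m)⁻¹) = 1
    rw [hV c he, hm, ← map_mul, mul_inv_cancel, map_one]
  let φt : Λ →* Gt := p.liftOfSurjective hp ⟨Ψ, hker⟩
  have hφt : ∀ e : E, φt (p e) = Ψ e := fun e => p.liftOfRightInverse_comp_apply _ _ ⟨Ψ, hker⟩ e
  refine ⟨φt, ?_, ?_⟩
  · obtain ⟨W, hW, hWS⟩ := hc
    obtain ⟨U, hUW, hU, hUo⟩ := exists_normal_le_of_isOpen hW
    refine Subgroup.isOpen_mono (H₁ := U) (fun u hu => ?_) hUo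
    have huS := hWS u (hUW hu)
    have huE : (1, u) ∈ E := (hE _).2 (hS.proj huS)
    rw [MonoidHom.mem_ker]
    refine (hφt ⟨_, huE⟩).trans ?_
    change 1 * X.ι ((V ⟨_, huE⟩ ^ m)⁻¹) = 1
    rw [hVU U hU (fun u hu => hWS u (hUW hu)) u hu huE, one_pow, inv_one, map_one, one_mul]
  · ext h
    obtain ⟨e, rfl⟩ := hp h
    rw [MonoidHom.comp_apply, hφt]
    change X.π ((e : Gt × Λ).1 * X.ι _) = _
    rw [map_mul, X.π_ι, mul_one]
    exact (hE _).1 e.2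

end coprimeTransfer

section globalLift
variable {Gt G : Type*} [Group Gt] [Group G] {Ω : Type} [Field Ω] [Algebra ℚ Ω] [IsGalois ℚ Ω] {ℓ : ℕ} [NeZero ℓ]

/-- If all local embedding problems are solvable, a global continuous lift exists. -/
theorem exists_global_lift [IsAlgClosed Ω] (hℓ : ℓ.Prime) (hodd : Odd ℓ) {X : CentralExt (Multiplicative (ZMod ℓ)) Gt G}
    (hG : ∃ n, Nat.card G = ℓ ^ n) {φ : (Ω ≃ₐ[ℚ] Ω) →* G} (hφ : IsOpen (φ.ker : Set (Ω ≃ₐ[ℚ] Ω)))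
    (hloc : LocallySolvable X φ) : ∃ φt : (Ω ≃ₐ[ℚ] Ω) →* Gt, IsOpen (φt.ker : Set (Ω ≃ₐ[ℚ] Ω)) ∧ X.π.comp φt = φ := by
  have : Fact ℓ.Prime := ⟨hℓ⟩
  have : CharZero Ω := algebraRat.charZero Ω
  obtain ⟨z, hz⟩ := HasEnoughRootsOfUnity.exists_primitiveRoot Ω ℓ
  obtain ⟨ζ, rfl⟩ := hz.isUnit hℓ.ne_zero
  let N : Subgroup (Ω ≃ₐ[ℚ] Ω) := (hz.autToPow ℚ).ker
  have hNζ : ∀ h, h ∈ N ↔ h • ζ = ζ := by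
    intro h
    rw [Units.ext_iff]
    change _ ↔ h (ζ : Ω) = ζ
    rw [← hz.autToPow_spec ℚ h, MonoidHom.mem_ker]
    constructor
    · intro h1
      rw [h1, Units.val_one, ZMod.val_one, pow_one]
    · intro h1
      have h2 := hz.pow_inj (ZMod.val_lt _) hℓ.one_lt (h1.trans (pow_one _).symm)
      refine Units.ext (ZMod.val_injective ℓ ?_)
      rw [h2, Units.val_one, ZMod.val_one]
  have hNo : IsOpen (N : Set (Ω ≃ₐ[ℚ] Ω)) := by
    have : FiniteDimensional ℚ (IntermediateField.adjoin ℚ {(ζ : Ω)}) :=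
      IntermediateField.adjoin.finiteDimensional (Algebra.IsIntegral.isIntegral _)
    refine Subgroup.isOpen_mono (fun h hh => ?_) (IntermediateField.fixingSubgroup_isOpen (IntermediateField.adjoin ℚ {(ζ : Ω)}))
    rw [hNζ]
    exact Units.ext (hh ⟨_, IntermediateField.mem_adjoin_simple_self ℚ _⟩)
  have hdvd : N.index ∣ ℓ - 1 := by
    rw [Subgroup.index_ker, ← Nat.totient_prime hℓ, ← ZMod.card_units_eq_totient, ← Nat.card_eq_fintype_card]
    exact Subgroup.card_subgroup_dvd_card _
  have hne : N.index ≠ 0 := fun h => by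
    rw [h, zero_dvd_iff] at hdvd
    have := hℓ.two_le
    omega
  have hfi : N.FiniteIndex := ⟨hne⟩
  have hcop : Nat.Coprime N.index ℓ := by
    refine Nat.Coprime.coprime_dvd_left hdvd ?_
    rw [Nat.coprime_comm, hℓ.coprime_iff_not_dvd]
    intro h
    have h1 := Nat.le_of_dvd (Nat.sub_pos_of_lt hℓ.one_lt) h
    have := hℓ.two_le
    omega
  obtain ⟨n, hn⟩ := hG
  obtain ⟨j, -, hj⟩ := (Nat.dvd_prime_pow hℓ).1 (hn ▸ Subgroup.card_subgroup_dvd_card (N.map φ))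
  obtain ⟨S, hS, hc⟩ := exists_lift_of_fix hℓ hodd hφ hz hloc j N hNo (fun h hh => (hNζ h).1 hh) hj
  obtain ⟨m, -, hm⟩ := Nat.exists_mul_mod_eq_one_of_coprime hcop hℓ.one_lt
  refine exists_hom_of_lift hS hc (m := m) fun c => ?_
  have hcard : Nat.card (Multiplicative (ZMod ℓ)) = ℓ := Nat.card_zmod ℓ
  rw [← pow_mul, ← pow_mod_natCard, hcard, hm, pow_one]

end globalLift

section surjectivity

/-- A homomorphism is continuous for the discrete topology iff its kernel is open. -/
theorem isOpen_ker_iff {Λ H : Type*} [Group Λ] [TopologicalSpace Λ] [IsTopologicalGroup Λ] [Group H] (f : Λ →* H) :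
    IsOpen (f.ker : Set Λ) ↔ @Continuous Λ H _ ⊥ f := by
  let : TopologicalSpace H := ⊥
  have : DiscreteTopology H := ⟨rfl⟩
  constructor
  · intro h
    refine continuous_of_continuousAt_one f ?_
    rw [ContinuousAt, map_one, nhds_discrete H, Filter.tendsto_pure]
    exact h.mem_nhds f.ker.one_mem
  · intro h
    have h1 : IsOpen ({1} : Set H) := isOpen_discrete _
    exact h1.preimage h

/-- For a non-split central extension by a group of prime order, every lift of a surjection is surjective. -/
theorem CentralExt.surjective_of_not_split {Gt G Λ : Type*} [Group Gt] [Group G] [Group Λ] {ℓ : ℕ} (hℓ : ℓ.Prime)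
    (X : CentralExt (Multiplicative (ZMod ℓ)) Gt G) (hX : ¬ ∃ j : G →* Gt, X.π.comp j = MonoidHom.id G)
    {φ : Λ →* G} (hφ : Function.Surjective φ) {φt : Λ →* Gt} (h : X.π.comp φt = φ) : Function.Surjective φt := by
  have : Fact (Nat.card (Multiplicative (ZMod ℓ))).Prime := ⟨by rw [show Nat.card (Multiplicative (ZMod ℓ)) = ℓ from Nat.card_zmod ℓ]; exact hℓ⟩
  have hπ : ∀ x, X.π (φt x) = φ x := fun x => DFunLike.congr_fun h x
  obtain h1 | h1 := Subgroup.eq_bot_or_eq_top_of_prime_card (φt.range.comap X.ι)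
  · refine absurd ⟨φ.liftOfSurjective hφ ⟨φt, fun x hx => ?_⟩, ?_⟩ hX
    · rw [MonoidHom.mem_ker] at hx ⊢
      obtain ⟨c, hc⟩ := (X.exact (φt x)).1 ((hπ x).trans hx)
      have h2 : c ∈ φt.range.comap X.ι := ⟨x, hc.symm⟩
      rw [h1, Subgroup.mem_bot] at h2
      rw [← hc, h2, map_one]
    · ext g
      obtain ⟨x, rfl⟩ := hφ g
      rw [MonoidHom.comp_apply, MonoidHom.liftOfRightInverse_comp_apply]
      exact hπ x
  · intro g
    obtain ⟨x, hx⟩ := hφ (X.π g)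
    obtain ⟨c, hc⟩ := X.exists_mul_ι ((hπ x).trans hx)
    obtain ⟨y, hy⟩ : c ∈ φt.range.comap X.ι := by rw [h1]; exact Subgroup.mem_top c
    exact ⟨x * y, by rw [map_mul, hy, hc]⟩

/-- An algebraically closed algebraic extension of `ℚ` is Galois. -/
theorem isGalois_rat {Ω : Type*} [Field Ω] [IsAlgClosed Ω] [Algebra ℚ Ω] [Algebra.IsAlgebraic ℚ Ω] : IsGalois ℚ Ω := by
  have : Normal ℚ Ω := normal_iff.2 fun x => ⟨Algebra.IsIntegral.isIntegral x, IsAlgClosed.splits _⟩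
  constructor

theorem isGalois_algebraicClosure_rat : IsGalois ℚ (AlgebraicClosure ℚ) := by
  have h : Algebra.IsAlgebraic ℚ (AlgebraicClosure ℚ) := by
    convert AlgebraicClosure.isAlgebraic ℚ
    · rfl
    · exact Subsingleton.elim _ _
  exact isGalois_rat

end surjectivity

end EmbeddingProblem

/-- Let `ℓ` be an odd prime, `G` a finite `ℓ`-group, and
`1 → ℤ/ℓℤ → G̃ →^π G → 1` a non-split central extension.  Let `φ : Gal(ℚ̄/ℚ) ↠ G` be a
continuous surjection.  For a prime `p` and a map `ρ : Gal(ℚ̄_p/ℚ_p) → Gal(ℚ̄/ℚ)` induced by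
an embedding `ι : ℚ̄ ↪ ℚ̄_p`, the local map `φ_p : Gal(ℚ̄_p/ℚ_p) ↠ G_p` onto the decomposition
group `G_p` is `φ ∘ ρ` (corestricted to its image), and a solution of the local embedding
problem at `p` is a continuous homomorphism `ψ : Gal(ℚ̄_p/ℚ_p) → G̃` with `π ∘ ψ = φ ∘ ρ`
(such a `ψ` automatically takes values in `G̃_p = π⁻¹(G_p)`).  Then a continuous surjective
lift `φ̃ : Gal(ℚ̄/ℚ) ↠ G̃` of `φ` exists if and only if the local embedding problem is
solvable at every prime `p`. -/
theorem global_lift_exists_iff_local_embedding_problems_solvable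
    (ℓ : ℕ) (hℓ : ℓ.Prime) (hodd : Odd ℓ)
    (G Gt : Type*) [Group Gt] [Group G] [Finite G]
    (hG : ∃ n : ℕ, Nat.card G = ℓ ^ n)
    (ι : Multiplicative (ZMod ℓ) →* Gt) (π : Gt →* G)
    (hι : Function.Injective ι) (hπ : Function.Surjective π)
    (hexact : ι.range = π.ker) (hcentral : ι.range ≤ Subgroup.center Gt)
    (hnonsplit : ¬ ∃ j : G →* Gt, π.comp j = MonoidHom.id G)
    (φ : AbsGaloisGroupQ →* G) (hφ : Function.Surjective φ)
    (hφcont : @Continuous AbsGaloisGroupQ G _ ⊥ φ) :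
    (∃ φt : AbsGaloisGroupQ →* Gt,
        @Continuous AbsGaloisGroupQ Gt _ ⊥ φt ∧ Function.Surjective φt ∧ π.comp φt = φ) ↔
      ∀ (p : ℕ) [Fact p.Prime]
        (ρ : AbsGaloisGroupQp p →* AbsGaloisGroupQ)
        (emb : AlgebraicClosure ℚ →ₐ[ℚ] AlgebraicClosure ℚ_[p]),
        Continuous ρ →
        (∀ (σ : AbsGaloisGroupQp p) (x : AlgebraicClosure ℚ), emb (ρ σ x) = σ (emb x)) →
        ∃ ψ : AbsGaloisGroupQp p →* Gt,
          @Continuous (AbsGaloisGroupQp p) Gt _ ⊥ ψ ∧ π.comp ψ = φ.comp ρ := by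
  constructor
  · rintro ⟨φt, hc, -, rfl⟩ p _ ρ emb hρ -
    let : TopologicalSpace Gt := ⊥
    exact ⟨φt.comp ρ, hc.comp hρ, rfl⟩
  · intro hloc
    have : NeZero ℓ := ⟨hℓ.ne_zero⟩
    have := EmbeddingProblem.isGalois_algebraicClosure_rat
    let X : EmbeddingProblem.CentralExt (Multiplicative (ZMod ℓ)) Gt G :=
      { ι := ι, π := π, inj := hι, surj := hπ
        exact := fun g => by rw [← MonoidHom.mem_ker, ← hexact, MonoidHom.mem_range]
        central := fun k g => (Subgroup.mem_center_iff.1 (hcentral ⟨k, rfl⟩) g).symm }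
    obtain ⟨φt, hφt, hlift⟩ := EmbeddingProblem.exists_global_lift (X := X) hℓ hodd hG
      ((EmbeddingProblem.isOpen_ker_iff φ).2 hφcont) fun p _ ρ emb hρ hemb => by
        obtain ⟨ψ, hψ, h⟩ := hloc p ρ emb hρ hemb
        exact ⟨ψ, (EmbeddingProblem.isOpen_ker_iff ψ).2 hψ, h⟩
    exact ⟨φt, (EmbeddingProblem.isOpen_ker_iff φt).1 hφt,
      X.surjective_of_not_split hℓ hnonsplit hφ hlift, hlift⟩
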